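/- arXiv:2203.09273 — 2 statements merged into one kernel-verified Lean document; each statement's English description precedes it below -/
import Mathlib

section
/- Let k ≥ 2, fix α ∈ (0, 1/3), N ∈ ℕ, X = ⌊N^{1/k}⌋, and let ξ ∈ [0,1] lie on the minor arcs, i.e., for all q ≤ X^α and all a coprime to q one has |ξ − a/q| > X^{−k+α}. Then for every ε > 0 there is C_ε > 0 such that |f_X(ξ)| ≤ C_ε X^{1 + ε − α/(k(k−1))}, where f_X(ξ) = ∑_{n=1}^{X} e^{2πi ξ n^k}. -/
noncomputable def e (x : ℝ) : ℂ := Complex.exp (2 * Real.pi * Complex.I * x)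

noncomputable def weylSum (k X : ℕ) (ξ : ℝ) : ℂ :=
  ∑ n ∈ Finset.Icc 1 X, e (ξ * (n : ℝ) ^ k)

namespace MinorArc

open Finset Polynomial

/-! ### Exponential sums along the moment curve modulo `q` -/

/-- The polynomial phase `∑ u_j n ^ (j + 1)` without constant term. -/
def phase {k q : ℕ} (u : Fin k → ZMod q) (n : ℤ) : ZMod q :=
  ∑ j, u j * (n : ZMod q) ^ ((j : ℕ) + 1)

/-- The exponential sum with coefficients `a`, frequencies `n` and phase `u`. -/
noncomputable def expSum {k q : ℕ} [NeZero q] (a : ℕ → ℂ) (n : ℕ → ℤ) (S : Finset ℕ)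
    (u : Fin k → ZMod q) : ℂ :=
  ∑ i ∈ S, a i * ZMod.stdAddChar (phase u (n i))

/-- The indices in `S` whose frequency lies in the residue class `ρ` modulo `q`. -/
def residueClass {q : ℕ} (n : ℕ → ℤ) (S : Finset ℕ) (ρ : ZMod q) : Finset ℕ :=
  {i ∈ S | ((n i : ℤ) : ZMod q) = ρ}

lemma phase_add {k q : ℕ} (u v : Fin k → ZMod q) (n : ℤ) :
    phase (u + v) n = phase u n + phase v n := by
  simp [phase, add_mul, sum_add_distrib]

lemma norm_stdAddChar {q : ℕ} [NeZero q] (x : ZMod q) : ‖ZMod.stdAddChar x‖ = 1 :=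
  AddChar.norm_apply _ _

@[simp] lemma expSum_empty {k q : ℕ} [NeZero q] (a : ℕ → ℂ) (n : ℕ → ℤ)
    (u : Fin k → ZMod q) : expSum a n ∅ u = 0 := by simp [expSum]

lemma residueClass_subset {q : ℕ} (n : ℕ → ℤ) (S : Finset ℕ) (ρ : ZMod q) :
    residueClass n S ρ ⊆ S := filter_subset _ _

lemma mem_residueClass {q : ℕ} {n : ℕ → ℤ} {S : Finset ℕ} {ρ : ZMod q} {i : ℕ} :
    i ∈ residueClass n S ρ ↔ i ∈ S ∧ ((n i : ℤ) : ZMod q) = ρ := by simp [residueClass]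

/-- An exponential sum is the sum of its pieces over residue classes. -/
lemma expSum_eq_sum_residueClass {k q r : ℕ} [NeZero q] [NeZero r] (a : ℕ → ℂ) (n : ℕ → ℤ)
    (S : Finset ℕ) (u : Fin k → ZMod q) :
    expSum a n S u = ∑ ρ : ZMod r, expSum a n (residueClass n S ρ) u := by
  simp only [expSum, residueClass]
  exact (sum_fiberwise S (fun i => ((n i : ℤ) : ZMod r)) _).symm

/-- The `ℓ^P` decoupling inequality for the moment curve of degree `k` at the critical exponent
`P = k (k + 1)`, into residue classes modulo `p ^ B`, with constant `C`. -/
def Decoupling (p : ℕ) [NeZero p] (k B : ℕ) (C : ℝ) : Prop :=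
  ∀ (a : ℕ → ℂ) (n : ℕ → ℤ) (S : Finset ℕ),
    ∑ u : Fin k → ZMod (p ^ (k * B)), ‖expSum a n S u‖ ^ (k * (k + 1)) ≤
      C * ∑ ρ : ZMod (p ^ B), ∑ u : Fin k → ZMod (p ^ (k * B)),
        ‖expSum a n (residueClass n S ρ) u‖ ^ (k * (k + 1))

lemma Decoupling.mono {p : ℕ} [NeZero p] {k B : ℕ} {C C' : ℝ} (h : Decoupling p k B C)
    (hC : C ≤ C') : Decoupling p k B C' := fun a n S =>
  (h a n S).trans (mul_le_mul_of_nonneg_right hC (by positivity))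

lemma norm_expSum_shift {k q l r : ℕ} [NeZero q] [NeZero r] {a : ℕ → ℂ} {n z : ℕ → ℤ}
    {S : Finset ℕ} {t : Fin k → ZMod q} {v : Fin l → ZMod r} {c : ℂ} (hc : ‖c‖ = 1)
    (h : ∀ i ∈ S, ZMod.stdAddChar (phase t (n i)) = c * ZMod.stdAddChar (phase v (z i)))
    (u : Fin k → ZMod q) :
    ‖expSum a n S (u + t)‖ =
      ‖expSum (fun i => a i * ZMod.stdAddChar (phase u (n i))) z S v‖ := by
  have : expSum a n S (u + t) =
      c * expSum (fun i => a i * ZMod.stdAddChar (phase u (n i))) z S v := by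
    simp only [expSum, mul_sum]
    refine sum_congr rfl fun i hi => ?_
    rw [phase_add, AddChar.map_add_eq_mul, h i hi]
    ring
  rw [this, norm_mul, hc, one_mul]

/-- Decoupling of degree `l` transfers to weighted moments of degree `k` if the phases of degree
`l` in the variable `z` are realised by shifts which preserve the weight. -/
lemma Decoupling.transfer {p : ℕ} [NeZero p] {l L : ℕ} {C : ℝ} (hD : Decoupling p l L C)
    {k q : ℕ} [NeZero q] (a : ℕ → ℂ) (n z : ℕ → ℤ) (S : Finset ℕ)
    (w : (Fin k → ZMod q) → ℝ) (hw : ∀ u, 0 ≤ w u)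
    (hshift : ∀ v : Fin l → ZMod (p ^ (l * L)), ∃ t : Fin k → ZMod q, (∀ u, w (u + t) = w u) ∧
      ∃ c : ℂ, ‖c‖ = 1 ∧
        ∀ i ∈ S, ZMod.stdAddChar (phase t (n i)) = c * ZMod.stdAddChar (phase v (z i))) :
    ∑ u, w u * ‖expSum a n S u‖ ^ (l * (l + 1)) ≤
      C * ∑ ρ : ZMod (p ^ L), ∑ u, w u * ‖expSum a n (residueClass z S ρ) u‖ ^ (l * (l + 1)) := by
  choose t htw c hc ht using hshift
  have key : ∀ S' ⊆ S, (Fintype.card (Fin l → ZMod (p ^ (l * L))) : ℝ) *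
      ∑ u, w u * ‖expSum a n S' u‖ ^ (l * (l + 1)) =
      ∑ u, w u * ∑ v : Fin l → ZMod (p ^ (l * L)),
        ‖expSum (fun i => a i * ZMod.stdAddChar (phase u (n i))) z S' v‖ ^ (l * (l + 1)) := by
    intro S' hS'
    simp_rw [mul_sum]
    rw [sum_comm, ← mul_sum, ← nsmul_eq_mul, ← card_univ, ← sum_const]
    refine sum_congr rfl fun v _ => ?_
    rw [← Equiv.sum_comp (Equiv.addRight (t v))]
    refine sum_congr rfl fun u _ => ?_
    rw [Equiv.coe_addRight, htw, norm_expSum_shift (hc v) (fun i hi => ht v i (hS' hi))]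
  have hcard : (0 : ℝ) < Fintype.card (Fin l → ZMod (p ^ (l * L))) := by
    exact_mod_cast Fintype.card_pos
  refine le_of_mul_le_mul_left ?_ hcard
  rw [key S subset_rfl, mul_left_comm, mul_sum _ _ (Fintype.card _ : ℝ),
    sum_congr rfl fun ρ _ => key _ (residueClass_subset z S ρ), sum_comm, mul_sum]
  refine sum_le_sum fun u _ => ?_
  rw [← mul_sum, mul_left_comm]
  exact mul_le_mul_of_nonneg_left (hD _ _ _) (hw u)

/-! ### Realising low degree phases by shifts -/

/-- A phase modulo `p ^ m` given by a polynomial of degree at most `k` is, up to its constant term,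
a phase modulo `p ^ M`. -/
lemma exists_phase_eq_eval {p : ℕ} [NeZero p] {k m M : ℕ} (hm : m ≤ M)
    (Q : (ZMod (p ^ m))[X]) (hQ : Q.natDegree ≤ k) :
    ∃ t : Fin k → ZMod (p ^ M), ∃ c : ℂ, ‖c‖ = 1 ∧
      ∀ n : ℤ, ZMod.stdAddChar (phase t n) = c * ZMod.stdAddChar (Q.eval (n : ZMod (p ^ m))) := by
  refine ⟨fun j => ((p ^ (M - m) * (Q.coeff (j + 1)).val : ℤ) : ZMod (p ^ M)),
    ZMod.stdAddChar (-Q.coeff 0), norm_stdAddChar _, fun n => ?_⟩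
  have h1 : phase (fun j : Fin k => ((p ^ (M - m) * (Q.coeff (j + 1)).val : ℤ) : ZMod (p ^ M))) n
      = ((p ^ (M - m) * ∑ j : Fin k, (Q.coeff (j + 1)).val * n ^ ((j : ℕ) + 1) : ℤ) :
        ZMod (p ^ M)) := by
    simp [phase, mul_sum, mul_assoc]
  have h2 : -Q.coeff 0 + Q.eval (n : ZMod (p ^ m)) =
      ((∑ j : Fin k, (Q.coeff (j + 1)).val * n ^ ((j : ℕ) + 1) : ℤ) : ZMod (p ^ m)) := by
    rw [eval_eq_sum_range' (Nat.lt_succ_of_le hQ), sum_range_succ']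
    simp [Finset.sum_range]
  rw [h1, ← AddChar.map_add_eq_mul, h2, ZMod.stdAddChar_coe, ZMod.stdAddChar_coe]
  congr 1
  have hp : (p : ℂ) ≠ 0 := by exact_mod_cast NeZero.ne p
  have hM : (p : ℂ) ^ M = p ^ (M - m) * p ^ m := by rw [← pow_add]; congr 1; omega
  push_cast
  rw [hM]
  field_simp

/-- If `1, …, k` and `τ` are invertible, every polynomial `Y` agrees modulo `X ^ (l + 1)` and up to
a constant with a translate by `τ` of a combination of `X ^ (k - l + 1), …, X ^ k`. -/
lemma exists_comp_eq {R : Type*} [CommRing R] {h l : ℕ} (hl : 1 ≤ l)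
    (hunit : ∀ j : ℕ, 1 ≤ j → j ≤ h + l → IsUnit (j : R)) {τ : R} (hτ : IsUnit τ) (Y : R[X]) :
    ∃ H : R[X], H.natDegree ≤ h + l ∧ X ^ (h + 1) ∣ H ∧
      ∃ (c : R) (G : R[X]), H.comp (X + C τ) = Y + C c + X ^ (l + 1) * G := by
  nontriviality R
  have hcop : IsCoprime ((X + C τ : R[X]) ^ h) (X ^ l) := by
    refine IsCoprime.pow ?_
    obtain ⟨s, hs⟩ := hτ.exists_left_inv
    exact ⟨C s, -C s, by rw [mul_add, ← C_mul, hs]; simp⟩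
  obtain ⟨A, D, hAD⟩ := hcop
  set r : R[X] := (derivative Y * A) %ₘ X ^ l with hr
  have hrdeg : r.degree < l := by
    simpa using degree_modByMonic_lt (derivative Y * A) (monic_X_pow l)
  have hr' : r + X ^ l * ((derivative Y * A) /ₘ X ^ l) = derivative Y * A :=
    modByMonic_add_div _ _
  -- `g` is the derivative of the polynomial to be constructed
  set g : R[X] := X ^ h * r.comp (X - C τ) with hg
  have hgdeg : g.natDegree < h + l := by
    have h1 : (r.comp (X - C τ)).natDegree < l := by
      refine natDegree_comp_le.trans_lt ?_
      rw [natDegree_X_sub_C, mul_one]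
      by_cases h0 : r = 0
      · rw [h0, natDegree_zero]; omega
      · exact (natDegree_lt_iff_degree_lt h0).2 hrdeg
    refine (natDegree_mul_le.trans_lt ?_)
    rw [natDegree_X_pow]; omega
  choose! inv hinv using fun j (hj : 1 ≤ j ∧ j ≤ h + l) => (hunit j hj.1 hj.2).exists_left_inv
  set H : R[X] := ∑ j ∈ Icc (h + 1) (h + l), monomial j (inv j * g.coeff (j - 1)) with hH
  have hgcoeff : ∀ j < h, g.coeff j = 0 := fun j hj => by
    rw [hg, coeff_X_pow_mul', if_neg (by omega)]
  have hHcoeff : ∀ j, H.coeff j =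
      if j ∈ Icc (h + 1) (h + l) then inv j * g.coeff (j - 1) else 0 := fun j => by
    rw [hH, finsetSum_coeff]
    simp only [coeff_monomial]
    rw [Finset.sum_ite_eq']
  have hderiv : derivative H = g := by
    ext j
    rw [coeff_derivative, hHcoeff]
    split_ifs with hj
    · rw [mem_Icc] at hj
      have := hinv (j + 1) ⟨by omega, hj.2⟩
      rw [Nat.add_sub_cancel, mul_right_comm]
      push_cast at this
      rw [this, one_mul]
    · rw [mem_Icc, not_and_or] at hj
      rw [zero_mul]
      by_cases hjh : j < h
      · exact (hgcoeff j hjh).symm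
      · exact (coeff_eq_zero_of_natDegree_lt (by omega)).symm
  refine ⟨H, ?_, ?_, ?_⟩
  · refine natDegree_le_iff_coeff_eq_zero.2 fun j hj => ?_
    rw [hHcoeff, if_neg (by rw [mem_Icc]; omega)]
  · refine X_pow_dvd_iff.2 fun j hj => ?_
    rw [hHcoeff, if_neg (by rw [mem_Icc]; omega)]
  · set F : R[X] := H.comp (X + C τ) - Y with hF
    have hFd : X ^ l ∣ derivative F := by
      have h1 : derivative F = (X + C τ) ^ h * r - derivative Y := by
        rw [hF, derivative_sub, derivative_comp, hderiv, hg]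
        simp [mul_comp, comp_assoc]
      refine ⟨-(derivative Y * D) - (X + C τ) ^ h * ((derivative Y * A) /ₘ X ^ l), ?_⟩
      rw [h1, eq_sub_of_add_eq hr']
      linear_combination (derivative Y) * hAD
    have hFc : ∀ j, 1 ≤ j → j ≤ l → F.coeff j = 0 := fun j hj hjl => by
      have h1 := X_pow_dvd_iff.1 hFd (j - 1) (by omega)
      rw [coeff_derivative, Nat.sub_add_cancel hj] at h1
      have h2 := hunit j hj (by omega)
      have h3 : ((j - 1 : ℕ) : R) + 1 = j := by
        rw [Nat.cast_sub hj]; push_cast; ring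
      rw [h3] at h1
      exact (h2.mul_left_eq_zero).1 h1
    have hdvd : X ^ (l + 1) ∣ F - C (F.coeff 0) := by
      refine X_pow_dvd_iff.2 fun j hj => ?_
      rw [coeff_sub, coeff_C]
      split_ifs with h0
      · rw [h0, sub_self]
      · rw [hFc j (by omega) (by omega), sub_zero]
    obtain ⟨G, hG⟩ := hdvd
    exact ⟨F.coeff 0, G, by linear_combination hG⟩

/-- A phase of degree `l` in `z`, viewed at the finer level. -/
lemma stdAddChar_phase_eq {p : ℕ} [NeZero p] {l c c₁ : ℕ} (hc : c ≤ c₁)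
    (v : Fin l → ZMod (p ^ (l * (c₁ - c)))) (z : ℤ) :
    ZMod.stdAddChar (phase v z) = ZMod.stdAddChar ((∑ i : Fin l,
      C (((v i).val : ZMod (p ^ (l * c₁))) * (p : ZMod (p ^ (l * c₁))) ^ (c * (l - (i + 1)))) *
        X ^ ((i : ℕ) + 1)).eval ((p : ZMod (p ^ (l * c₁))) ^ c * (z : ZMod (p ^ (l * c₁))))) := by
  have h1 : phase v z = ((∑ i : Fin l, (v i).val * z ^ ((i : ℕ) + 1) : ℤ) :
      ZMod (p ^ (l * (c₁ - c)))) := by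
    simp [phase]
  have h2 : (∑ i : Fin l,
      C (((v i).val : ZMod (p ^ (l * c₁))) * (p : ZMod (p ^ (l * c₁))) ^ (c * (l - (i + 1)))) *
        X ^ ((i : ℕ) + 1)).eval ((p : ZMod (p ^ (l * c₁))) ^ c * (z : ZMod (p ^ (l * c₁)))) =
      ((p ^ (l * c) * ∑ i : Fin l, (v i).val * z ^ ((i : ℕ) + 1) : ℤ) : ZMod (p ^ (l * c₁))) := by
    rw [eval_finsetSum]
    push_cast
    rw [mul_sum]
    refine sum_congr rfl fun i _ => ?_
    have : l * c = c * (l - (i + 1)) + c * ((i : ℕ) + 1) := by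
      rw [← mul_add, Nat.sub_add_cancel i.2, mul_comm]
    simp only [eval_mul, eval_C, eval_pow, eval_X]
    rw [this, pow_add, mul_pow, ← pow_mul]
    ring
  rw [h1, h2, ZMod.stdAddChar_coe, ZMod.stdAddChar_coe]
  congr 1
  have hp : (p : ℂ) ≠ 0 := by exact_mod_cast NeZero.ne p
  have hM : (p : ℂ) ^ (l * c₁) = p ^ (l * c) * p ^ (l * (c₁ - c)) := by
    rw [← pow_add, ← mul_add, Nat.add_sub_cancel' hc]
  push_cast
  rw [hM]
  field_simp

/-- Phases of degree `k` on a residue class modulo `p ^ b` are realised by shifts. -/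
lemma exists_shift_of_degree_eq {p : ℕ} [NeZero p] {k b B M : ℕ} (hb : b ≤ B) (hM : k * B ≤ M)
    (η : ℤ) (v : Fin k → ZMod (p ^ (k * (B - b)))) :
    ∃ t : Fin k → ZMod (p ^ M), ∃ c : ℂ, ‖c‖ = 1 ∧
      ∀ z : ℤ, ZMod.stdAddChar (phase t (η + p ^ b * z)) = c * ZMod.stdAddChar (phase v z) := by
  set Y : (ZMod (p ^ (k * B)))[X] := ∑ i : Fin k,
      C (((v i).val : ZMod (p ^ (k * B))) * (p : ZMod (p ^ (k * B))) ^ (b * (k - (i + 1)))) *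
        X ^ ((i : ℕ) + 1) with hY
  have hdeg : Y.natDegree ≤ k := natDegree_sum_le_of_forall_le _ _ fun i _ =>
    (natDegree_C_mul_X_pow_le _ _).trans i.2
  obtain ⟨t, c, hc, ht⟩ := exists_phase_eq_eval (M := M) hM (Y.comp (X - C (η : ZMod _)))
    (natDegree_comp_le.trans ((Nat.mul_le_mul hdeg (natDegree_X_sub_C_le _)).trans_eq (mul_one k)))
  refine ⟨t, c, hc, fun z => ?_⟩
  rw [ht, stdAddChar_phase_eq hb, ← hY, eval_comp]
  simp

lemma isUnit_natCast_of_lt {p m j : ℕ} (hp : p.Prime) (h1 : 1 ≤ j) (h2 : j < p) :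
    IsUnit (j : ZMod (p ^ m)) :=
  (ZMod.isUnit_iff_coprime _ _).2
    (Nat.Coprime.pow_right m (Nat.coprime_of_lt_prime (by omega) h2 hp).symm)

lemma isUnit_intCast_of_not_dvd {p m : ℕ} (hp : p.Prime) {τ : ℤ} (h : ¬ (p : ℤ) ∣ τ) :
    IsUnit (τ : ZMod (p ^ m)) := by
  have h1 : IsCoprime τ (p : ℤ) := ((Nat.prime_iff_prime_int.1 hp).coprime_iff_not_dvd.2 h).symm
  obtain ⟨x, y, hxy⟩ := h1.pow_right (n := m)
  have h2 := congrArg (Int.cast : ℤ → ZMod (p ^ m)) hxy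
  push_cast at h2
  rw [← Nat.cast_pow, ZMod.natCast_self, mul_zero, add_zero] at h2
  exact IsUnit.of_mul_eq_one_right _ h2

/-- Phases of degree `l < k` on a residue class modulo `p ^ c` are realised by shifts which are
constant on a transversal residue class modulo `p ^ b`. -/
lemma exists_shift_of_degree_lt {p : ℕ} (hp : p.Prime) [NeZero p] {k l b c c₁ M : ℕ} (hkp : k < p)
    (hl : 1 ≤ l) (hlk : l ≤ k) (hc : c ≤ c₁) (hc₁ : l * c₁ ≤ (l + 1) * c)
    (hb : l * c₁ ≤ (k - l + 1) * b) (hM : l * c₁ ≤ M) {ξ η : ℤ} (hξη : ¬ (p : ℤ) ∣ ξ - η)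
    (v : Fin l → ZMod (p ^ (l * (c₁ - c)))) :
    ∃ t : Fin k → ZMod (p ^ M),
      (∃ d : ℂ, ‖d‖ = 1 ∧
        ∀ z : ℤ, ZMod.stdAddChar (phase t (ξ + p ^ c * z)) = d * ZMod.stdAddChar (phase v z)) ∧
      ∃ d : ℂ, ‖d‖ = 1 ∧ ∀ z : ℤ, ZMod.stdAddChar (phase t (η + p ^ b * z)) = d := by
  set Y : (ZMod (p ^ (l * c₁)))[X] := ∑ i : Fin l,
      C (((v i).val : ZMod (p ^ (l * c₁))) * (p : ZMod (p ^ (l * c₁))) ^ (c * (l - (i + 1)))) *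
        X ^ ((i : ℕ) + 1) with hY
  obtain ⟨H, hHdeg, ⟨H', hH'⟩, s, G, hG⟩ := exists_comp_eq (R := ZMod (p ^ (l * c₁)))
    (h := k - l) hl (fun j hj hj' => isUnit_natCast_of_lt hp hj (by omega))
    (isUnit_intCast_of_not_dvd hp hξη) Y
  rw [Nat.sub_add_cancel hlk] at hHdeg
  have hzero : ∀ j, l * c₁ ≤ j → (p : ZMod (p ^ (l * c₁))) ^ j = 0 := fun j hj => by
    rw [← Nat.cast_pow, ZMod.natCast_eq_zero_iff]
    exact pow_dvd_pow p hj
  obtain ⟨t, d, hd, ht⟩ := exists_phase_eq_eval (M := M) hM (H.comp (X - C (η : ZMod _)))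
    (natDegree_comp_le.trans ((Nat.mul_le_mul hHdeg (natDegree_X_sub_C_le _)).trans_eq (mul_one k)))
  refine ⟨t, ⟨d * ZMod.stdAddChar s, by rw [norm_mul, hd, norm_stdAddChar, one_mul], fun z => ?_⟩,
    d, hd, fun z => ?_⟩
  · rw [ht, stdAddChar_phase_eq hc, ← hY, mul_assoc, ← AddChar.map_add_eq_mul]
    have h1 := congrArg (eval ((p : ZMod (p ^ (l * c₁))) ^ c * z)) hG
    simp only [eval_comp, eval_add, eval_mul, eval_pow, eval_X, eval_C] at h1
    rw [mul_pow, ← pow_mul, hzero (c * (l + 1)) (by rw [mul_comm c]; exact hc₁), zero_mul, zero_mul,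
      add_zero]
      at h1
    rw [add_comm s, ← h1, eval_comp]
    congr 3
    simp
    ring
  · rw [ht, eval_comp, hH']
    simp only [Int.cast_add, eval_sub, eval_X, eval_C, eval_mul, eval_pow]
    push_cast
    rw [add_sub_cancel_left, mul_pow, ← pow_mul, hzero _ (by rw [mul_comm b]; exact hb)]
    simp

/-! ### Decoupling on residue classes -/

lemma sum_residueClass_le {p : ℕ} [NeZero p] {b B : ℕ} (hb : b ≤ B) {S : Finset ℕ} {n z : ℕ → ℤ}
    {η : ℤ} (h : ∀ i ∈ S, n i = η + p ^ b * z i) (F : Finset ℕ → ℝ) (hF : ∀ S, 0 ≤ F S) :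
    ∑ r : ZMod (p ^ (B - b)), F (residueClass z S r) ≤
      ∑ ρ : ZMod (p ^ B), F (residueClass n S ρ) := by
  have hB : (p ^ B : ℤ) = p ^ b * p ^ (B - b) := by rw [← pow_add, Nat.add_sub_cancel' hb]
  have hp : (p ^ b : ℤ) ≠ 0 := pow_ne_zero _ (by exact_mod_cast NeZero.ne p)
  have key : ∀ x y : ℤ, ((η + p ^ b * x : ℤ) : ZMod (p ^ B)) =
      ((η + p ^ b * y : ℤ) : ZMod (p ^ B)) ↔
      (x : ZMod (p ^ (B - b))) = (y : ZMod (p ^ (B - b))) := fun x y => by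
    rw [ZMod.intCast_eq_intCast_iff_dvd_sub, ZMod.intCast_eq_intCast_iff_dvd_sub]
    push_cast
    rw [hB, show η + (p : ℤ) ^ b * y - (η + p ^ b * x) = p ^ b * (y - x) by ring,
      mul_dvd_mul_iff_left hp]
  set ι : ZMod (p ^ (B - b)) → ZMod (p ^ B) := fun r =>
      ((η + p ^ b * (r.val : ℤ) : ℤ) : ZMod (p ^ B))
  have hι : Function.Injective ι := fun r s hrs => by
    simpa using (key _ _).1 hrs
  have hcls : ∀ r, residueClass z S r = residueClass n S (ι r) := fun r => by
    ext i
    simp only [mem_residueClass]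
    refine and_congr_right fun hi => ?_
    rw [h i hi, key]
    simp
  calc ∑ r, F (residueClass z S r) = ∑ r, F (residueClass n S (ι r)) := by simp_rw [hcls]
    _ = ∑ ρ ∈ univ.map ⟨ι, hι⟩, F (residueClass n S ρ) := by rw [sum_map]; rfl
    _ ≤ _ := sum_le_sum_of_subset_of_nonneg (subset_univ _) fun _ _ _ => hF _

lemma sum_sum_residueClass {p : ℕ} [NeZero p] {b B : ℕ} (hb : b ≤ B) (S : Finset ℕ) (n : ℕ → ℤ)
    (F : Finset ℕ → ℝ) (hF : F ∅ = 0) :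
    ∑ σ : ZMod (p ^ b), ∑ ρ : ZMod (p ^ B), F (residueClass n (residueClass n S σ) ρ) =
      ∑ ρ : ZMod (p ^ B), F (residueClass n S ρ) := by
  rw [sum_comm]
  refine sum_congr rfl fun ρ _ => ?_
  have hdvd : p ^ b ∣ p ^ B := pow_dvd_pow p hb
  have hcast : ∀ i, ((n i : ℤ) : ZMod (p ^ B)) = ρ →
      ((n i : ℤ) : ZMod (p ^ b)) = ZMod.castHom hdvd _ ρ := fun i hi => by
    rw [← hi, map_intCast]
  rw [sum_eq_single (ZMod.castHom hdvd _ ρ)]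
  · congr 1
    ext i
    simp only [mem_residueClass]
    exact ⟨fun h => ⟨h.1.1, h.2⟩, fun h => ⟨⟨h.1, hcast i h.2⟩, h.2⟩⟩
  · intro σ _ hσ
    rw [show residueClass n (residueClass n S σ) ρ = ∅ from ?_, hF]
    ext i
    simp only [mem_residueClass, notMem_empty, iff_false]
    rintro ⟨⟨_, h1⟩, h2⟩
    exact hσ (h1.symm.trans (hcast i h2))
  · simp

lemma exists_eq_add_mul_of_mem_residueClass {p : ℕ} {b : ℕ} {S : Finset ℕ} {n : ℕ → ℤ}
    {σ : ZMod (p ^ b)} {i j : ℕ} (hi : i ∈ residueClass n S σ) (hj : j ∈ residueClass n S σ) :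
    n i = n j + p ^ b * ((n i - n j) / p ^ b) := by
  have h : ((n j : ℤ) : ZMod (p ^ b)) = ((n i : ℤ) : ZMod (p ^ b)) :=
    (mem_residueClass.1 hj).2.trans (mem_residueClass.1 hi).2.symm
  rw [ZMod.intCast_eq_intCast_iff_dvd_sub] at h
  push_cast at h
  rw [Int.mul_ediv_cancel' h]
  ring

/-- Decoupling after rescaling: residue classes modulo `p ^ b` decouple into residue classes modulo
`p ^ B`, at any modulus which is fine enough. -/
lemma Decoupling.sum_residueClass {p : ℕ} [NeZero p] {k b B M : ℕ} {C : ℝ} (hk : 1 ≤ k)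
    (hb : b ≤ B) (hM : k * B ≤ M) (hD : Decoupling p k (B - b) C) (hC : 0 ≤ C) (a : ℕ → ℂ)
    (n : ℕ → ℤ) (S : Finset ℕ) :
    ∑ σ : ZMod (p ^ b), ∑ u : Fin k → ZMod (p ^ M),
        ‖expSum a n (residueClass n S σ) u‖ ^ (k * (k + 1)) ≤
      C * ∑ ρ : ZMod (p ^ B), ∑ u : Fin k → ZMod (p ^ M),
        ‖expSum a n (residueClass n S ρ) u‖ ^ (k * (k + 1)) := by
  have hk0 : k * (k + 1) ≠ 0 := by positivity
  rw [← sum_sum_residueClass hb S n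
    (fun S' => ∑ u : Fin k → ZMod (p ^ M), ‖expSum a n S' u‖ ^ (k * (k + 1)))
    (by simp [hk0]), mul_sum]
  refine sum_le_sum fun σ _ => ?_
  rcases (residueClass n S σ).eq_empty_or_nonempty with h0 | ⟨j, hj⟩
  · rw [h0]; simp [residueClass, hk0]
  have hz := fun i hi => exists_eq_add_mul_of_mem_residueClass (i := i) hi hj
  have h1 := hD.transfer a n (fun i => (n i - n j) / p ^ b) (residueClass n S σ)
    (fun _ : Fin k → ZMod (p ^ M) => 1) (fun _ => zero_le_one) (fun v => by
      obtain ⟨t, c, hc, ht⟩ := exists_shift_of_degree_eq (M := M) hb hM (n j) v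
      exact ⟨t, fun _ => rfl, c, hc, fun i hi => by rw [← ht, ← hz i hi]⟩)
  simp only [one_mul] at h1
  exact h1.trans (mul_le_mul_of_nonneg_left (sum_residueClass_le hb hz
    (fun S' => ∑ u : Fin k → ZMod (p ^ M), ‖expSum a n S' u‖ ^ (k * (k + 1)))
    fun _ => by positivity) hC)

/-! ### Mixed moments -/

/-- The mixed moment over pairs of residue classes modulo `p ^ c` and `p ^ b`. -/
noncomputable def mixedMoment (p : ℕ) [NeZero p] (k M l c b : ℕ) (a : ℕ → ℂ) (n : ℕ → ℤ)
    (S₁ S₂ : Finset ℕ) : ℝ :=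
  ∑ ρ : ZMod (p ^ c), ∑ σ : ZMod (p ^ b), ∑ u : Fin k → ZMod (p ^ M),
    ‖expSum a n (residueClass n S₁ ρ) u‖ ^ (l * (l + 1)) *
      ‖expSum a n (residueClass n S₂ σ) u‖ ^ (k * (k + 1) - l * (l + 1))

/-- Frequencies from `S₁` and `S₂` are distinct modulo `p`. -/
def Transversal (p : ℕ) (n : ℕ → ℤ) (S₁ S₂ : Finset ℕ) : Prop :=
  ∀ i ∈ S₁, ∀ j ∈ S₂, ¬ (p : ℤ) ∣ n i - n j

lemma Transversal.symm {p : ℕ} {n : ℕ → ℤ} {S₁ S₂ : Finset ℕ} (h : Transversal p n S₁ S₂) :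
    Transversal p n S₂ S₁ := fun i hi j hj hd => h j hj i hi (by rwa [← dvd_neg, neg_sub])

lemma mixedMoment_nonneg (p : ℕ) [NeZero p] (k M l c b : ℕ) (a : ℕ → ℂ) (n : ℕ → ℤ)
    (S₁ S₂ : Finset ℕ) : 0 ≤ mixedMoment p k M l c b a n S₁ S₂ := by
  unfold mixedMoment; positivity

lemma norm_expSum_add_of_const {k q : ℕ} [NeZero q] {a : ℕ → ℂ} {n : ℕ → ℤ}
    {S : Finset ℕ} {t : Fin k → ZMod q} {d : ℂ} (hd : ‖d‖ = 1)
    (h : ∀ i ∈ S, ZMod.stdAddChar (phase t (n i)) = d) (u : Fin k → ZMod q) :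
    ‖expSum a n S (u + t)‖ = ‖expSum a n S u‖ := by
  have : expSum a n S (u + t) = d * expSum a n S u := by
    simp only [expSum, mul_sum]
    refine sum_congr rfl fun i hi => ?_
    rw [phase_add, AddChar.map_add_eq_mul, h i hi]
    ring
  rw [this, norm_mul, hd, one_mul]

/-- Decoupling of lower degree `l` refines the first scale of a mixed moment. -/
lemma Decoupling.mixedMoment_le {p : ℕ} (hp : p.Prime) [NeZero p] {k l b c c₁ M : ℕ} {C : ℝ}
    (hkp : k < p) (hl : 1 ≤ l) (hlk : l < k) (hc : c ≤ c₁) (hc₁ : l * c₁ ≤ (l + 1) * c)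
    (hb : l * c₁ ≤ (k - l + 1) * b) (hM : l * c₁ ≤ M) (hD : Decoupling p l (c₁ - c) C) (hC : 0 ≤ C)
    (a : ℕ → ℂ) {n : ℕ → ℤ} {S₁ S₂ : Finset ℕ} (hS : Transversal p n S₁ S₂) :
    mixedMoment p k M l c b a n S₁ S₂ ≤ C * mixedMoment p k M l c₁ b a n S₁ S₂ := by
  have hl0 : l * (l + 1) ≠ 0 := by positivity
  have hlk0 : k * (k + 1) - l * (l + 1) ≠ 0 := by
    have : l * (l + 1) < k * (k + 1) := by nlinarith
    omega
  unfold mixedMoment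
  rw [sum_comm, sum_comm (s := (univ : Finset (ZMod (p ^ c₁)))), mul_sum]
  refine sum_le_sum fun σ _ => ?_
  rw [← sum_sum_residueClass hc S₁ n (fun S' => ∑ u : Fin k → ZMod (p ^ M),
    ‖expSum a n S' u‖ ^ (l * (l + 1)) *
      ‖expSum a n (residueClass n S₂ σ) u‖ ^ (k * (k + 1) - l * (l + 1))) (by simp [hl0]), mul_sum]
  refine sum_le_sum fun ρ _ => ?_
  rcases (residueClass n S₁ ρ).eq_empty_or_nonempty with h0 | ⟨i₀, hi₀⟩
  · rw [h0]; simp [residueClass, hl0]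
  rcases (residueClass n S₂ σ).eq_empty_or_nonempty with h0 | ⟨j₀, hj₀⟩
  · rw [h0]; simp [hlk0]
  have hz := fun i hi => exists_eq_add_mul_of_mem_residueClass (i := i) hi hi₀
  have hy := fun i hi => exists_eq_add_mul_of_mem_residueClass (i := i) hi hj₀
  have h1 := hD.transfer a n (fun i => (n i - n i₀) / p ^ c) (residueClass n S₁ ρ)
    (fun u : Fin k → ZMod (p ^ M) =>
      ‖expSum a n (residueClass n S₂ σ) u‖ ^ (k * (k + 1) - l * (l + 1)))
    (fun _ => by positivity) (fun v => by
      obtain ⟨t, ⟨d, hd, ht⟩, d', hd', ht'⟩ := exists_shift_of_degree_lt (M := M) hp hkp hl hlk.le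
        hc hc₁ hb hM (hS i₀ (residueClass_subset _ _ _ hi₀) j₀ (residueClass_subset _ _ _ hj₀)) v
      refine ⟨t, fun u => ?_, d, hd, fun i hi => by rw [← ht, ← hz i hi]⟩
      rw [norm_expSum_add_of_const hd' fun i hi => by rw [hy i hi]; exact ht' _])
  simp only [mul_comm (‖expSum a n (residueClass n S₂ σ) _‖ ^ _)] at h1
  exact h1.trans (mul_le_mul_of_nonneg_left (sum_residueClass_le hc hz
    (fun S' => ∑ u : Fin k → ZMod (p ^ M), ‖expSum a n S' u‖ ^ (l * (l + 1)) *
      ‖expSum a n (residueClass n S₂ σ) u‖ ^ (k * (k + 1) - l * (l + 1)))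
    fun _ => by positivity) hC)

/-- Iterated version of `Decoupling.mixedMoment_le`. -/
lemma mixedMoment_le_of_forall_decoupling {p : ℕ} (hp : p.Prime) [NeZero p] {k l b c' M : ℕ}
    {K x : ℝ} (hkp : k < p) (hl : 1 ≤ l) (hlk : l < k) (hb : l * c' ≤ (k - l + 1) * b)
    (hM : l * c' ≤ M) (hK : 1 ≤ K) (hD : ∀ L : ℕ, Decoupling p l L (K * (p : ℝ) ^ (x * L)))
    (a : ℕ → ℂ) {n : ℕ → ℤ} {S₁ S₂ : Finset ℕ} (hS : Transversal p n S₁ S₂) (s : ℕ) :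
    ∀ c, c ≤ c' → c' ≤ c + s * (c / l) → mixedMoment p k M l c b a n S₁ S₂ ≤
      K ^ s * (p : ℝ) ^ (x * (c' - c)) * mixedMoment p k M l c' b a n S₁ S₂ := by
  have hp0 : (0 : ℝ) < p := by exact_mod_cast hp.pos
  induction s with
  | zero =>
    intro c h1 h2
    obtain rfl : c = c' := by omega
    simp
  | succ s ih =>
    intro c h1 h2
    set c₁ := min c' (c + c / l) with hc₁
    have hcc₁ : c ≤ c₁ := by rw [hc₁]; exact le_min h1 (Nat.le_add_right _ _)
    have hc₁c' : c₁ ≤ c' := min_le_left _ _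
    have h3 : l * c₁ ≤ (l + 1) * c := calc
      l * c₁ ≤ l * (c + c / l) := Nat.mul_le_mul_left _ (min_le_right _ _)
      _ = l * c + l * (c / l) := by ring
      _ ≤ l * c + c := Nat.add_le_add_left (Nat.mul_div_le _ _) _
      _ = _ := by ring
    have h4 : c' ≤ c₁ + s * (c₁ / l) := by
      rcases le_total c' (c + c / l) with h | h
      · rw [hc₁, min_eq_left h]; omega
      · have h5 : c₁ = c + c / l := by rw [hc₁, min_eq_right h]
        have h6 : s * (c / l) ≤ s * (c₁ / l) := Nat.mul_le_mul_left _ (Nat.div_le_div_right hcc₁)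
        rw [add_mul, one_mul] at h2
        omega
    have h7 := (hD (c₁ - c)).mixedMoment_le hp hkp hl hlk hcc₁ h3
      ((Nat.mul_le_mul_left _ hc₁c').trans hb) ((Nat.mul_le_mul_left _ hc₁c').trans hM)
      (by positivity) a hS
    refine h7.trans ?_
    refine (mul_le_mul_of_nonneg_left (ih c₁ hc₁c' h4) (by positivity)).trans_eq ?_
    have h8 : (p : ℝ) ^ (x * ((c' : ℝ) - c)) =
        (p : ℝ) ^ (x * ((c₁ - c : ℕ) : ℝ)) * (p : ℝ) ^ (x * ((c' : ℝ) - c₁)) := by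
      rw [← Real.rpow_add hp0, Nat.cast_sub hcc₁]
      congr 1; ring
    rw [h8]
    ring

/-- Hölder's inequality for finite sums, with weights `θ` and `1 - θ`. -/
lemma sum_rpow_mul_rpow_le {ι : Type*} (s : Finset ι) {f g : ι → ℝ} (hf : ∀ i ∈ s, 0 ≤ f i)
    (hg : ∀ i ∈ s, 0 ≤ g i) {θ θ' : ℝ} (hθ : 0 < θ) (hθ' : 0 < θ') (h1 : θ + θ' = 1) :
    ∑ i ∈ s, f i ^ θ * g i ^ θ' ≤ (∑ i ∈ s, f i) ^ θ * (∑ i ∈ s, g i) ^ θ' := by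
  have hc : Real.HolderConjugate θ⁻¹ θ'⁻¹ := by
    rw [Real.holderConjugate_iff]
    refine ⟨(one_lt_inv₀ hθ).2 (by linarith), by simpa using h1⟩
  have h := Real.inner_le_Lp_mul_Lq_of_nonneg s hc (f := fun i => f i ^ θ) (g := fun i => g i ^ θ')
    (fun i hi => Real.rpow_nonneg (hf i hi) _) (fun i hi => Real.rpow_nonneg (hg i hi) _)
  rw [one_div, one_div, inv_inv, inv_inv] at h
  rwa [sum_congr rfl fun i hi => Real.rpow_rpow_inv (hf i hi) hθ.ne',
    sum_congr rfl fun i hi => Real.rpow_rpow_inv (hg i hi) hθ'.ne'] at h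

lemma mixedMoment_eq_sum_prod (p : ℕ) [NeZero p] (k M l c b : ℕ) (a : ℕ → ℂ) (n : ℕ → ℤ)
    (S₁ S₂ : Finset ℕ) : mixedMoment p k M l c b a n S₁ S₂ =
    ∑ x : ZMod (p ^ c) × ZMod (p ^ b) × (Fin k → ZMod (p ^ M)),
      ‖expSum a n (residueClass n S₁ x.1) x.2.2‖ ^ (l * (l + 1)) *
      ‖expSum a n (residueClass n S₂ x.2.1) x.2.2‖ ^ (k * (k + 1) - l * (l + 1)) := by
  simp only [mixedMoment, Fintype.sum_prod_type]

lemma mixedMoment_swap_eq_sum_prod (p : ℕ) [NeZero p] (k M l c b : ℕ) (a : ℕ → ℂ) (n : ℕ → ℤ)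
    (S₁ S₂ : Finset ℕ) : mixedMoment p k M l b c a n S₂ S₁ =
    ∑ x : ZMod (p ^ c) × ZMod (p ^ b) × (Fin k → ZMod (p ^ M)),
      ‖expSum a n (residueClass n S₁ x.1) x.2.2‖ ^ (k * (k + 1) - l * (l + 1)) *
      ‖expSum a n (residueClass n S₂ x.2.1) x.2.2‖ ^ (l * (l + 1)) := by
  simp only [mixedMoment, Fintype.sum_prod_type]
  rw [sum_comm]
  simp only [mul_comm]

/-- Interpolation between mixed moments. -/
lemma mixedMoment_holder (p : ℕ) [NeZero p] (m h M c b : ℕ) (hh : 1 ≤ h) (a : ℕ → ℂ) (n : ℕ → ℤ)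
    (S₁ S₂ : Finset ℕ) :
    mixedMoment p (m + 1 + h) M (m + 1) c b a n S₁ S₂ ≤
      mixedMoment p (m + 1 + h) M m c b a n S₁ S₂ ^ ((h : ℝ) / (h + 1)) *
      mixedMoment p (m + 1 + h) M h b c a n S₂ S₁ ^ (1 / ((h : ℝ) + 1)) := by
  have hh0 : (0 : ℝ) < h := by exact_mod_cast hh
  rw [mixedMoment_eq_sum_prod, mixedMoment_eq_sum_prod, mixedMoment_swap_eq_sum_prod]
  refine le_trans (sum_le_sum fun x _ => ?_) (sum_rpow_mul_rpow_le _
    (fun i _ => by positivity) (fun i _ => by positivity) (by positivity) (by positivity)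
    (by field_simp))
  have e1 : (m + 1 + h) * (m + 1 + h + 1) - (m + 1) * (m + 1 + 1) =
      h * (h + 1) + 2 * h * (m + 1) := by
    apply Nat.sub_eq_of_eq_add; ring
  have e2 : (m + 1 + h) * (m + 1 + h + 1) - m * (m + 1) =
      h * (h + 1) + 2 * (h + 1) * (m + 1) := by
    apply Nat.sub_eq_of_eq_add; ring
  have e3 : (m + 1 + h) * (m + 1 + h + 1) - h * (h + 1) = (m + 1) * (m + 2 + 2 * h) := by
    apply Nat.sub_eq_of_eq_add; ring
  rw [e1, e2, e3]
  generalize hX : ‖expSum a n (residueClass n S₁ x.1) x.2.2‖ = A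
  generalize hY : ‖expSum a n (residueClass n S₂ x.2.1) x.2.2‖ = D
  have hA : 0 ≤ A := hX ▸ norm_nonneg _
  have hD : 0 ≤ D := hY ▸ norm_nonneg _
  rw [Real.mul_rpow (by positivity) (by positivity), Real.mul_rpow (by positivity) (by positivity)]
  simp only [← Real.rpow_natCast, ← Real.rpow_mul hA, ← Real.rpow_mul hD]
  rw [mul_mul_mul_comm, ← Real.rpow_add_of_nonneg hA (by positivity) (by positivity),
    ← Real.rpow_add_of_nonneg hD (by positivity) (by positivity)]
  refine le_of_eq ?_
  congr 2
  · push_cast; field_simp; ring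
  · push_cast; field_simp; ring

/-- The moment over residue classes modulo `p ^ B`. -/
noncomputable def classMoment (p : ℕ) [NeZero p] (k M B : ℕ) (a : ℕ → ℂ) (n : ℕ → ℤ)
    (S : Finset ℕ) : ℝ :=
  ∑ ρ : ZMod (p ^ B), ∑ u : Fin k → ZMod (p ^ M),
    ‖expSum a n (residueClass n S ρ) u‖ ^ (k * (k + 1))

lemma classMoment_nonneg (p : ℕ) [NeZero p] (k M B : ℕ) (a : ℕ → ℂ) (n : ℕ → ℤ)
    (S : Finset ℕ) : 0 ≤ classMoment p k M B a n S := by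
  unfold classMoment; positivity

/-- Decoupling holds with the exponent `η` in excess of the optimal one. -/
def HasExponent (p : ℕ) [NeZero p] (k : ℕ) (η : ℝ) : Prop :=
  ∃ K : ℝ, 1 ≤ K ∧ ∀ B : ℕ, Decoupling p k B (K * (p : ℝ) ^ (((k * (k + 1) : ℝ) / 2 - 1 + η) * B))

/-- The exponent of `p` expected in a mixed moment, relative to the class moment. -/
noncomputable def mixedExponent (k l B c b : ℝ) : ℝ :=
  c + b - B + (B - c) * (l * (l + 1)) / 2 + (B - b) * (k * (k + 1) - l * (l + 1)) / 2

/-- Mixed moments at the balanced scales `l c = (k - l + 1) b` gain `p ^ (-μ b)` over the bound that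
follows from the exponent `η`. -/
def MixedBound (p : ℕ) [NeZero p] (k : ℕ) (η μ : ℝ) (l N R : ℕ) : Prop :=
  ∀ ε : ℝ, 0 < ε → ∃ K : ℝ, 1 ≤ K ∧ ∀ (B b c : ℕ) (a : ℕ → ℂ) (n : ℕ → ℤ) (S₁ S₂ : Finset ℕ)
    (T : ℝ), Transversal p n S₁ S₂ → N ∣ b → R * b ≤ B → l * c = (k - l + 1) * b →
    classMoment p k (k * B) B a n S₁ ≤ T → classMoment p k (k * B) B a n S₂ ≤ T →
    mixedMoment p k (k * B) l c b a n S₁ S₂ ≤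
      K * (p : ℝ) ^ (mixedExponent k l B c b + η * B - μ * b + ε * B) * T

lemma sum_residueClass_le_of_decoupling {p : ℕ} [NeZero p] {k B b : ℕ} (hk : 1 ≤ k) {K y T : ℝ}
    (hK : 0 ≤ K) (hD : ∀ L : ℕ, Decoupling p k L (K * (p : ℝ) ^ (y * L))) {a : ℕ → ℂ}
    {n : ℕ → ℤ} {S : Finset ℕ} (hT : classMoment p k (k * B) B a n S ≤ T) (hb : b ≤ B) :
    classMoment p k (k * B) b a n S ≤ K * (p : ℝ) ^ (y * (B - b)) * T := by
  have h := (hD (B - b)).sum_residueClass hk hb le_rfl (by positivity) a n S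
  rw [Nat.cast_sub hb] at h
  exact h.trans (mul_le_mul_of_nonneg_left hT (by positivity))

lemma mixedMoment_le_of_pow_le {p : ℕ} [NeZero p] (k M l c b : ℕ) (hl : l ≤ k) (a : ℕ → ℂ)
    (n : ℕ → ℤ) (S₁ S₂ : Finset ℕ) :
    mixedMoment p k M l c b a n S₁ S₂ ≤
      (p : ℝ) ^ b * classMoment p k M c a n S₁ + (p : ℝ) ^ c * classMoment p k M b a n S₂ := by
  have h1 : (p : ℝ) ^ b * classMoment p k M c a n S₁ = ∑ ρ : ZMod (p ^ c), ∑ σ : ZMod (p ^ b),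
      ∑ u : Fin k → ZMod (p ^ M), ‖expSum a n (residueClass n S₁ ρ) u‖ ^ (k * (k + 1)) := by
    simp [classMoment, mul_sum, ZMod.card]
  have h2 : (p : ℝ) ^ c * classMoment p k M b a n S₂ = ∑ ρ : ZMod (p ^ c), ∑ σ : ZMod (p ^ b),
      ∑ u : Fin k → ZMod (p ^ M), ‖expSum a n (residueClass n S₂ σ) u‖ ^ (k * (k + 1)) := by
    simp [classMoment, mul_sum, ZMod.card]
  rw [h1, h2, ← sum_add_distrib]
  refine sum_le_sum fun ρ _ => ?_
  rw [← sum_add_distrib]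
  refine sum_le_sum fun σ _ => ?_
  rw [← sum_add_distrib]
  refine sum_le_sum fun u _ => ?_
  set A := ‖expSum a n (residueClass n S₁ ρ) u‖
  set D := ‖expSum a n (residueClass n S₂ σ) u‖
  have hA : 0 ≤ A := norm_nonneg _
  have hD : 0 ≤ D := norm_nonneg _
  have hle : l * (l + 1) + (k * (k + 1) - l * (l + 1)) = k * (k + 1) :=
    Nat.add_sub_cancel' (Nat.mul_le_mul hl (by omega))
  rcases le_total A D with h | h
  · calc _ ≤ D ^ (l * (l + 1)) * D ^ (k * (k + 1) - l * (l + 1)) := by gcongr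
      _ = D ^ (k * (k + 1)) := by rw [← pow_add, hle]
      _ ≤ _ := le_add_of_nonneg_left (by positivity)
  · calc _ ≤ A ^ (l * (l + 1)) * A ^ (k * (k + 1) - l * (l + 1)) := by gcongr
      _ = A ^ (k * (k + 1)) := by rw [← pow_add, hle]
      _ ≤ _ := le_add_of_nonneg_right (by positivity)

lemma mixedMoment_zero_le {p : ℕ} (hp : p.Prime) [NeZero p] {k B b c : ℕ} (hk : 1 ≤ k)
    {K η T : ℝ} (hK : 1 ≤ K)
    (hD : ∀ L : ℕ, Decoupling p k L (K * (p : ℝ) ^ (((k * (k + 1) : ℝ) / 2 - 1 + η) * L)))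
    {a : ℕ → ℂ} {n : ℕ → ℤ} {S₁ S₂ : Finset ℕ} (hT : classMoment p k (k * B) B a n S₂ ≤ T)
    (hb : b ≤ B) :
    mixedMoment p k (k * B) 0 c b a n S₁ S₂ ≤
      K * (p : ℝ) ^ (mixedExponent k 0 B c b + η * (B - b)) * T := by
  have hp0 : (0 : ℝ) < p := by exact_mod_cast hp.pos
  have h1 : mixedMoment p k (k * B) 0 c b a n S₁ S₂ =
      (p : ℝ) ^ c * classMoment p k (k * B) b a n S₂ := by
    simp [mixedMoment, classMoment, ZMod.card]
  rw [h1]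
  refine (mul_le_mul_of_nonneg_left
    (sum_residueClass_le_of_decoupling hk (by linarith) hD hT hb) (by positivity)).trans_eq ?_
  rw [← Real.rpow_natCast (p : ℝ) c, ← mul_assoc, mul_left_comm, ← Real.rpow_add hp0]
  congr 3
  unfold mixedExponent
  ring

/-- The trivial bound for mixed moments. -/
lemma mixedBound_of_hasExponent {p : ℕ} (hp : p.Prime) [NeZero p] {k l : ℕ} (hl : 1 ≤ l)
    (hlk : l < k) {η : ℝ} (hη : 0 ≤ η) (h : HasExponent p k η) (N : ℕ) :
    MixedBound p k η (-(1 + k + (k + 1) * (k * (k + 1)))) l N k := by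
  intro ε hε
  obtain ⟨K, hK, hD⟩ := h
  refine ⟨2 * K, by linarith, fun B b c a n S₁ S₂ T _ _ hbB hcb hT₁ hT₂ => ?_⟩
  have hp0 : (0 : ℝ) < p := by exact_mod_cast hp.pos
  have hp1 : (1 : ℝ) ≤ p := by exact_mod_cast hp.one_le
  have hT : 0 ≤ T := (classMoment_nonneg _ _ _ _ _ _ _).trans hT₁
  have hckb : c ≤ k * b := calc
    c ≤ l * c := Nat.le_mul_of_pos_left _ hl
    _ = (k - l + 1) * b := hcb
    _ ≤ k * b := Nat.mul_le_mul_right _ (by omega)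
  have hcB : c ≤ B := hckb.trans hbB
  have hbB' : b ≤ B := (Nat.le_mul_of_pos_left b (by omega)).trans hbB
  have hckb' : (c : ℝ) ≤ k * b := by exact_mod_cast hckb
  have hk1 : (1 : ℝ) ≤ k := by exact_mod_cast (by omega : 1 ≤ k)
  have hlk' : (l : ℝ) ≤ k := by exact_mod_cast hlk.le
  have hl' : (1 : ℝ) ≤ l := by exact_mod_cast hl
  have hb0 : (0 : ℝ) ≤ b := by positivity
  have hc0 : (0 : ℝ) ≤ c := by positivity
  have hPl : (l * (l + 1) : ℝ) ≤ k * (k + 1) := by nlinarith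
  set E := mixedExponent k l B c b + η * B - -(1 + k + (k + 1) * (k * (k + 1))) * b + ε * B with hE
  have hEe : ((k * (k + 1) : ℝ) / 2 - 1) * B + (b + c) + η * B ≤ E := by
    have h1 : (c : ℝ) * (l * (l + 1)) ≤ (k * b) * (k * (k + 1)) := by gcongr
    have h2 : (0 : ℝ) ≤ b * (l * (l + 1)) := by positivity
    have h3 : 0 ≤ ε * B := by positivity
    rw [hE]
    unfold mixedExponent
    nlinarith [mul_nonneg hb0 (mul_nonneg (by linarith : (0 : ℝ) ≤ k)
      (by linarith : (0 : ℝ) ≤ k + 1))]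
  have hy : (0 : ℝ) ≤ (k * (k + 1) : ℝ) / 2 - 1 + η := by nlinarith
  have bound : ∀ (d d' : ℕ) (S : Finset ℕ), d ≤ B → (d' : ℝ) ≤ b + c →
      classMoment p k (k * B) B a n S ≤ T →
      (p : ℝ) ^ d' * classMoment p k (k * B) d a n S ≤ K * (p : ℝ) ^ E * T := by
    intro d d' S hd hd' hS
    refine (mul_le_mul_of_nonneg_left
      (sum_residueClass_le_of_decoupling (by omega : 1 ≤ k) (by linarith) hD hS hd)
        (by positivity)).trans ?_
    rw [← Real.rpow_natCast (p : ℝ) d', ← mul_assoc, mul_left_comm, ← Real.rpow_add hp0]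
    gcongr
    · have : 0 ≤ ((k * (k + 1) : ℝ) / 2 - 1 + η) * d := by positivity
      linarith
  have h1 := bound c b S₁ hcB (by linarith) hT₁
  have h2 := bound b c S₂ hbB' (by linarith) hT₂
  have := mixedMoment_le_of_pow_le (p := p) k (k * B) l c b hlk.le a n S₁ S₂
  linarith

/-- Mixed moments at unbalanced scales, by lower degree decoupling. -/
lemma mixedMoment_le_of_mixedBound {p : ℕ} (hp : p.Prime) [NeZero p] {k l : ℕ} (hkp : k < p)
    (hl : 1 ≤ l) (hlk : l < k) {η μ : ℝ} {N R s : ℕ} (hR : k ≤ R)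
    (hlow : ∀ ε : ℝ, 0 < ε → HasExponent p l ε) (hM : MixedBound p k η μ l N R)
    {ε : ℝ} (hε : 0 < ε) :
    ∃ K : ℝ, 1 ≤ K ∧ ∀ (B b c c' : ℕ) (a : ℕ → ℂ) (n : ℕ → ℤ) (S₁ S₂ : Finset ℕ) (T : ℝ),
      Transversal p n S₁ S₂ → N ∣ b → R * b ≤ B → l * c' = (k - l + 1) * b → c ≤ c' →
      c' ≤ c + s * (c / l) →
      classMoment p k (k * B) B a n S₁ ≤ T → classMoment p k (k * B) B a n S₂ ≤ T →
      mixedMoment p k (k * B) l c b a n S₁ S₂ ≤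
        K * (p : ℝ) ^ (mixedExponent k l B c b + η * B - μ * b + ε * B) * T := by
  obtain ⟨K₁, hK₁, hD⟩ := hlow (ε / 2) (by positivity)
  obtain ⟨K₂, hK₂, hM⟩ := hM (ε / 2) (by positivity)
  refine ⟨K₁ ^ s * K₂, one_le_mul_of_one_le_of_one_le (one_le_pow₀ hK₁) hK₂,
    fun B b c c' a n S₁ S₂ T hS hNb hRb hc'b hcc' hc's hT₁ hT₂ => ?_⟩
  have hp0 : (0 : ℝ) < p := by exact_mod_cast hp.pos
  have hp1 : (1 : ℝ) ≤ p := by exact_mod_cast hp.one_le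
  have hT : 0 ≤ T := (classMoment_nonneg _ _ _ _ _ _ _).trans hT₁
  have hkb : k * b ≤ B := (Nat.mul_le_mul_right _ hR).trans hRb
  have hlc' : l * c' ≤ B := by
    rw [hc'b]; exact (Nat.mul_le_mul_right _ (by omega)).trans hkb
  have hc'B : c' ≤ B := (Nat.le_mul_of_pos_left _ hl).trans hlc'
  have h1 := mixedMoment_le_of_forall_decoupling hp hkp hl hlk hc'b.le
    (hlc'.trans (Nat.le_mul_of_pos_left _ (by omega)) : l * c' ≤ k * B) hK₁ hD a hS s c hcc' hc's
  refine h1.trans ((mul_le_mul_of_nonneg_left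
    (hM B b c' a n S₁ S₂ T hS hNb hRb hc'b hT₁ hT₂) (by positivity)).trans ?_)
  rw [show ∀ x y z w : ℝ, K₁ ^ s * x * (y * z * w) = K₁ ^ s * y * (x * z) * w by intros; ring,
    ← Real.rpow_add hp0]
  refine mul_le_mul_of_nonneg_right (mul_le_mul_of_nonneg_left
    (Real.rpow_le_rpow_of_exponent_le hp1 ?_) (by positivity)) hT
  have h2 : (c' : ℝ) ≤ B := by exact_mod_cast hc'B
  have h3 : (0 : ℝ) ≤ c := by positivity
  have h4 : ε / 2 * (c' - c) ≤ ε / 2 * B := by gcongr; linarith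
  unfold mixedExponent
  nlinarith

lemma mul_rpow_mul_rpow_interpolate {p K₁ K₂ x y T θ θ' : ℝ} (hp : 0 < p) (hK₁ : 0 ≤ K₁)
    (hK₂ : 0 ≤ K₂) (hT : 0 ≤ T) (hθ : 0 < θ) (hθ' : 0 < θ') (h1 : θ + θ' = 1) :
    (K₁ * p ^ x * T) ^ θ * (K₂ * p ^ y * T) ^ θ' =
      K₁ ^ θ * K₂ ^ θ' * p ^ (θ * x + θ' * y) * T := by
  have e : T ^ θ * T ^ θ' = T := by
    rw [← Real.rpow_add_of_nonneg hT hθ.le hθ'.le, h1, Real.rpow_one]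
  rw [Real.mul_rpow (by positivity) hT, Real.mul_rpow (by positivity) hT,
    Real.mul_rpow hK₁ (by positivity), Real.mul_rpow hK₂ (by positivity), ← Real.rpow_mul hp.le,
    ← Real.rpow_mul hp.le, Real.rpow_add hp, mul_comm θ x, mul_comm θ' y]
  nth_rewrite 3 [← e]
  ring

/-- One step of the iteration improving the gain in mixed moments. -/
lemma mixedBound_improve {p : ℕ} (hp : p.Prime) [NeZero p] {k : ℕ} (hkp : k < p)
    (hlow : ∀ l, 1 ≤ l → l < k → ∀ ε : ℝ, 0 < ε → HasExponent p l ε) {η δ : ℝ}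
    (hδη : δ ≤ η) (hη : HasExponent p k η) {μ : ℕ → ℝ} (hμ : μ 0 = δ) {N R : ℕ}
    (hN : k.factorial ∣ N) (hR : k ≤ R)
    (hM : ∀ l, 1 ≤ l → l < k → MixedBound p k η (μ l) l N R) {m h : ℕ} (hh : 1 ≤ h)
    (hmh : m + 1 + h = k) :
    MixedBound p k η ((h : ℝ) / (h + 1) * μ m + μ h / (m + 1)) (m + 1) (k.factorial * N)
      (k * R) := by
  subst hmh
  set k := m + 1 + h with hk
  intro ε hε
  have hp0 : (0 : ℝ) < p := by exact_mod_cast hp.pos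
  have hp1 : (1 : ℝ) ≤ p := by exact_mod_cast hp.one_le
  have first : ∃ K : ℝ, 1 ≤ K ∧ ∀ (B b c b₀ : ℕ) (a : ℕ → ℂ) (n : ℕ → ℤ) (S₁ S₂ : Finset ℕ)
      (T : ℝ), Transversal p n S₁ S₂ → N ∣ b → R * b ≤ B → b = (m + 1) * m * b₀ ∨ m = 0 →
      (m + 1) * c = (h + 1) * b →
      classMoment p k (k * B) B a n S₁ ≤ T → classMoment p k (k * B) B a n S₂ ≤ T →
      mixedMoment p k (k * B) m c b a n S₁ S₂ ≤
        K * (p : ℝ) ^ (mixedExponent k m B c b + η * B - μ m * b + ε * B) * T := by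
    rcases Nat.eq_zero_or_pos m with hm | hm
    · obtain ⟨K, hK, hD⟩ := hη
      refine ⟨K, hK, fun B b c b₀ a n S₁ S₂ T hS hNb hRb _ _ hT₁ hT₂ => ?_⟩
      have hT : 0 ≤ T := (classMoment_nonneg _ _ _ _ _ _ _).trans hT₁
      have hbB : b ≤ B := (Nat.le_mul_of_pos_left b (by omega)).trans hRb
      rw [hm]
      refine (mixedMoment_zero_le hp (by omega) hK hD hT₂ hbB).trans ?_
      refine mul_le_mul_of_nonneg_right (mul_le_mul_of_nonneg_left
        (Real.rpow_le_rpow_of_exponent_le hp1 ?_) (by positivity)) hT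
      rw [hμ]
      have h1 : δ * b ≤ η * b := by gcongr
      have h2 : 0 ≤ ε * B := by positivity
      push_cast
      linarith
    · obtain ⟨K, hK, hD⟩ := mixedMoment_le_of_mixedBound hp hkp hm (by omega : m < k) hR
        (s := (h + 2) * (m + 1)) (hlow m hm (by omega)) (hM m hm (by omega)) hε
      refine ⟨K, hK, fun B b c b₀ a n S₁ S₂ T hS hNb hRb hb hcb hT₁ hT₂ => ?_⟩
      replace hb : b = (m + 1) * m * b₀ := hb.resolve_right (by omega)
      have hc : c = m * ((h + 1) * b₀) := by
        apply Nat.eq_of_mul_eq_mul_left (Nat.succ_pos m)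
        rw [Nat.succ_eq_add_one, hcb, hb]; ring
      refine hD B b c ((h + 2) * (m + 1) * b₀) a n S₁ S₂ T hS hNb hRb ?_ ?_ ?_ hT₁ hT₂
      · rw [show k - m + 1 = h + 2 by omega, hb]; ring
      · rw [hc]; nlinarith [Nat.zero_le (m * h * b₀), Nat.zero_le (m * b₀), Nat.zero_le (h * b₀)]
      · rw [hc, Nat.mul_div_cancel_left _ hm]
        nlinarith [Nat.zero_le (m * ((h + 1) * b₀)), Nat.zero_le ((h + 2) * (m + 1) * (h * b₀))]
  obtain ⟨K₁, hK₁, first⟩ := first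
  obtain ⟨K₂, hK₂, second⟩ := mixedMoment_le_of_mixedBound hp hkp hh (by omega : h < k) hR
    (s := (m + 2) * (h + 1)) (hlow h hh (by omega)) (hM h hh (by omega)) hε
  have hh0 : (0 : ℝ) < h := by exact_mod_cast hh
  refine ⟨K₁ ^ ((h : ℝ) / (h + 1)) * K₂ ^ (1 / ((h : ℝ) + 1)),
    one_le_mul_of_one_le_of_one_le (Real.one_le_rpow hK₁ (by positivity))
      (Real.one_le_rpow hK₂ (by positivity)),
    fun B b c a n S₁ S₂ T hS hNb hRb hcb hT₁ hT₂ => ?_⟩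
  have hT : 0 ≤ T := (classMoment_nonneg _ _ _ _ _ _ _).trans hT₁
  rw [show k - (m + 1) + 1 = h + 1 by omega] at hcb
  have hNb' : N ∣ b := (Dvd.intro_left _ rfl).trans hNb
  have hRb' : R * b ≤ B := by
    refine le_trans (Nat.mul_le_mul_right _ (Nat.le_mul_of_pos_left R (by omega : 0 < k))) hRb
  have hm1 : m + 1 ∣ k.factorial := Nat.dvd_factorial (by omega) (by omega)
  have dvd : ∀ j, 1 ≤ j → j ≤ k → ∃ b₀, b = (m + 1) * j * b₀ := fun j hj hjk =>
    (mul_dvd_mul hm1 ((Nat.dvd_factorial hj hjk).trans hN)).trans hNb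
  have hb1 : ∃ b₀, b = (m + 1) * m * b₀ ∨ m = 0 := by
    rcases Nat.eq_zero_or_pos m with hm | hm
    · exact ⟨0, Or.inr hm⟩
    · obtain ⟨b₀, hb₀⟩ := dvd m hm (by omega)
      exact ⟨b₀, Or.inl hb₀⟩
  obtain ⟨b₀, hb₀⟩ := hb1
  obtain ⟨b₁, hb₁⟩ := dvd h hh (by omega)
  have hc : c = (h + 1) * h * b₁ := by
    apply Nat.eq_of_mul_eq_mul_left (Nat.succ_pos m)
    rw [Nat.succ_eq_add_one, hcb, hb₁]; ring
  have hNc : N ∣ c := by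
    obtain ⟨x, hx⟩ := hm1
    obtain ⟨y, hy⟩ := hNb
    refine ⟨(h + 1) * x * y, ?_⟩
    apply Nat.eq_of_mul_eq_mul_left (Nat.succ_pos m)
    rw [Nat.succ_eq_add_one, hcb, hy, hx]; ring
  have hRc : R * c ≤ B := by
    refine le_trans ?_ hRb
    have : c ≤ k * b := calc
      c ≤ (m + 1) * c := Nat.le_mul_of_pos_left _ (by omega)
      _ = (h + 1) * b := hcb
      _ ≤ k * b := Nat.mul_le_mul_right _ (by omega)
    calc R * c ≤ R * (k * b) := Nat.mul_le_mul_left _ this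
      _ = k * R * b := by ring
  have h1 := first B b c b₀ a n S₁ S₂ T hS hNb' hRb' hb₀ hcb hT₁ hT₂
  have h2 := second B c b ((m + 2) * (h + 1) * b₁) a n S₂ S₁ T hS.symm hNc hRc
    (by rw [show k - h + 1 = m + 2 by omega, hc]; ring)
    (by rw [hb₁]; nlinarith [Nat.zero_le (m * h * b₁), Nat.zero_le (m * b₁), Nat.zero_le (h * b₁)])
    (by
      rw [hb₁, mul_right_comm (m + 1) h b₁, Nat.mul_div_cancel _ hh]
      nlinarith [Nat.zero_le ((m + 1) * b₁ * h), Nat.zero_le ((m + 2) * (h + 1) * (m * b₁))])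
    hT₂ hT₁
  refine (mixedMoment_holder p m h (k * B) c b hh a n S₁ S₂).trans ?_
  refine (mul_le_mul (Real.rpow_le_rpow (mixedMoment_nonneg _ _ _ _ _ _ _ _ _ _) h1
    (by positivity)) (Real.rpow_le_rpow (mixedMoment_nonneg _ _ _ _ _ _ _ _ _ _) h2
    (by positivity)) (Real.rpow_nonneg (mixedMoment_nonneg _ _ _ _ _ _ _ _ _ _) _)
    (by positivity)).trans_eq ?_
  rw [mul_rpow_mul_rpow_interpolate hp0 (by positivity) (by positivity) hT (by positivity)
    (by positivity) (by field_simp)]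
  congr 3
  have hcb' : ((m : ℝ) + 1) * c = (h + 1) * b := by exact_mod_cast hcb
  have hc' : (c : ℝ) = (h + 1) * b / (m + 1) := by
    field_simp; linarith
  rw [hc', hk]
  unfold mixedExponent
  push_cast
  field_simp
  ring

/-- The gains in mixed moments after `t` steps of the iteration. -/
noncomputable def gain (k : ℕ) (δ C : ℝ) : ℕ → ℕ → ℝ
  | _, 0 => δ
  | 0, _ + 1 => -C
  | t + 1, m + 1 => ((k - (m + 1) : ℕ) : ℝ) / ((k - (m + 1) : ℕ) + 1) * gain k δ C t m +
      gain k δ C t (k - (m + 1)) / (m + 1)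

lemma mixedBound_gain {p : ℕ} (hp : p.Prime) [NeZero p] {k : ℕ} (hkp : k < p)
    (hlow : ∀ l, 1 ≤ l → l < k → ∀ ε : ℝ, 0 < ε → HasExponent p l ε) {η δ : ℝ} (hδ : 0 ≤ δ)
    (hδη : δ ≤ η) (hη : HasExponent p k η) (t : ℕ) : ∀ l, 1 ≤ l → l < k →
      MixedBound p k η (gain k δ (1 + k + (k + 1) * (k * (k + 1))) t l) l (k.factorial ^ (t + 1))
        (k ^ (t + 1)) := by
  induction t with
  | zero =>
    intro l hl hlk
    obtain ⟨m, rfl⟩ : ∃ m, l = m + 1 := ⟨l - 1, by omega⟩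
    simpa [gain] using mixedBound_of_hasExponent hp hl hlk (hδ.trans hδη) hη k.factorial
  | succ t ih =>
    intro l hl hlk
    obtain ⟨m, rfl⟩ : ∃ m, l = m + 1 := ⟨l - 1, by omega⟩
    rw [pow_succ' _ (t + 1), pow_succ' _ (t + 1)]
    exact mixedBound_improve hp hkp hlow hδη hη (by cases t <;> simp [gain])
      (dvd_pow_self _ (by omega)) (Nat.le_self_pow (by omega) k) ih (by omega)
      (by omega)

lemma sum_gain (k : ℕ) (hk : 2 ≤ k) (δ C : ℝ) (t : ℕ) :
    ∑ m ∈ range (k - 1), gain k δ C t (m + 1) = (k - 1) * (t * (δ / k) - C) := by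
  obtain ⟨d, rfl⟩ : ∃ d, k = d + 2 := ⟨k - 2, by omega⟩
  rw [show d + 2 - 1 = d + 1 by omega]
  induction t with
  | zero =>
    simp only [gain, sum_const, card_range, nsmul_eq_mul]
    push_cast
    ring
  | succ t ih =>
    have e1 : ∑ m ∈ range (d + 1), gain (d + 2) δ C (t + 1) (m + 1) =
        ∑ m ∈ range (d + 1), (((d + 1 - m : ℕ) : ℝ) / ((d + 1 - m : ℕ) + 1)) *
          gain (d + 2) δ C t m +
        ∑ m ∈ range (d + 1), gain (d + 2) δ C t (d - m + 1) / (m + 1) := by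
      rw [← sum_add_distrib]
      refine sum_congr rfl fun m hm => ?_
      have := mem_range.1 hm
      rw [gain, show d + 2 - (m + 1) = d + 1 - m by omega, show d + 1 - m = d - m + 1 by omega]
    have e2 : ∑ m ∈ range (d + 1), gain (d + 2) δ C t (d - m + 1) / (m + 1) =
        ∑ m ∈ range (d + 1), gain (d + 2) δ C t (m + 1) / ((d - m : ℕ) + 1) := by
      rw [← sum_range_reflect]
      refine sum_congr rfl fun m hm => ?_
      have := mem_range.1 hm
      rw [show d - (d + 1 - 1 - m) = m by omega, show d + 1 - 1 - m = d - m by omega]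
    have e3 : ∑ m ∈ range (d + 1), (((d + 1 - m : ℕ) : ℝ) / ((d + 1 - m : ℕ) + 1)) *
          gain (d + 2) δ C t m = ∑ m ∈ range (d + 1), (((d - m : ℕ) : ℝ) / ((d - m : ℕ) + 1)) *
          gain (d + 2) δ C t (m + 1) + (d + 1) / (d + 2) * δ := by
      rw [sum_range_succ', sum_range_succ]
      have : gain (d + 2) δ C t 0 = δ := by cases t <;> simp [gain]
      simp only [this, Nat.sub_self, Nat.cast_zero, zero_div, zero_mul, add_zero,
        Nat.reduceSubDiff, Nat.sub_zero]
      push_cast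
      ring
    have e4 : ∀ m, ((d - m : ℕ) : ℝ) / ((d - m : ℕ) + 1) * gain (d + 2) δ C t (m + 1) +
        gain (d + 2) δ C t (m + 1) / ((d - m : ℕ) + 1) = gain (d + 2) δ C t (m + 1) := by
      intro m; field_simp
    rw [e1, e2, e3, add_right_comm, ← sum_add_distrib, sum_congr rfl fun m _ => e4 m, ih]
    push_cast
    field_simp
    ring

lemma exists_le_gain (k : ℕ) (hk : 2 ≤ k) {δ : ℝ} (hδ : 0 < δ) (C G : ℝ) :
    ∃ t l, 1 ≤ l ∧ l < k ∧ G ≤ gain k δ C t l := by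
  have hk0 : (0 : ℝ) < k := by positivity
  obtain ⟨t, ht⟩ := exists_nat_ge ((G + C) / (δ / k))
  rw [div_le_iff₀ (by positivity)] at ht
  by_contra! hcon
  have h1 : ∑ m ∈ range (k - 1), gain k δ C t (m + 1) < ∑ m ∈ range (k - 1), G :=
    sum_lt_sum_of_nonempty (by simp; omega) fun m hm =>
      hcon t (m + 1) (by omega) (by have := mem_range.1 hm; omega)
  rw [sum_gain k hk, sum_const, card_range, nsmul_eq_mul, Nat.cast_sub (by omega)] at h1
  have hk1 : (0 : ℝ) < k - 1 := by
    have : (2 : ℝ) ≤ k := by exact_mod_cast hk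
    linarith
  push_cast at h1
  have := lt_of_mul_lt_mul_left h1 hk1.le
  linarith

/-- A sum is dominated either by its largest term or by the product of two different ones. -/
lemma sum_pow_le_broad_narrow {ι : Type*} [Fintype ι] [Nonempty ι] [DecidableEq ι] {A : ι → ℝ}
    (hA : ∀ i, 0 ≤ A i) (Q Q' : ℕ) :
    (∑ i, A i) ^ (Q + Q') ≤ 2 ^ (Q + Q') * ∑ i, A i ^ (Q + Q') +
      (Fintype.card ι : ℝ) ^ (2 * (Q + Q')) *
        ∑ i, ∑ j, if i = j then 0 else A i ^ Q * A j ^ Q' := by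
  obtain ⟨i, hi⟩ := Finite.exists_max A
  set D : ℝ := ((Fintype.card ι : ℕ) : ℝ)
  have hD : 1 ≤ D := Nat.one_le_cast.2 Fintype.card_pos
  have hnn : ∀ i j, 0 ≤ if i = j then 0 else A i ^ Q * A j ^ Q' := fun i j => by
    split_ifs
    · exact le_rfl
    · exact mul_nonneg (pow_nonneg (hA i) _) (pow_nonneg (hA j) _)
  have h0 : 0 ≤ ∑ i, A i := sum_nonneg fun i _ => hA i
  have hs : ∑ j, A j ≤ D * A i := by
    refine (sum_le_card_nsmul univ A (A i) fun j _ => hi j).trans_eq ?_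
    simp [D]
  by_cases h : ∀ j, j ≠ i → D * A j ≤ A i
  · refine le_add_of_le_of_nonneg ?_ (mul_nonneg (by positivity)
      (sum_nonneg fun i _ => sum_nonneg fun j _ => hnn i j))
    have h1 : ∑ j, A j ≤ 2 * A i := by
      rw [← add_sum_erase univ A (mem_univ i), two_mul]
      gcongr
      have h2 : ∑ j ∈ univ.erase i, A j ≤ ∑ j ∈ univ.erase i, A i / D := by
        refine sum_le_sum fun j hj => ?_
        rw [le_div_iff₀ (by linarith), mul_comm]
        exact h j (ne_of_mem_erase hj)
      refine h2.trans ((sum_le_sum_of_subset_of_nonneg (erase_subset _ _) fun _ _ _ =>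
        div_nonneg (hA i) (by linarith)).trans_eq ?_)
      rw [sum_const, nsmul_eq_mul, card_univ]
      change D * _ = _
      field_simp
    calc _ ≤ (2 * A i) ^ (Q + Q') := by gcongr
      _ = 2 ^ (Q + Q') * A i ^ (Q + Q') := mul_pow _ _ _
      _ ≤ _ := by
        gcongr
        exact single_le_sum (f := fun i => A i ^ (Q + Q')) (fun j _ => pow_nonneg (hA j) _)
          (mem_univ i)
  · push Not at h
    obtain ⟨j, hj, hlt⟩ := h
    refine le_add_of_nonneg_of_le (mul_nonneg (by positivity)
      (sum_nonneg fun i _ => pow_nonneg (hA i) _)) ?_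
    have hAi := hA i
    have hAj := hA j
    calc (∑ j, A j) ^ (Q + Q') ≤ (D * A i) ^ (Q + Q') := by gcongr
      _ = D ^ (Q + Q') * (A i ^ Q * A i ^ Q') := by rw [mul_pow, pow_add (A i)]
      _ ≤ D ^ (Q + Q') * (A i ^ Q * (D * A j) ^ Q') := by gcongr
      _ = D ^ (Q + Q') * D ^ Q' * (A i ^ Q * A j ^ Q') := by rw [mul_pow]; ring
      _ ≤ D ^ (Q + Q') * D ^ (Q + Q') * (A i ^ Q * A j ^ Q') := by
        gcongr
        omega
      _ = D ^ (2 * (Q + Q')) * (A i ^ Q * A j ^ Q') := by rw [two_mul, pow_add D (Q + Q')]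
      _ ≤ _ := by
        gcongr
        refine le_trans ?_ (single_le_sum (f := fun i => ∑ j,
          if i = j then 0 else A i ^ Q * A j ^ Q')
          (fun i _ => sum_nonneg fun j _ => hnn i j) (mem_univ i))
        refine le_trans ?_ (single_le_sum (f := fun j => if i = j then 0 else A i ^ Q * A j ^ Q')
          (fun j _ => hnn i j) (mem_univ j))
        rw [if_neg hj.symm]

lemma norm_expSum_pow_le {p k q : ℕ} [NeZero p] [NeZero q] (c Q : ℕ) (hQ : Q ≠ 0) (a : ℕ → ℂ)
    (n : ℕ → ℤ) (S : Finset ℕ) (u : Fin k → ZMod q) :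
    ‖expSum a n S u‖ ^ Q ≤
      (p : ℝ) ^ (c * Q) * ∑ ρ : ZMod (p ^ c), ‖expSum a n (residueClass n S ρ) u‖ ^ Q := by
  obtain ⟨Q, rfl⟩ := Nat.exists_eq_succ_of_ne_zero hQ
  rw [Nat.succ_eq_add_one]
  have hp1 : (1 : ℝ) ≤ p := by exact_mod_cast NeZero.one_le
  have h := pow_sum_div_card_le_sum_pow (s := univ)
    (f := fun ρ : ZMod (p ^ c) => ‖expSum a n (residueClass n S ρ) u‖) (fun _ _ => norm_nonneg _) Q
  have hpc : (0 : ℝ) < (p ^ c : ℕ) := by push_cast; positivity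
  rw [card_univ, ZMod.card, div_le_iff₀ (by positivity), mul_comm] at h
  calc _ ≤ (∑ ρ : ZMod (p ^ c), ‖expSum a n (residueClass n S ρ) u‖) ^ (Q + 1) := by
        rw [expSum_eq_sum_residueClass (r := p ^ c) a n S u]
        gcongr
        exact norm_sum_le _ _
    _ ≤ _ := h
    _ ≤ _ := by
      push_cast
      rw [← pow_mul]
      gcongr
      omega

/-- Transversal products are bounded by mixed moments. -/
lemma sum_mul_le_mixedMoment {p : ℕ} [NeZero p] {k l : ℕ} (hl : 1 ≤ l) (hlk : l < k)
    (M c b : ℕ) (a : ℕ → ℂ) (n : ℕ → ℤ) (S₁ S₂ : Finset ℕ) :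
    ∑ u : Fin k → ZMod (p ^ M), ‖expSum a n S₁ u‖ ^ (l * (l + 1)) *
        ‖expSum a n S₂ u‖ ^ (k * (k + 1) - l * (l + 1)) ≤
      (p : ℝ) ^ (c * (l * (l + 1)) + b * (k * (k + 1) - l * (l + 1))) *
        mixedMoment p k M l c b a n S₁ S₂ := by
  have hQ' : k * (k + 1) - l * (l + 1) ≠ 0 := by
    have : l * (l + 1) < k * (k + 1) := Nat.mul_lt_mul_of_lt_of_le hlk (by omega) (by omega)
    omega
  have e1 : mixedMoment p k M l c b a n S₁ S₂ = ∑ u : Fin k → ZMod (p ^ M),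
      (∑ ρ : ZMod (p ^ c), ‖expSum a n (residueClass n S₁ ρ) u‖ ^ (l * (l + 1))) *
      ∑ σ : ZMod (p ^ b), ‖expSum a n (residueClass n S₂ σ) u‖ ^ (k * (k + 1) - l * (l + 1)) := by
    simp only [mixedMoment, sum_mul_sum]
    rw [eq_comm, sum_comm]
    exact sum_congr rfl fun ρ _ => sum_comm
  rw [e1, mul_sum]
  refine sum_le_sum fun u _ => ?_
  rw [pow_add, mul_mul_mul_comm]
  exact mul_le_mul (norm_expSum_pow_le c _ (by positivity) a n S₁ u)
    (norm_expSum_pow_le b _ hQ' a n S₂ u) (by positivity) (by positivity)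

/-- Transversal products gain over the decoupling exponent. -/
lemma exists_transversal_gain {p : ℕ} (hp : p.Prime) [NeZero p] {k : ℕ} (hk : 2 ≤ k) (hkp : k < p)
    (hlow : ∀ l, 1 ≤ l → l < k → ∀ ε : ℝ, 0 < ε → HasExponent p l ε) {δ : ℝ} (hδ : 0 < δ) :
    ∃ (κ : ℝ) (l : ℕ), 0 < κ ∧ κ ≤ δ ∧ 1 ≤ l ∧ l < k ∧ ∀ η, δ ≤ η → HasExponent p k η →
      ∃ K : ℝ, 1 ≤ K ∧ ∀ (B : ℕ) (a : ℕ → ℂ) (n : ℕ → ℤ) (S₁ S₂ : Finset ℕ) (T : ℝ),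
        Transversal p n S₁ S₂ → classMoment p k (k * B) B a n S₁ ≤ T →
        classMoment p k (k * B) B a n S₂ ≤ T →
        ∑ u : Fin k → ZMod (p ^ (k * B)), ‖expSum a n S₁ u‖ ^ (l * (l + 1)) *
          ‖expSum a n S₂ u‖ ^ (k * (k + 1) - l * (l + 1)) ≤
          K * (p : ℝ) ^ (((k * (k + 1) : ℝ) / 2 - 1 + (η - κ)) * B) * T := by
  obtain ⟨t, l, hl, hlk, hgain⟩ := exists_le_gain k hk hδ (1 + k + (k + 1) * (k * (k + 1)))
    (2 + k + k * (k * (k + 1)))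
  have hp0 : (0 : ℝ) < p := by exact_mod_cast hp.pos
  have hp1 : (1 : ℝ) ≤ p := by exact_mod_cast hp.one_le
  set N := k.factorial ^ (t + 1) with hN
  set R := k ^ (t + 1) with hR
  have hN0 : 0 < N := by positivity
  have hR0 : 0 < R := by positivity
  have hR0' : (0 : ℝ) < R := by exact_mod_cast hR0
  refine ⟨min δ (1 / (2 * R)), l, lt_min hδ (by positivity), min_le_left _ _, hl, hlk,
    fun η hδη hη => ?_⟩
  obtain ⟨K, hK, hM⟩ := mixedBound_gain hp hkp hlow hδ.le hδη hη t l hl hlk (1 / (2 * R))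
    (by positivity)
  refine ⟨K * (p : ℝ) ^ (N : ℝ), one_le_mul_of_one_le_of_one_le hK (Real.one_le_rpow hp1
    (by positivity)), fun B a n S₁ S₂ T hS hT₁ hT₂ => ?_⟩
  have hT : 0 ≤ T := (classMoment_nonneg _ _ _ _ _ _ _).trans hT₁
  set b := N * (B / (N * R)) with hb
  obtain ⟨x, hx⟩ : l ∣ b := ((Nat.dvd_factorial hl hlk.le).trans (dvd_pow_self _ (by omega))).trans
    (Dvd.intro _ rfl)
  have hcb : l * ((k - l + 1) * x) = (k - l + 1) * b := by rw [hx]; ring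
  set c := (k - l + 1) * x
  have hRb : R * b ≤ B := by
    rw [hb, ← mul_assoc, mul_comm R N]
    exact Nat.mul_div_le B (N * R)
  have hbB : (B : ℝ) / R - N ≤ b := by
    have h1 : B < N * R * (B / (N * R) + 1) := Nat.lt_mul_div_succ B (by positivity)
    have h2 : B ≤ R * (b + N) := by rw [hb]; nlinarith
    have h3 : (B : ℝ) ≤ R * (b + N) := by exact_mod_cast h2
    rw [sub_le_iff_le_add, div_le_iff₀ hR0']
    linarith
  have hckb : c ≤ k * b := calc
    c ≤ l * c := Nat.le_mul_of_pos_left _ hl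
    _ = (k - l + 1) * b := hcb
    _ ≤ k * b := Nat.mul_le_mul_right _ (by omega)
  have hckb' : (c : ℝ) ≤ k * b := by exact_mod_cast hckb
  have h1 := hM B b c a n S₁ S₂ T hS (Dvd.intro _ rfl) hRb hcb hT₁ hT₂
  refine (sum_mul_le_mixedMoment hl hlk (k * B) c b a n S₁ S₂).trans
    ((mul_le_mul_of_nonneg_left h1 (by positivity)).trans ?_)
  set μ := gain k δ (1 + k + (k + 1) * (k * (k + 1))) t l
  have hle : l * (l + 1) ≤ k * (k + 1) := Nat.mul_le_mul hlk.le (by omega)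
  rw [← Real.rpow_natCast, show ∀ x y z : ℝ, x * (K * y * z) = K * (x * y) * z by intros; ring,
    ← Real.rpow_add hp0, show ∀ x y z w : ℝ, x * y * z * w = x * (y * z) * w by intros; ring,
    ← Real.rpow_add hp0]
  refine mul_le_mul_of_nonneg_right (mul_le_mul_of_nonneg_left
    (Real.rpow_le_rpow_of_exponent_le hp1 ?_) (by positivity)) hT
  push_cast [Nat.cast_sub hle]
  have hle' : (l * (l + 1) : ℝ) ≤ k * (k + 1) := by exact_mod_cast hle
  have hb0 : (0 : ℝ) ≤ b := by positivity
  have hc0 : (0 : ℝ) ≤ c := by positivity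
  have hk0 : (0 : ℝ) < k := by positivity
  have hk1 : (1 : ℝ) ≤ k := by exact_mod_cast (by omega : 1 ≤ k)
  have hl0 : (0 : ℝ) ≤ l * (l + 1) := by positivity
  have i1 : (c : ℝ) * (l * (l + 1)) ≤ k * b * (l * (l + 1)) := by gcongr
  have i2 : (b : ℝ) * (k * (k + 1) - l * (l + 1)) ≤ k * b * (k * (k + 1) - l * (l + 1)) := by
    have : (b : ℝ) ≤ k * b := by nlinarith
    gcongr
  have i3 : (2 + k + k * (k * (k + 1))) * (b : ℝ) ≤ μ * b := by gcongr
  have i4 : min δ (1 / (2 * R)) * B ≤ 1 / (2 * R) * B := by gcongr; exact min_le_right _ _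
  have i5 : (B : ℝ) / R = 1 / (2 * R) * B + 1 / (2 * R) * B := by field_simp; ring
  have i6 : 0 ≤ (c : ℝ) * (l * (l + 1)) := by positivity
  have i7 : 0 ≤ (b : ℝ) * (k * (k + 1) - l * (l + 1)) := mul_nonneg hb0 (by linarith)
  unfold mixedExponent
  linarith

lemma decoupling_zero (p : ℕ) [NeZero p] (k : ℕ) : Decoupling p k 0 1 := by
  intro a n S
  have h : ∀ ρ : ZMod (p ^ 0), residueClass n S ρ = S := fun ρ => by
    have : Subsingleton (ZMod (p ^ 0)) := by rw [pow_zero]; infer_instance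
    ext i
    simp only [mem_residueClass, and_iff_left_iff_imp]
    exact fun _ => Subsingleton.elim _ _
  simp only [h, sum_const, card_univ, ZMod.card, pow_zero, one_smul, one_mul, le_refl]

lemma classMoment_residueClass_le {p : ℕ} [NeZero p] {k b B : ℕ} (hk : 1 ≤ k) (hb : b ≤ B) (M : ℕ)
    (a : ℕ → ℂ) (n : ℕ → ℤ) (S : Finset ℕ) (σ : ZMod (p ^ b)) :
    classMoment p k M B a n (residueClass n S σ) ≤ classMoment p k M B a n S := by
  have hk0 : k * (k + 1) ≠ 0 := by positivity
  have h := sum_sum_residueClass (p := p) hb S n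
    (fun S' => ∑ u : Fin k → ZMod (p ^ M), ‖expSum a n S' u‖ ^ (k * (k + 1))) (by simp [hk0])
  unfold classMoment
  rw [← h]
  exact single_le_sum (f := fun σ : ZMod (p ^ b) => ∑ ρ : ZMod (p ^ B),
    ∑ u : Fin k → ZMod (p ^ M), ‖expSum a n (residueClass n (residueClass n S σ) ρ) u‖ ^
      (k * (k + 1))) (fun _ _ => by positivity) (mem_univ σ)

/-- Above any positive threshold, the decoupling exponent improves by a fixed amount. -/
lemma exists_hasExponent_sub {p : ℕ} (hp : p.Prime) [NeZero p] (hp64 : 64 ≤ p) {k : ℕ}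
    (hk : 2 ≤ k) (hkp : k < p)
    (hlow : ∀ l, 1 ≤ l → l < k → ∀ ε : ℝ, 0 < ε → HasExponent p l ε) {δ : ℝ} (hδ : 0 < δ) :
    ∃ κ : ℝ, 0 < κ ∧ ∀ η, δ ≤ η → HasExponent p k η → HasExponent p k (η - κ) := by
  obtain ⟨κ, l, hκ, hκδ, hl, hlk, hgain⟩ := exists_transversal_gain hp hk hkp hlow hδ
  refine ⟨κ, hκ, fun η hδη hη => ?_⟩
  obtain ⟨K, hK, hbroad⟩ := hgain η hδη hη
  have hp0 : (0 : ℝ) < p := by exact_mod_cast hp.pos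
  have hp1 : (1 : ℝ) ≤ p := by exact_mod_cast hp.one_le
  set P := k * (k + 1) with hP
  set y : ℝ := (k * (k + 1) : ℝ) / 2 - 1 + (η - κ) with hy
  set W : ℝ := (p : ℝ) ^ (2 * P) * (p * p) with hW
  have hW1 : 1 ≤ W := one_le_mul_of_one_le_of_one_le (one_le_pow₀ hp1)
    (one_le_mul_of_one_le_of_one_le hp1 hp1)
  have hnarrow : 2 ^ P ≤ (p : ℝ) ^ y / 2 := by
    have h6 : 6 ≤ P := by rw [hP]; nlinarith
    have h6' : (6 : ℝ) ≤ P := by exact_mod_cast h6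
    have h1 : (P : ℝ) + 1 ≤ 6 * y := by
      have : y = (P : ℝ) / 2 - 1 + (η - κ) := by rw [hy, hP]; push_cast; ring
      linarith
    rw [le_div_iff₀ two_pos, ← pow_succ, ← Real.rpow_natCast]
    calc (2 : ℝ) ^ (((P + 1 : ℕ) : ℝ)) ≤ 2 ^ (6 * y) :=
          Real.rpow_le_rpow_of_exponent_le one_le_two (by push_cast; exact h1)
      _ = (64 : ℝ) ^ y := by
        rw [Real.rpow_mul two_pos.le]; norm_num
      _ ≤ (p : ℝ) ^ y := Real.rpow_le_rpow (by norm_num) (by exact_mod_cast hp64) (by linarith)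
  refine ⟨2 * W * K, by nlinarith, fun B => ?_⟩
  induction B with
  | zero =>
    refine (decoupling_zero p k).mono ?_
    simp only [Nat.cast_zero, mul_zero, Real.rpow_zero]
    nlinarith
  | succ B ih =>
    intro a n S
    change _ ≤ _ * classMoment p k (k * (B + 1)) (B + 1) a n S
    set T := classMoment p k (k * (B + 1)) (B + 1) a n S with hTdef
    have hT0 : 0 ≤ T := classMoment_nonneg _ _ _ _ _ _ _
    have hle : l * (l + 1) + (P - l * (l + 1)) = P :=
      Nat.add_sub_cancel' (Nat.mul_le_mul hlk.le (by omega))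
    have h1 : ∑ u : Fin k → ZMod (p ^ (k * (B + 1))), ‖expSum a n S u‖ ^ P ≤
        2 ^ P * classMoment p k (k * (B + 1)) 1 a n S + (p : ℝ) ^ (2 * P) *
          ∑ ρ : ZMod (p ^ 1), ∑ σ : ZMod (p ^ 1), ∑ u : Fin k → ZMod (p ^ (k * (B + 1))),
          if ρ = σ then 0 else ‖expSum a n (residueClass n S ρ) u‖ ^ (l * (l + 1)) *
            ‖expSum a n (residueClass n S σ) u‖ ^ (P - l * (l + 1)) := by
      have e1 : classMoment p k (k * (B + 1)) 1 a n S =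
          ∑ u : Fin k → ZMod (p ^ (k * (B + 1))), ∑ ρ : ZMod (p ^ 1),
            ‖expSum a n (residueClass n S ρ) u‖ ^ P := sum_comm
      have e2 : ∀ F : ZMod (p ^ 1) → ZMod (p ^ 1) → (Fin k → ZMod (p ^ (k * (B + 1)))) → ℝ,
          ∑ ρ, ∑ σ, ∑ u, F ρ σ u = ∑ u, ∑ ρ, ∑ σ, F ρ σ u := fun F => by
        rw [eq_comm, sum_comm]
        exact sum_congr rfl fun ρ _ => sum_comm
      rw [e1, e2, mul_sum, mul_sum, ← sum_add_distrib]
      refine sum_le_sum fun u _ => ?_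
      have h2 := sum_pow_le_broad_narrow (ι := ZMod (p ^ 1))
        (A := fun ρ => ‖expSum a n (residueClass n S ρ) u‖) (fun _ => norm_nonneg _)
        (l * (l + 1)) (P - l * (l + 1))
      rw [hle, ZMod.card, show ((p ^ 1 : ℕ) : ℝ) = p by simp] at h2
      refine le_trans ?_ h2
      rw [expSum_eq_sum_residueClass (r := p ^ 1) a n S u]
      gcongr
      exact norm_sum_le _ _
    have h2 : ∑ ρ : ZMod (p ^ 1), ∑ σ : ZMod (p ^ 1), ∑ u : Fin k → ZMod (p ^ (k * (B + 1))),
          (if ρ = σ then 0 else ‖expSum a n (residueClass n S ρ) u‖ ^ (l * (l + 1)) *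
            ‖expSum a n (residueClass n S σ) u‖ ^ (P - l * (l + 1))) ≤
        (p * p : ℝ) * (K * (p : ℝ) ^ (y * (B + 1 : ℕ)) * T) := by
      have h3 : ∀ ρ σ : ZMod (p ^ 1), ∑ u : Fin k → ZMod (p ^ (k * (B + 1))),
          (if ρ = σ then 0 else ‖expSum a n (residueClass n S ρ) u‖ ^ (l * (l + 1)) *
            ‖expSum a n (residueClass n S σ) u‖ ^ (P - l * (l + 1))) ≤
          K * (p : ℝ) ^ (y * (B + 1 : ℕ)) * T := by
        intro ρ σ
        by_cases hρσ : ρ = σ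
        · simp only [hρσ, if_true, sum_const_zero]
          positivity
        · simp only [hρσ, if_false]
          refine hbroad (B + 1) a n _ _ T ?_
            (classMoment_residueClass_le (by omega) (by omega) _ a n S ρ)
            (classMoment_residueClass_le (by omega) (by omega) _ a n S σ)
          intro i hi j hj hd
          apply hρσ
          rw [← (mem_residueClass.1 hi).2, ← (mem_residueClass.1 hj).2, eq_comm,
            ZMod.intCast_eq_intCast_iff_dvd_sub]
          simpa using hd
      refine (sum_le_sum fun ρ _ => sum_le_sum fun σ _ => h3 ρ σ).trans_eq ?_
      simp [ZMod.card]
      ring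
    have h3 : classMoment p k (k * (B + 1)) 1 a n S ≤
        2 * W * K * (p : ℝ) ^ (y * B) * T :=
      Decoupling.sum_residueClass (by omega) (by omega : 1 ≤ B + 1) le_rfl
        (by simpa using ih) (by positivity) a n S
    have hpy : (p : ℝ) ^ (y * (B + 1 : ℕ)) = p ^ y * p ^ (y * B) := by
      rw [← Real.rpow_add hp0]; push_cast; ring_nf
    refine h1.trans ?_
    calc _ ≤ (p : ℝ) ^ y / 2 * (2 * W * K * (p : ℝ) ^ (y * B) * T) +
          (p : ℝ) ^ (2 * P) * ((p * p : ℝ) * (K * (p : ℝ) ^ (y * (B + 1 : ℕ)) * T)) := by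
          have := classMoment_nonneg p k (k * (B + 1)) 1 a n S
          gcongr
      _ = 2 * W * K * (p : ℝ) ^ (y * (B + 1 : ℕ)) * T := by rw [hpy, hW]; ring

lemma HasExponent.mono {p : ℕ} (hp : p.Prime) [NeZero p] {k : ℕ} {η η' : ℝ}
    (h : HasExponent p k η) (hη : η ≤ η') : HasExponent p k η' := by
  obtain ⟨K, hK, hD⟩ := h
  refine ⟨K, hK, fun B => (hD B).mono ?_⟩
  have hp1 : (1 : ℝ) ≤ p := by exact_mod_cast hp.one_le
  gcongr

lemma hasExponent_trivial (p : ℕ) [NeZero p] (k : ℕ) (hk : 1 ≤ k) :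
    HasExponent p k ((k * (k + 1) : ℝ) / 2 + 1) := by
  refine ⟨1, le_rfl, fun B a n S => ?_⟩
  have e1 : ((k * (k + 1) : ℝ) / 2 - 1 + ((k * (k + 1) : ℝ) / 2 + 1)) * B =
      ((B * (k * (k + 1)) : ℕ) : ℝ) := by push_cast; ring
  rw [e1, one_mul, Real.rpow_natCast, sum_comm, mul_sum]
  exact sum_le_sum fun u _ => norm_expSum_pow_le B _ (by positivity) a n S u

/-- Parseval's identity modulo `q`. -/
lemma sum_norm_sq_stdAddChar {q : ℕ} [NeZero q] (F : ZMod q → ℂ) :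
    ∑ t : ZMod q, ‖∑ ρ, ZMod.stdAddChar (t * ρ) * F ρ‖ ^ 2 = q * ∑ ρ, ‖F ρ‖ ^ 2 := by
  have h : ∀ z : ℂ, ((‖z‖ ^ 2 : ℝ) : ℂ) = z * (starRingEnd ℂ) z := fun z => by
    rw [Complex.mul_conj, Complex.normSq_eq_norm_sq]
  apply Complex.ofReal_injective
  push_cast
  simp only [← Complex.ofReal_pow, h, map_sum, map_mul, sum_mul_sum]
  have e1 : ∀ t ρ σ : ZMod q, ZMod.stdAddChar (t * ρ) * F ρ *
      ((starRingEnd ℂ) (ZMod.stdAddChar (t * σ)) * (starRingEnd ℂ) (F σ)) =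
      ZMod.stdAddChar (t * (ρ - σ)) * (F ρ * (starRingEnd ℂ) (F σ)) := fun t ρ σ => by
    rw [← AddChar.map_neg_eq_conj, mul_sub, sub_eq_add_neg, AddChar.map_add_eq_mul]
    ring
  simp only [e1]
  rw [sum_comm, mul_sum]
  refine sum_congr rfl fun ρ _ => ?_
  rw [sum_comm]
  simp only [← sum_mul, AddChar.sum_mulShift _ (ZMod.isPrimitive_stdAddChar q), sub_eq_zero,
    Nat.cast_ite, Nat.cast_zero, ite_mul, zero_mul, sum_ite_eq, mem_univ, if_true, ZMod.card]

lemma decoupling_one (p : ℕ) [NeZero p] (B : ℕ) : Decoupling p 1 B 1 := by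
  intro a n S
  suffices h : ∀ M, M = B → ∑ u : Fin 1 → ZMod (p ^ M), ‖expSum a n S u‖ ^ (1 * (1 + 1)) ≤
      1 * ∑ ρ : ZMod (p ^ B), ∑ u : Fin 1 → ZMod (p ^ M),
        ‖expSum a n (residueClass n S ρ) u‖ ^ (1 * (1 + 1)) from h _ (one_mul B)
  rintro B rfl
  have hcls : ∀ (ρ : ZMod (p ^ B)) (u : Fin 1 → ZMod (p ^ B)),
      expSum a n (residueClass n S ρ) u = ZMod.stdAddChar (u 0 * ρ) *
        ∑ i ∈ residueClass n S ρ, a i := by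
    intro ρ u
    rw [mul_sum]
    refine sum_congr rfl fun i hi => ?_
    simp [phase, (mem_residueClass.1 hi).2, mul_comm]
  set F : ZMod (p ^ B) → ℂ := fun ρ => ∑ i ∈ residueClass n S ρ, a i
  have hnorm : ∀ ρ (u : Fin 1 → ZMod (p ^ B)),
      ‖expSum a n (residueClass n S ρ) u‖ = ‖F ρ‖ := fun ρ u => by
    rw [hcls, norm_mul, norm_stdAddChar, one_mul]
  have hS : ∀ u : Fin 1 → ZMod (p ^ B), expSum a n S u =
      ∑ ρ : ZMod (p ^ B), ZMod.stdAddChar (u 0 * ρ) * F ρ := fun u => by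
    rw [expSum_eq_sum_residueClass (r := p ^ B)]
    exact sum_congr rfl fun ρ _ => hcls ρ u
  refine le_of_eq ?_
  simp only [hnorm, hS, one_mul, one_add_one_eq_two]
  rw [← (Equiv.funUnique (Fin 1) (ZMod (p ^ B))).symm.sum_comp]
  refine (sum_norm_sq_stdAddChar F).trans ?_
  simp [mul_sum, ZMod.card]

/-- Decoupling for the moment curve with an arbitrarily small loss. -/
theorem hasExponent {p : ℕ} (hp : p.Prime) [NeZero p] (hp64 : 64 ≤ p) (k : ℕ) (hk : 1 ≤ k)
    (hkp : k < p) (ε : ℝ) (hε : 0 < ε) : HasExponent p k ε := by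
  induction k using Nat.strong_induction_on generalizing ε with
  | _ k ih =>
  rcases hk.eq_or_lt with rfl | hk2
  · refine ⟨1, le_rfl, fun B => (decoupling_one p B).mono ?_⟩
    rw [one_mul]
    refine Real.one_le_rpow (by exact_mod_cast hp.one_le) ?_
    push_cast
    have : 0 ≤ ε * B := by positivity
    linarith
  · obtain ⟨κ, hκ, hstep⟩ := exists_hasExponent_sub hp hp64 hk2 hkp
      (fun l hl hlk ε hε => ih l hlk hl (by omega) ε hε) hε
    have h : ∀ t : ℕ, HasExponent p k (max ε ((k * (k + 1) : ℝ) / 2 + 1 - t * κ)) := by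
      intro t
      induction t with
      | zero =>
        refine (hasExponent_trivial p k hk).mono hp ?_
        simp
      | succ t iht =>
        refine (hstep _ (le_max_left _ _) iht).mono hp ?_
        rw [sub_le_iff_le_add, max_le_iff]
        push_cast
        constructor
        · linarith [le_max_left ε ((k * (k + 1) : ℝ) / 2 + 1 - (t + 1) * κ)]
        · linarith [le_max_right ε ((k * (k + 1) : ℝ) / 2 + 1 - (t + 1) * κ)]
    obtain ⟨t, ht⟩ := exists_nat_ge (((k * (k + 1) : ℝ) / 2 + 1) / κ)
    rw [div_le_iff₀ hκ] at ht
    have := h t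
    rwa [max_eq_left (by linarith)] at this

end MinorArc

namespace MinorArc

open Finset

/-! ### Mean values of exponential sums over intervals -/

/-- Mean values at the critical exponent, with bounded coefficients. -/
lemma exists_sum_norm_expSum_pow_le {p : ℕ} (hp : p.Prime) [NeZero p] (hp64 : 64 ≤ p) {d : ℕ}
    (hd : 1 ≤ d) (hdp : d < p) {ε : ℝ} (hε : 0 < ε) :
    ∃ K : ℝ, 1 ≤ K ∧ ∀ (B M X : ℕ) (a : ℕ → ℂ) (A : ℝ), X ≤ p ^ B → d * B ≤ M →
      (∀ i, ‖a i‖ ≤ A) →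
      ∑ u : Fin d → ZMod (p ^ M), ‖expSum a (fun i => i) (Icc 1 X) u‖ ^ (d * (d + 1)) ≤
        K * (p : ℝ) ^ (((d * (d + 1) : ℝ) / 2 - 1 + ε) * B) *
          (X * (A ^ (d * (d + 1)) * (p ^ M : ℕ) ^ d)) := by
  obtain ⟨K, hK, hD⟩ := hasExponent hp hp64 d hd hdp ε hε
  refine ⟨K, hK, fun B M X a A hX hM ha => ?_⟩
  have hA : 0 ≤ A := (norm_nonneg _).trans (ha 0)
  have hP : d * (d + 1) ≠ 0 := by positivity
  have h0 : ∀ ρ : ZMod (p ^ 0), residueClass (fun i => (i : ℤ)) (Icc 1 X) ρ = Icc 1 X := fun ρ => by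
    have : Subsingleton (ZMod (p ^ 0)) := by rw [pow_zero]; infer_instance
    ext i
    simp only [mem_residueClass, and_iff_left_iff_imp]
    exact fun _ => Subsingleton.elim _ _
  have h1 := Decoupling.sum_residueClass (b := 0) hd (Nat.zero_le B) hM (hD B) (by positivity) a
    (fun i => i) (Icc 1 X)
  simp only [h0, sum_const, card_univ, ZMod.card, pow_zero, one_smul] at h1
  refine h1.trans (mul_le_mul_of_nonneg_left ?_ (by positivity))
  have h2 : ∀ ρ : ZMod (p ^ B), ∑ u : Fin d → ZMod (p ^ M),
      ‖expSum a (fun i => i) (residueClass (fun i => (i : ℤ)) (Icc 1 X) ρ) u‖ ^ (d * (d + 1)) ≤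
      #(residueClass (fun i => (i : ℤ)) (Icc 1 X) ρ) * (A ^ (d * (d + 1)) * (p ^ M : ℕ) ^ d) := by
    intro ρ
    have hcard : #(residueClass (fun i => (i : ℤ)) (Icc 1 X) ρ) ≤ 1 := by
      refine card_le_one.2 fun i hi j hj => ?_
      rw [mem_residueClass, mem_Icc] at hi hj
      have hij := hi.2.trans hj.2.symm
      push_cast at hij
      rw [ZMod.natCast_eq_natCast_iff'] at hij
      obtain ⟨⟨hi1, hi2⟩, -⟩ := hi
      obtain ⟨⟨hj1, hj2⟩, -⟩ := hj
      rcases (hi2.trans hX).eq_or_lt with hi3 | hi3 <;>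
        rcases (hj2.trans hX).eq_or_lt with hj3 | hj3
      · omega
      · rw [hi3, Nat.mod_self, Nat.mod_eq_of_lt hj3] at hij; omega
      · rw [hj3, Nat.mod_self, Nat.mod_eq_of_lt hi3] at hij; omega
      · rwa [Nat.mod_eq_of_lt hi3, Nat.mod_eq_of_lt hj3] at hij
    rcases Nat.le_one_iff_eq_zero_or_eq_one.1 hcard with h | h
    · rw [card_eq_zero] at h
      simp [h, hP]
    · obtain ⟨i, hi⟩ := card_eq_one.1 h
      rw [hi]
      simp only [card_singleton, Nat.cast_one, one_mul]
      calc _ ≤ ∑ u : Fin d → ZMod (p ^ M), A ^ (d * (d + 1)) := by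
            refine sum_le_sum fun u _ => ?_
            gcongr
            simpa [expSum] using ha i
        _ = _ := by simp [ZMod.card, mul_comm]
  refine (sum_le_sum fun ρ _ => h2 ρ).trans_eq ?_
  rw [← sum_mul, ← Nat.cast_sum]
  congr 2
  simp only [residueClass]
  rw [← card_eq_sum_card_fiberwise (f := fun i : ℕ => (((i : ℕ) : ℤ) : ZMod (p ^ B)))
    (fun _ _ => mem_coe.2 (mem_univ _))]
  simp

/-! ### Local constancy -/

/-- The half-widths of the boxes on which exponential sums of length `X` are essentially
constant. -/
def boxWidth (d Q X : ℕ) (j : Fin d) : ℕ := Q / (6 * d * X ^ ((j : ℕ) + 1))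

/-- A box on which exponential sums of length `X` are essentially constant. -/
def box (d Q X : ℕ) : Finset (Fin d → ℕ) := Fintype.piFinset fun j => range (boxWidth d Q X j + 1)

lemma half_le_re_stdAddChar {d Q X : ℕ} [NeZero Q] {t : Fin d → ℕ}
    (ht : t ∈ box d Q X) {x : ℕ} (hx : x ∈ Icc 1 X) :
    1 / 2 ≤ (ZMod.stdAddChar (phase (fun j => (t j : ZMod Q)) x)).re := by
  rw [mem_Icc] at hx
  set s : ℕ := ∑ j, t j * x ^ ((j : ℕ) + 1) with hs
  have h1 : phase (fun j => (t j : ZMod Q)) x = ((s : ℤ) : ZMod Q) := by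
    rw [hs]; simp [phase]
  have h2 : d * (6 * s) ≤ d * Q := by
    calc d * (6 * s) = ∑ j : Fin d, 6 * d * (t j * x ^ ((j : ℕ) + 1)) := by rw [← mul_sum]; ring
      _ ≤ ∑ j : Fin d, Q := by
        refine sum_le_sum fun j _ => ?_
        have := Fintype.mem_piFinset.1 ht j
        rw [mem_range, Nat.lt_succ_iff] at this
        calc 6 * d * (t j * x ^ ((j : ℕ) + 1)) ≤
            6 * d * (boxWidth d Q X j * X ^ ((j : ℕ) + 1)) := by gcongr; exact hx.2
          _ = 6 * d * X ^ ((j : ℕ) + 1) * (Q / (6 * d * X ^ ((j : ℕ) + 1))) := by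
            unfold boxWidth; ring
          _ ≤ Q := Nat.mul_div_le _ _
      _ = d * Q := by simp
  have h3 : 6 * s ≤ Q := by
    rcases Nat.eq_zero_or_pos d with rfl | hd
    · simp [hs]
    · exact Nat.le_of_mul_le_mul_left h2 hd
  have hQ : (0 : ℝ) < Q := by exact_mod_cast NeZero.pos Q
  have h4 : (6 * s : ℝ) ≤ Q := by exact_mod_cast h3
  rw [h1, ZMod.stdAddChar_coe, show 2 * (Real.pi : ℂ) * Complex.I * ((s : ℤ) : ℂ) / (Q : ℂ) =
    ((2 * Real.pi * s / Q : ℝ) : ℂ) * Complex.I by push_cast; ring, Complex.exp_ofReal_mul_I_re,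
    ← Real.cos_pi_div_three]
  refine Real.cos_le_cos_of_nonneg_of_le_pi (by positivity) (by linarith [Real.pi_pos]) ?_
  rw [div_le_div_iff₀ hQ (by norm_num)]
  nlinarith [Real.pi_pos]

/-- Exponential sums are dominated by averages over boxes. -/
lemma exists_norm_expSum_pow_le_sum_box {d Q X : ℕ} [NeZero Q] {a : ℕ → ℂ} (ha : ∀ i, ‖a i‖ ≤ 1) :
    ∃ a' : ℕ → ℂ, (∀ i, ‖a' i‖ ≤ 2) ∧ ∀ (u : Fin d → ZMod Q) (P : ℕ),
      #(box d Q X) * ‖expSum a (fun i => i) (Icc 1 X) u‖ ^ P ≤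
        ∑ t ∈ box d Q X, ‖expSum a' (fun i => i) (Icc 1 X) (u + fun j => (t j : ZMod Q))‖ ^ P := by
  have hbox : 0 < #(box d Q X) := by
    refine card_pos.2 ⟨0, Fintype.mem_piFinset.2 fun j => ?_⟩
    simp
  set V : ℝ := ((#(box d Q X) : ℕ) : ℝ) with hV
  have hV0 : 0 < V := Nat.cast_pos.2 hbox
  set W : ℕ → ℂ := fun x => ∑ t ∈ box d Q X, ZMod.stdAddChar (phase (fun j => (t j : ZMod Q)) x)
    with hW
  have hWre : ∀ x ∈ Icc 1 X, V / 2 ≤ ‖W x‖ := fun x hx => by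
    refine le_trans ?_ (Complex.re_le_norm _)
    rw [hW, Complex.re_sum]
    refine le_trans (le_of_eq ?_) (sum_le_sum fun t ht => half_le_re_stdAddChar ht hx)
    simp [hV, div_eq_mul_inv]
  refine ⟨fun x => if x ∈ Icc 1 X then V * a x / W x else 0, fun x => ?_, fun u P => ?_⟩
  · dsimp only
    split_ifs with hx
    · have := hWre x hx
      rw [norm_div, norm_mul, Complex.norm_real, Real.norm_of_nonneg hV0.le,
        div_le_iff₀ (by linarith)]
      nlinarith [ha x]
    · simp
  · have key : V * expSum a (fun i => i) (Icc 1 X) u = ∑ t ∈ box d Q X,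
        expSum (fun x => if x ∈ Icc 1 X then V * a x / W x else 0) (fun i => i) (Icc 1 X)
          (u + fun j => (t j : ZMod Q)) := by
      simp only [expSum]
      rw [sum_comm, mul_sum]
      refine sum_congr rfl fun x hx => ?_
      have hW0 : W x ≠ 0 := by
        rw [← norm_pos_iff]; linarith [hWre x hx]
      simp only [hx, if_true, phase_add, AddChar.map_add_eq_mul]
      rw [← mul_sum, ← mul_sum]
      change _ = V * a x / W x * (_ * W x)
      field_simp
    rcases Nat.eq_zero_or_pos P with rfl | hP
    · simp [hV]
    obtain ⟨P, rfl⟩ : ∃ P', P = P' + 1 := ⟨P - 1, by omega⟩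
    have h1 := pow_sum_div_card_le_sum_pow (s := box d Q X)
      (f := fun t => ‖expSum (fun x => if x ∈ Icc 1 X then V * a x / W x else 0) (fun i => i)
        (Icc 1 X) (u + fun j => (t j : ZMod Q))‖) (fun _ _ => norm_nonneg _) P
    refine le_trans ?_ h1
    rw [le_div_iff₀ (by positivity)]
    calc _ = ‖(V : ℂ) * expSum a (fun i => i) (Icc 1 X) u‖ ^ (P + 1) := by
          rw [norm_mul, Complex.norm_real, Real.norm_of_nonneg hV0.le, hV]; ring
      _ ≤ _ := by
        rw [key]
        gcongr
        exact norm_sum_le _ _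

/-! ### Counting close points -/

/-- The number of `y < Y` for which the multiples `k ξ y` are `τ`-close to each other modulo `1`. -/
lemma card_le_of_close {ξ τ : ℝ} {k q Y : ℕ} {a : ℤ} (hk : 1 ≤ k) (hq : 1 ≤ q)
    (haq : IsCoprime a q) (hξ : |ξ - a / q| ≤ 2 / (q : ℝ) ^ 2) (hτ : 0 ≤ τ) {A : Finset ℕ}
    (hA : A ⊆ range Y)
    (hclose : ∀ y ∈ A, ∀ y' ∈ A, ∃ N : ℤ, |k * ξ * ((y : ℝ) - y') - N| ≤ τ) :
    (#A : ℝ) ≤ (5 + 2 * (q * τ)) * (k * Y / q + 1) := by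
  have hq0 : (0 : ℝ) < q := by exact_mod_cast hq
  set L := (q - 1) / k + 1 with hL
  have hL0 : 0 < L := Nat.succ_pos _
  have hkL : k * (L - 1) < q := by
    have := Nat.mul_div_le (q - 1) k
    rw [hL, Nat.add_sub_cancel]; omega
  have hqL : q ≤ k * L := by
    have := Nat.lt_mul_div_succ (q - 1) hk
    rw [hL]; omega
  set H := ⌊q * τ + 2⌋₊ with hH
  have hH' : (H : ℝ) ≤ q * τ + 2 := Nat.floor_le (by positivity)
  have fiber : ∀ c ∈ A.image (· / L), #{y ∈ A | y / L = c} ≤ 2 * H + 1 := by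
    intro c hc
    obtain ⟨y₀, hy₀, rfl⟩ := mem_image.1 hc
    have diff : ∀ y y' : ℕ, y / L = y' / L → k * |(y : ℤ) - y'| < q := by
      intro y y' h
      have h1 := Nat.div_add_mod y L
      have h2 := Nat.div_add_mod y' L
      have h3 := Nat.mod_lt y hL0
      have h4 := Nat.mod_lt y' hL0
      rw [h] at h1
      have h5 : |(y : ℤ) - y'| ≤ (L - 1 : ℕ) := by rw [abs_le]; omega
      calc (k : ℤ) * |(y : ℤ) - y'| ≤ k * (L - 1 : ℕ) := by gcongr
        _ < q := by exact_mod_cast hkL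
    choose! N hN using fun y hy => hclose y hy y₀ hy₀
    have hcard : #(Icc (-(H : ℤ)) H) = 2 * H + 1 := by
      rw [Int.card_Icc]; omega
    rw [← hcard]
    refine card_le_card_of_injOn (fun y => a * k * ((y : ℤ) - y₀) - q * N y) ?_ ?_
    · intro y hy
      simp only [coe_filter, Set.mem_ofPred_eq] at hy
      have h1 := hN y hy.1
      have h2 : (k : ℝ) * |(y : ℝ) - y₀| ≤ q := by exact_mod_cast (diff y y₀ hy.2).le
      have h3 : |(a * k * ((y : ℤ) - y₀) - q * N y : ℝ)| ≤ q * τ + 2 := by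
        have e1 : (a * k * ((y : ℤ) - y₀) - q * N y : ℝ) =
            q * (k * ξ * ((y : ℝ) - y₀) - N y) - q * (k * ((y : ℝ) - y₀)) * (ξ - a / q) := by
          push_cast; field_simp; ring
        rw [e1]
        refine (abs_sub _ _).trans (add_le_add ?_ ?_)
        · rw [abs_mul, abs_of_pos hq0]; gcongr
        · rw [abs_mul, abs_mul, abs_mul, abs_of_pos hq0, abs_of_nonneg (Nat.cast_nonneg k)]
          calc _ ≤ q * (q : ℝ) * (2 / (q : ℝ) ^ 2) := by gcongr
            _ = 2 := by field_simp
      have h4 : |a * k * ((y : ℤ) - y₀) - q * N y| ≤ (H : ℤ) := by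
        have h5 : ((|a * k * ((y : ℤ) - y₀) - q * N y|).toNat : ℝ) ≤ q * τ + 2 := by
          have : ((|a * k * ((y : ℤ) - y₀) - q * N y|).toNat : ℤ) =
            |a * k * ((y : ℤ) - y₀) - q * N y| := Int.toNat_of_nonneg (abs_nonneg _)
          have h6 : ((|a * k * ((y : ℤ) - y₀) - q * N y|).toNat : ℝ) =
            ((|a * k * ((y : ℤ) - y₀) - q * N y| : ℤ) : ℝ) := by exact_mod_cast this
          rw [h6]; push_cast; push_cast at h3; exact h3
        have := Nat.le_floor h5
        omega
      rw [abs_le] at h4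
      simpa using h4
    · intro y hy y' hy' h
      simp only [coe_filter, Set.mem_ofPred_eq] at hy hy' h
      have h1 : (q : ℤ) ∣ a * (k * ((y : ℤ) - y')) := ⟨N y - N y', by linear_combination h⟩
      have h2 := (haq.symm).dvd_of_dvd_mul_left h1
      have h3 : (k : ℤ) * ((y : ℤ) - y') = 0 := by
        refine Int.eq_zero_of_abs_lt_dvd h2 ?_
        rw [abs_mul, Nat.abs_cast]
        exact diff y y' (hy.2.trans hy'.2.symm)
      have hk0 : (k : ℤ) ≠ 0 := by omega
      have := (mul_eq_zero.1 h3).resolve_left hk0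
      omega
  have h1 : #A ≤ (2 * H + 1) * (Y / L + 1) := by
    refine (card_le_mul_card_image A _ fiber).trans (Nat.mul_le_mul_left _ ?_)
    rw [← card_range (Y / L + 1)]
    refine card_le_card fun c hc => ?_
    obtain ⟨y, hy, rfl⟩ := mem_image.1 hc
    rw [mem_range, Nat.lt_succ_iff]
    exact Nat.div_le_div_right (mem_range.1 (hA hy)).le
  have h2 : ((Y / L : ℕ) : ℝ) ≤ k * Y / q := by
    refine Nat.cast_div_le.trans ?_
    rw [div_le_div_iff₀ (by exact_mod_cast hL0) hq0]
    have : (q : ℝ) ≤ k * L := by exact_mod_cast hqL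
    calc (Y : ℝ) * q ≤ Y * (k * L) := by gcongr
      _ = k * Y * L := by ring
  calc (#A : ℝ) ≤ ((2 * H + 1) * (Y / L + 1) : ℕ) := by exact_mod_cast h1
    _ = (2 * H + 1) * ((Y / L : ℕ) + 1) := by push_cast; ring
    _ ≤ (5 + 2 * (q * τ)) * (k * Y / q + 1) := by
      exact mul_le_mul (by linarith) (by linarith) (by positivity) (by positivity)

/-- Summing over translates of a box which cover each point at most `Z` times. -/
lemma sum_sum_box_le {d Q X Y : ℕ} [NeZero Q] (hX : 1 ≤ X) {β : ℕ → Fin d → ZMod Q}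
    {G : (Fin d → ZMod Q) → ℝ} (hG : ∀ u, 0 ≤ G u) {Z : ℝ}
    (hZ : ∀ u, (#{y ∈ range Y | ∃ t ∈ box d Q X, β y + (fun j => (t j : ZMod Q)) = u} : ℝ) ≤ Z) :
    ∑ y ∈ range Y, ∑ t ∈ box d Q X, G (β y + fun j => (t j : ZMod Q)) ≤ Z * ∑ u, G u := by
  classical
  have hlt : ∀ t ∈ box d Q X, ∀ j, t j < Q := fun t ht j => by
    have h1 := Fintype.mem_piFinset.1 ht j
    rw [mem_range, Nat.lt_succ_iff] at h1
    refine h1.trans_lt (Nat.div_lt_self (NeZero.pos Q) ?_)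
    have hd : 1 ≤ d := by have := j.2; omega
    have : 1 ≤ X ^ ((j : ℕ) + 1) := Nat.one_le_pow _ _ hX
    nlinarith
  have inner : ∀ y, ∑ t ∈ box d Q X, G (β y + fun j => (t j : ZMod Q)) =
      ∑ u, if ∃ t ∈ box d Q X, β y + (fun j => (t j : ZMod Q)) = u then G u else 0 := fun y => by
    rw [← sum_filter]
    refine sum_bij (fun t _ => β y + fun j => (t j : ZMod Q)) (fun t ht => ?_)
      (fun t ht t' ht' h => ?_)
      (fun u hu => ?_) (fun _ _ => rfl)
    · simpa using ⟨t, ht, rfl⟩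
    · funext j
      have hj := congrFun (add_left_cancel h) j
      simp only [ZMod.natCast_eq_natCast_iff'] at hj
      rwa [Nat.mod_eq_of_lt (hlt t ht j), Nat.mod_eq_of_lt (hlt t' ht' j)] at hj
    · obtain ⟨t, ht, h⟩ := (mem_filter.1 hu).2
      exact ⟨t, ht, h⟩
  rw [sum_congr rfl fun y _ => inner y, sum_comm, mul_sum]
  refine sum_le_sum fun u _ => ?_
  rw [← sum_filter, sum_const, nsmul_eq_mul]
  exact mul_le_mul_of_nonneg_right (by convert hZ u) (hG u)

lemma pow_le_card_box {d Q X : ℕ} (hd : 1 ≤ d) (hX : 1 ≤ X) :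
    (Q : ℝ) ^ d ≤ (6 * d) ^ d * (X : ℝ) ^ ((d * (d + 1) : ℝ) / 2) * #(box d Q X) := by
  have hX0 : (0 : ℝ) < X := by exact_mod_cast hX
  have hd0 : (0 : ℝ) < d := by exact_mod_cast hd
  have hsum : ((∑ j : Fin d, ((j : ℕ) + 1) : ℕ) : ℝ) = (d * (d + 1) : ℝ) / 2 := by
    rw [Fin.sum_univ_eq_sum_range (fun j => j + 1) d, eq_div_iff two_ne_zero]
    have h := sum_range_id_mul_two (d + 1)
    rw [sum_range_succ', add_zero, Nat.add_sub_cancel] at h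
    exact_mod_cast h.trans (mul_comm _ _)
  have hcard : (#(box d Q X) : ℝ) = ∏ j : Fin d, ((boxWidth d Q X j : ℝ) + 1) := by
    simp [box, Fintype.card_piFinset]
  have e1 : (6 * d : ℝ) ^ d * (X : ℝ) ^ ((d * (d + 1) : ℝ) / 2) =
      ∏ j : Fin d, (6 * d * (X : ℝ) ^ ((j : ℕ) + 1)) := by
    rw [prod_mul_distrib, prod_const, card_univ, Fintype.card_fin, prod_pow_eq_pow_sum, ← hsum,
      Real.rpow_natCast]
  rw [e1, hcard, ← prod_mul_distrib]
  calc (Q : ℝ) ^ d = ∏ j : Fin d, (Q : ℝ) := by simp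
    _ ≤ _ := by
      refine prod_le_prod (fun _ _ => by positivity) fun j _ => ?_
      have h := Nat.lt_mul_div_succ Q (show 0 < 6 * d * X ^ ((j : ℕ) + 1) by positivity)
      have h' : (Q : ℝ) < ((6 * d * X ^ ((j : ℕ) + 1) * (boxWidth d Q X j + 1) : ℕ) : ℝ) := by
        exact_mod_cast h
      push_cast at h'
      exact h'.le

lemma pow_clog_le {p X : ℕ} (hp : 1 < p) (hX : 1 ≤ X) : p ^ Nat.clog p X ≤ p * X := by
  rcases hX.eq_or_lt with h | h
  · rw [← h, Nat.clog_one_right, pow_zero]; omega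
  · have h5 : 0 < Nat.clog p X := Nat.clog_pos hp h
    calc p ^ Nat.clog p X = p * p ^ (Nat.clog p X).pred := by
          rw [← pow_succ', Nat.pred_eq_sub_one, Nat.sub_add_cancel h5]
      _ ≤ p * X := Nat.mul_le_mul_left _ (Nat.pow_pred_clog_lt_self hp h).le

/-- A discrete mean value over well-spaced points, at the critical exponent. -/
lemma exists_sum_norm_expSum_pow_le_of_spaced {p : ℕ} (hp : p.Prime) [NeZero p] (hp64 : 64 ≤ p)
    {d : ℕ} (hd : 1 ≤ d) (hdp : d < p) {ε : ℝ} (hε : 0 < ε) :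
    ∃ K : ℝ, 1 ≤ K ∧ ∀ (M X Y : ℕ) (a : ℕ → ℂ) (β : ℕ → Fin d → ZMod (p ^ M)) (Z : ℝ),
      1 ≤ X → d * Nat.clog p X ≤ M → (∀ i, ‖a i‖ ≤ 1) →
      (∀ u, (#{y ∈ range Y | ∃ t ∈ box d (p ^ M) X,
        β y + (fun j => (t j : ZMod (p ^ M))) = u} : ℝ) ≤ Z) →
      ∑ y ∈ range Y, ‖expSum a (fun i => i) (Icc 1 X) (β y)‖ ^ (d * (d + 1)) ≤
        K * Z * (X : ℝ) ^ ((d * (d + 1) : ℝ) + ε) := by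
  obtain ⟨K, hK, hmean⟩ := exists_sum_norm_expSum_pow_le hp hp64 hd hdp hε
  have hp0 : (0 : ℝ) < p := by exact_mod_cast hp.pos
  have hp1 : (1 : ℝ) ≤ p := by exact_mod_cast hp.one_le
  have hd1 : (1 : ℝ) ≤ d := by exact_mod_cast hd
  set g : ℝ := (d * (d + 1) : ℝ) / 2 with hg
  have hg1 : 1 ≤ g := by rw [hg]; nlinarith
  refine ⟨(6 * d) ^ d * (K * (p : ℝ) ^ (g - 1 + ε) * 2 ^ (d * (d + 1))), ?_,
    fun M X Y a β Z hX hM ha hZ => ?_⟩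
  · refine one_le_mul_of_one_le_of_one_le (one_le_pow₀ (by linarith))
      (one_le_mul_of_one_le_of_one_le (one_le_mul_of_one_le_of_one_le hK
        (Real.one_le_rpow hp1 (by linarith))) (one_le_pow₀ one_le_two))
  obtain ⟨a', ha', hbox⟩ := exists_norm_expSum_pow_le_sum_box (d := d) (Q := p ^ M) (X := X) ha
  have hX0 : (0 : ℝ) < X := by exact_mod_cast hX
  have hZ0 : 0 ≤ Z := (Nat.cast_nonneg _).trans (hZ 0)
  set B := Nat.clog p X with hB
  have h1 := hmean B M X a' 2 (Nat.le_pow_clog hp.one_lt X) hM ha'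
  have h2 := sum_sum_box_le hX (β := β)
    (G := fun u => ‖expSum a' (fun i => i) (Icc 1 X) u‖ ^ (d * (d + 1)))
    (fun _ => by positivity) hZ
  have h3 : (#(box d (p ^ M) X) : ℝ) * ∑ y ∈ range Y,
      ‖expSum a (fun i => i) (Icc 1 X) (β y)‖ ^ (d * (d + 1)) ≤
      Z * (K * (p : ℝ) ^ ((g - 1 + ε) * B) *
          (X * (2 ^ (d * (d + 1)) * (p ^ M : ℕ) ^ d))) := by
    rw [mul_sum]
    exact (sum_le_sum fun y _ => hbox (β y) _).trans (h2.trans (mul_le_mul_of_nonneg_left h1 hZ0))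
  have hpB : (p : ℝ) ^ ((g - 1 + ε) * B) ≤ (p : ℝ) ^ (g - 1 + ε) * (X : ℝ) ^ (g - 1 + ε) := by
    rw [mul_comm, Real.rpow_mul hp0.le, ← Real.mul_rpow hp0.le hX0.le, Real.rpow_natCast]
    refine Real.rpow_le_rpow (by positivity) ?_ (by linarith)
    exact_mod_cast pow_clog_le hp.one_lt hX
  have hQ0 : (0 : ℝ) < ((p ^ M : ℕ) : ℝ) ^ d := by positivity
  have h5 := pow_le_card_box (Q := p ^ M) hd hX
  set V : ℝ := ((#(box d (p ^ M) X) : ℕ) : ℝ)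
  set W := ∑ y ∈ range Y, ‖expSum a (fun i => i) (Icc 1 X) (β y)‖ ^ (d * (d + 1))
  have hW : 0 ≤ W := by positivity
  refine le_of_mul_le_mul_left ?_ hQ0
  calc _ ≤ (6 * d) ^ d * (X : ℝ) ^ g * V * W := by gcongr
    _ = (6 * d) ^ d * (X : ℝ) ^ g * (V * W) := by ring
    _ ≤ (6 * d) ^ d * (X : ℝ) ^ g * (Z * (K * ((p : ℝ) ^ (g - 1 + ε) * (X : ℝ) ^ (g - 1 + ε)) *
          (X * (2 ^ (d * (d + 1)) * (p ^ M : ℕ) ^ d)))) := by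
        refine mul_le_mul_of_nonneg_left (h3.trans ?_) (by positivity)
        gcongr
    _ = (p ^ M : ℕ) ^ d * ((6 * d) ^ d * (K * (p : ℝ) ^ (g - 1 + ε) * 2 ^ (d * (d + 1))) * Z *
          ((X : ℝ) ^ g * (X : ℝ) ^ (g - 1 + ε) * X)) := by ring
    _ = _ := by
      rw [← Real.rpow_add hX0, ← Real.rpow_add_one hX0.ne', hg]
      ring_nf

/-! ### Completion of exponential sums -/

lemma two_mul_le_sin {t : ℝ} (h0 : 0 ≤ t) (h1 : t ≤ 1) :
    2 * (t * (1 - t)) ≤ Real.sin (Real.pi * t) := by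
  have key : ∀ s : ℝ, 0 ≤ s → s ≤ 1 / 2 → 2 * (s * (1 - s)) ≤ Real.sin (Real.pi * s) := by
    intro s hs hs'
    have h := Real.mul_le_sin (x := Real.pi * s) (by positivity)
      (by nlinarith [Real.pi_pos])
    have e : 2 / Real.pi * (Real.pi * s) = 2 * s := by field_simp
    rw [e] at h
    nlinarith
  rcases le_total t (1 / 2) with h | h
  · exact key t h0 h
  · have := key (1 - t) (by linarith) (by linarith)
    rw [show Real.pi * (1 - t) = Real.pi - Real.pi * t by ring, Real.sin_pi_sub] at this
    linarith

lemma le_norm_stdAddChar_sub_one {Q c : ℕ} [NeZero Q] (hc : c ≤ Q) :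
    4 * ((c / Q : ℝ) * (1 - c / Q)) ≤ ‖(ZMod.stdAddChar (N := Q) (c : ZMod Q) : ℂ) - 1‖ := by
  have hQ : (0 : ℝ) < Q := by exact_mod_cast NeZero.pos Q
  have h := ZMod.stdAddChar_coe (N := Q) (c : ℤ)
  have e1 : (ZMod.stdAddChar (N := Q) (c : ZMod Q) : ℂ) =
      Complex.exp (Complex.I * ((2 * Real.pi * (c / Q) : ℝ) : ℂ)) := by
    rw [show (c : ZMod Q) = ((c : ℤ) : ZMod Q) by simp, h]
    congr 1
    push_cast
    ring
  rw [e1, Complex.norm_exp_I_mul_ofReal_sub_one, Real.norm_eq_abs]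
  have h2 := two_mul_le_sin (t := (c / Q : ℝ)) (by positivity)
    (by rw [div_le_one hQ]; exact_mod_cast hc)
  rw [show 2 * Real.pi * (c / Q : ℝ) / 2 = Real.pi * (c / Q) by ring]
  refine le_trans ?_ (le_abs_self _)
  linarith

lemma norm_sum_stdAddChar_le {Q c X : ℕ} [NeZero Q] (h0 : 0 < c) (hc : c < Q) :
    ‖∑ m ∈ Icc 1 X, ZMod.stdAddChar (N := Q) (-((c : ZMod Q) * m))‖ ≤
      Q / 2 * (1 / (c : ℝ) + 1 / ((Q - c : ℕ) : ℝ)) := by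
  have hQ : (0 : ℝ) < Q := by exact_mod_cast NeZero.pos Q
  have hc0 : (0 : ℝ) < c := by exact_mod_cast h0
  have hcQ : (c : ℝ) < Q := by exact_mod_cast hc
  set w : ℂ := ZMod.stdAddChar (N := Q) (-(c : ZMod Q)) with hw
  have hsum : ∑ m ∈ Icc 1 X, (ZMod.stdAddChar (N := Q) (-((c : ZMod Q) * m)) : ℂ) =
      w * ∑ m ∈ range X, w ^ m := by
    rw [mul_sum, ← Finset.Ico_add_one_right_eq_Icc, sum_Ico_eq_sum_range]
    refine sum_congr (by simp) fun m _ => ?_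
    rw [← pow_succ', hw, ← AddChar.map_nsmul_eq_pow]
    congr 1
    rw [nsmul_eq_mul]
    push_cast
    ring
  have hw1 : 4 * ((c / Q : ℝ) * (1 - c / Q)) ≤ ‖w - 1‖ := by
    have h := le_norm_stdAddChar_sub_one (Q := Q) (c := c) hc.le
    have : ‖w - 1‖ = ‖(ZMod.stdAddChar (N := Q) (c : ZMod Q) : ℂ) - 1‖ := by
      have e : (ZMod.stdAddChar (N := Q) (c : ZMod Q) : ℂ) * (w - 1) =
          -((ZMod.stdAddChar (N := Q) (c : ZMod Q) : ℂ) - 1) := by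
        have : (ZMod.stdAddChar (N := Q) (c : ZMod Q) : ℂ) * w = 1 := by
          rw [hw, ← AddChar.map_add_eq_mul, add_neg_cancel, AddChar.map_zero_eq_one]
        linear_combination this
      have h3 := congrArg norm e
      rwa [norm_mul, norm_stdAddChar, one_mul, norm_neg] at h3
    rwa [this]
  have ht : 0 < (c / Q : ℝ) * (1 - c / Q) := by
    have : (c / Q : ℝ) < 1 := by rwa [div_lt_one hQ]
    have : 0 < (c / Q : ℝ) := by positivity
    nlinarith
  have hne : w ≠ 1 := fun h => by
    rw [h, sub_self, norm_zero] at hw1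
    linarith
  have hnw : ‖w‖ = 1 := norm_stdAddChar _
  rw [hsum, norm_mul, hnw, one_mul, geom_sum_eq hne, norm_div]
  have h2 : ‖w ^ X - 1‖ ≤ 2 := by
    refine (norm_sub_le _ _).trans ?_
    rw [norm_pow, hnw, one_pow, norm_one]
    norm_num
  calc ‖w ^ X - 1‖ / ‖w - 1‖ ≤ 2 / (4 * ((c / Q : ℝ) * (1 - c / Q))) := by gcongr
    _ = _ := by
      rw [Nat.cast_sub hc.le]
      have : (Q : ℝ) - c ≠ 0 := by linarith
      field_simp
      ring

lemma sum_zmod_eq_sum_range {Q : ℕ} [NeZero Q] (f : ZMod Q → ℝ) :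
    ∑ γ, f γ = ∑ c ∈ range Q, f c :=
  sum_bij' (fun γ _ => γ.val) (fun c _ => (c : ZMod Q))
    (fun γ _ => mem_range.2 (ZMod.val_lt γ)) (fun _ _ => mem_univ _)
    (fun γ _ => ZMod.natCast_zmod_val γ)
    (fun c hc => ZMod.val_cast_of_lt (mem_range.1 hc)) (fun γ _ => by rw [ZMod.natCast_zmod_val])

lemma sum_norm_sum_stdAddChar_le {Q X : ℕ} [NeZero Q] (hX : X ≤ Q) :
    ∑ γ : ZMod Q, ‖∑ m ∈ Icc 1 X, ZMod.stdAddChar (N := Q) (-(γ * m))‖ ≤ Q * (2 + Real.log Q) := by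
  have hQ1 : 1 ≤ Q := NeZero.one_le
  rw [sum_zmod_eq_sum_range (fun γ : ZMod Q =>
    ‖∑ m ∈ Icc 1 X, ZMod.stdAddChar (N := Q) (-(γ * m))‖),
    range_eq_Ico, sum_eq_sum_Ico_succ_bot hQ1]
  have hH : ∑ c ∈ Ico 1 Q, 1 / (c : ℝ) ≤ 1 + Real.log Q := by
    have h := harmonic_le_one_add_log Q
    rw [harmonic_eq_sum_Icc] at h
    push_cast at h
    refine le_trans ?_ h
    simp only [one_div]
    exact sum_le_sum_of_subset_of_nonneg Ico_subset_Icc_self fun _ _ _ => by positivity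
  have hH' : ∑ c ∈ Ico 1 Q, 1 / ((Q - c : ℕ) : ℝ) = ∑ c ∈ Ico 1 Q, 1 / (c : ℝ) := by
    have h := sum_Ico_reflect (fun c : ℕ => 1 / (c : ℝ)) 1 (Nat.le_succ Q)
    rwa [Nat.add_sub_cancel_left, Nat.add_sub_cancel] at h
  have h0 : ‖∑ m ∈ Icc 1 X, (ZMod.stdAddChar (N := Q) (-(((0 : ℕ) : ZMod Q) * m)) : ℂ)‖ ≤ Q := by
    simpa using hX
  calc _ ≤ (Q : ℝ) + ∑ c ∈ Ico 1 Q, Q / 2 * (1 / (c : ℝ) + 1 / ((Q - c : ℕ) : ℝ)) :=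
        add_le_add h0 (sum_le_sum fun c hc => by
          rw [mem_Ico] at hc
          exact norm_sum_stdAddChar_le (by omega) hc.2)
    _ = Q + Q * ∑ c ∈ Ico 1 Q, 1 / (c : ℝ) := by
        rw [← mul_sum, sum_add_distrib, hH']; ring
    _ ≤ Q + Q * (1 + Real.log Q) := by gcongr
    _ = _ := by ring

/-- Completion: a sum over an interval in terms of sums over translates of a longer interval. -/
lemma sum_eq_completion {Q X y : ℕ} [NeZero Q] (hQ : 2 * X < Q) (hy : y < X) (g : ZMod Q → ℂ) :
    (Q : ℂ) * ∑ n ∈ Icc 1 X, g n = ∑ γ : ZMod Q,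
      (∑ m ∈ Icc 1 X, ZMod.stdAddChar (N := Q) (-(γ * m))) *
      ∑ x ∈ Icc 1 (2 * X), ZMod.stdAddChar (N := Q)
        (γ * ((x : ZMod Q) - y)) * g ((x : ZMod Q) - y) := by
  have orth : ∀ b : ZMod Q, ∑ γ : ZMod Q, (ZMod.stdAddChar (N := Q) (γ * b) : ℂ) =
      if b = 0 then (Q : ℂ) else 0 := by
    intro b
    have h := AddChar.sum_mulShift b (ZMod.isPrimitive_stdAddChar Q)
    rw [h, ZMod.card]
    split_ifs <;> simp
  simp_rw [sum_mul_sum]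
  rw [sum_comm]
  rw [mul_sum]
  refine sum_congr rfl fun m hm => ?_
  rw [sum_comm]
  rw [mem_Icc] at hm
  have h1 : ∀ x ∈ Icc 1 (2 * X), ∑ γ : ZMod Q, (ZMod.stdAddChar (N := Q) (-(γ * m)) : ℂ) *
      (ZMod.stdAddChar (N := Q) (γ * ((x : ZMod Q) - y)) * g ((x : ZMod Q) - y)) =
      if x = y + m then (Q : ℂ) * g m else 0 := by
    intro x hx
    rw [mem_Icc] at hx
    have h2 : ∀ γ : ZMod Q, (ZMod.stdAddChar (N := Q) (-(γ * m)) : ℂ) *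
      (ZMod.stdAddChar (N := Q) (γ * ((x : ZMod Q) - y)) * g ((x : ZMod Q) - y)) =
        ZMod.stdAddChar (N := Q) (γ * ((x : ZMod Q) - y - m)) * g ((x : ZMod Q) - y) := fun γ => by
      rw [← mul_assoc, ← AddChar.map_add_eq_mul]
      congr 3
      ring
    rw [sum_congr rfl fun γ _ => h2 γ, ← sum_mul, orth]
    have h3 : (x : ZMod Q) - y - m = 0 ↔ x = y + m := by
      rw [sub_sub, sub_eq_zero, ← Nat.cast_add, ZMod.natCast_eq_natCast_iff',
        Nat.mod_eq_of_lt (by omega), Nat.mod_eq_of_lt (by omega)]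
    simp only [h3]
    split_ifs with h
    · rw [h]; push_cast; rw [add_sub_cancel_left]
    · simp
  rw [sum_congr rfl h1, sum_ite_eq', if_pos (mem_Icc.2 (by omega))]

lemma exists_mul_norm_sum_le {Q X : ℕ} [NeZero Q] (hQ : 2 * X < Q) (g : ZMod Q → ℂ) :
    ∃ γ : ZMod Q, X * ‖∑ n ∈ Icc 1 X, g n‖ ≤ (2 + Real.log Q) * ∑ y ∈ range X,
      ‖∑ x ∈ Icc 1 (2 * X), ZMod.stdAddChar (N := Q)
        (γ * ((x : ZMod Q) - y)) * g ((x : ZMod Q) - y)‖ := by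
  set F : ZMod Q → ℕ → ℂ := fun γ y =>
    ∑ x ∈ Icc 1 (2 * X), ZMod.stdAddChar (N := Q)
      (γ * ((x : ZMod Q) - y)) * g ((x : ZMod Q) - y) with hF
  obtain ⟨γ₀, hγ₀⟩ := Finite.exists_max fun γ => ∑ y ∈ range X, ‖F γ y‖
  refine ⟨γ₀, ?_⟩
  have hQ0 : (0 : ℝ) < Q := by exact_mod_cast NeZero.pos Q
  refine le_of_mul_le_mul_left ?_ hQ0
  calc (Q : ℝ) * (X * ‖∑ n ∈ Icc 1 X, g n‖) = ∑ y ∈ range X, ‖(Q : ℂ) * ∑ n ∈ Icc 1 X, g n‖ := by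
        rw [sum_const, card_range, nsmul_eq_mul, norm_mul, Complex.norm_natCast]; ring
    _ ≤ ∑ y ∈ range X, ∑ γ, ‖∑ m ∈ Icc 1 X, (ZMod.stdAddChar (N := Q) (-(γ * m)) : ℂ)‖ *
        ‖F γ y‖ := by
        refine sum_le_sum fun y hy => ?_
        rw [sum_eq_completion hQ (mem_range.1 hy)]
        exact (norm_sum_le _ _).trans (sum_le_sum fun γ _ => (norm_mul _ _).le)
    _ = ∑ γ, ‖∑ m ∈ Icc 1 X, (ZMod.stdAddChar (N := Q) (-(γ * m)) : ℂ)‖ * ∑ y ∈ range X,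
        ‖F γ y‖ := by
        rw [sum_comm]; simp_rw [mul_sum]
    _ ≤ ∑ γ, ‖∑ m ∈ Icc 1 X, (ZMod.stdAddChar (N := Q) (-(γ * m)) : ℂ)‖ * ∑ y ∈ range X,
        ‖F γ₀ y‖ := by
        exact sum_le_sum fun γ _ => mul_le_mul_of_nonneg_left (hγ₀ γ) (norm_nonneg _)
    _ ≤ Q * (2 + Real.log Q) * ∑ y ∈ range X, ‖F γ₀ y‖ := by
        rw [← sum_mul]
        gcongr
        exact sum_norm_sum_stdAddChar_le (by omega)
    _ = _ := by ring

/-! ### Weyl shifts -/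

/-- The coefficients of `r (x - y) ^ (d + 1)` in degrees `1, …, d`, as a polynomial in `x`. -/
def shiftCoeff (d Q : ℕ) (r : ZMod Q) (y : ℕ) (j : Fin d) : ZMod Q :=
  r * (d + 1).choose (j + 1) * (-(y : ZMod Q)) ^ (d - j)

lemma mul_sub_pow_eq {d Q : ℕ} (r γ : ZMod Q) (x y : ℕ) :
    γ * ((x : ZMod Q) - y) + r * ((x : ZMod Q) - y) ^ (d + 1) =
      (r * x ^ (d + 1) + γ * x) + phase (shiftCoeff d Q r y) x +
        (r * (-(y : ZMod Q)) ^ (d + 1) - γ * y) := by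
  have h : phase (shiftCoeff d Q r y) x =
      ∑ j ∈ range d, r * (d + 1).choose (j + 1) * (-(y : ZMod Q)) ^ (d - j) *
        (x : ZMod Q) ^ (j + 1) := by
    rw [phase, ← Fin.sum_univ_eq_sum_range (fun j => r * ((d + 1).choose (j + 1) : ZMod Q) *
      (-(y : ZMod Q)) ^ (d - j) * (x : ZMod Q) ^ (j + 1))]
    simp [shiftCoeff]
  rw [h, sub_eq_add_neg (x : ZMod Q), add_pow, sum_range_succ, sum_range_succ']
  have h2 : r * ∑ j ∈ range d, (x : ZMod Q) ^ (j + 1) * (-(y : ZMod Q)) ^ (d + 1 - (j + 1)) *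
      ((d + 1).choose (j + 1) : ZMod Q) = ∑ j ∈ range d, r * (d + 1).choose (j + 1) *
        (-(y : ZMod Q)) ^ (d - j) * (x : ZMod Q) ^ (j + 1) := by
    rw [mul_sum]
    refine sum_congr rfl fun j _ => ?_
    rw [Nat.add_sub_add_right]
    ring
  simp only [mul_add, h2]
  simp
  ring

lemma norm_sum_eq_norm_expSum {d Q : ℕ} [NeZero Q] (r γ : ZMod Q) (S : Finset ℕ) (y : ℕ) :
    ‖∑ x ∈ S, (ZMod.stdAddChar (N := Q) (γ * ((x : ZMod Q) - y)) *
      ZMod.stdAddChar (N := Q) (r * ((x : ZMod Q) - y) ^ (d + 1)) : ℂ)‖ =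
    ‖expSum (fun x => ZMod.stdAddChar (N := Q) (r * (x : ZMod Q) ^ (d + 1) + γ * x)) (fun i => i) S
      (shiftCoeff d Q r y)‖ := by
  have h : ∑ x ∈ S, (ZMod.stdAddChar (N := Q) (γ * ((x : ZMod Q) - y)) *
      ZMod.stdAddChar (N := Q) (r * ((x : ZMod Q) - y) ^ (d + 1)) : ℂ) =
      expSum (fun x => ZMod.stdAddChar (N := Q) (r * (x : ZMod Q) ^ (d + 1) + γ * x)) (fun i => i) S
      (shiftCoeff d Q r y) * ZMod.stdAddChar (N := Q) (r * (-(y : ZMod Q)) ^ (d + 1) - γ * y) := by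
    rw [expSum, sum_mul]
    refine sum_congr rfl fun x _ => ?_
    rw [← AddChar.map_add_eq_mul, ← AddChar.map_add_eq_mul, ← AddChar.map_add_eq_mul,
      mul_sub_pow_eq]
  rw [h, norm_mul, norm_stdAddChar, mul_one]

/-- The shifted coefficient vectors are spaced, when `r / Q` is close to `a / q`. -/
lemma card_shiftCoeff_le {d Q X W q r : ℕ} [NeZero Q] {a : ℤ} (hd : 1 ≤ d) (hX : 1 ≤ X)
    (hXW : X ≤ W)
    (hq : 1 ≤ q) (haq : IsCoprime a q) (hr : |(r / Q : ℝ) - a / q| ≤ 2 / (q : ℝ) ^ 2)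
    (u : Fin d → ZMod Q) :
    (#{y ∈ range X | ∃ t ∈ box d Q W,
      shiftCoeff d Q r y + (fun j => (t j : ZMod Q)) = u} : ℝ) ≤
      (5 + 2 * (q * (1 / (X : ℝ) ^ d))) * ((d + 1 : ℕ) * X / q + 1) := by
  have hQ : (0 : ℝ) < Q := by exact_mod_cast NeZero.pos Q
  have hX0 : (0 : ℝ) < X := by exact_mod_cast hX
  refine card_le_of_close (by omega) hq haq hr (by positivity) (filter_subset _ _) ?_
  intro y hy y' hy'
  obtain ⟨t, ht, h⟩ := (mem_filter.1 hy).2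
  obtain ⟨t', ht', h'⟩ := (mem_filter.1 hy').2
  have hj := congrFun (h.trans h'.symm) ⟨d - 1, by omega⟩
  set j : Fin d := ⟨d - 1, by omega⟩ with hjd
  have hw : ∀ t ∈ box d Q W, (t j : ℝ) ≤ Q / X ^ d := by
    intro t ht
    have h1 := Fintype.mem_piFinset.1 ht j
    rw [mem_range, Nat.lt_succ_iff] at h1
    have h2 : (t j : ℝ) ≤ (boxWidth d Q W j : ℝ) := by exact_mod_cast h1
    refine h2.trans (Nat.cast_div_le.trans ?_)
    gcongr
    have h3 : X ^ d ≤ 6 * d * W ^ (d - 1 + 1) := by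
      rw [Nat.sub_add_cancel hd]
      calc X ^ d = 1 * X ^ d := by ring
        _ ≤ 6 * d * W ^ d := by gcongr; omega
    exact_mod_cast h3
  have hco : ∀ y, shiftCoeff d Q r y j = -((d + 1 : ℕ) * r * y : ZMod Q) := by
    intro y
    have : d - (d - 1) = 1 := by omega
    simp only [shiftCoeff, hjd, Nat.sub_add_cancel hd, this, pow_one]
    rw [Nat.choose_succ_self_right]
    ring
  simp only [Pi.add_apply, hco] at hj
  have hdvd : (((d + 1 : ℕ) * r * ((y : ℤ) - y') - ((t j : ℤ) - t' j) : ℤ) : ZMod Q) = 0 := by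
    push_cast at hj ⊢
    linear_combination -hj
  rw [ZMod.intCast_zmod_eq_zero_iff_dvd] at hdvd
  obtain ⟨N, hN⟩ := hdvd
  refine ⟨N, ?_⟩
  have hN' : ((d + 1 : ℕ) : ℝ) * r * ((y : ℝ) - y') - ((t j : ℝ) - t' j) = Q * N := by
    exact_mod_cast hN
  have e1 : ((d + 1 : ℕ) : ℝ) * (r / Q) * ((y : ℝ) - y') - N = ((t j : ℝ) - t' j) / Q := by
    rw [eq_div_iff hQ.ne']
    field_simp
    linear_combination hN'
  rw [e1, abs_div, abs_of_pos hQ, div_le_iff₀ hQ]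
  have h1 := hw t ht
  have h2 := hw t' ht'
  have e2 : 1 / (X : ℝ) ^ d * Q = Q / X ^ d := by ring
  rw [e2, abs_le]
  constructor <;> linarith [Nat.cast_nonneg (α := ℝ) (t j), Nat.cast_nonneg (α := ℝ) (t' j)]

/-! ### Weyl's inequality -/

lemma norm_e_sub_e_le (x y : ℝ) : ‖e x - e y‖ ≤ 2 * Real.pi * |x - y| := by
  have h1 : ∀ t : ℝ, e t = Complex.exp (Complex.I * ((2 * Real.pi * t : ℝ) : ℂ)) := fun t => by
    rw [e]; congr 1; push_cast; ring
  have h2 : e x - e y = e y * (Complex.exp (Complex.I *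
      ((2 * Real.pi * (x - y) : ℝ) : ℂ)) - 1) := by
    rw [h1, h1, mul_sub, ← Complex.exp_add, mul_one]
    congr 2
    push_cast; ring
  have h3 : ‖e y‖ = 1 := by rw [h1, Complex.norm_exp_I_mul_ofReal]
  rw [h2, norm_mul, h3, one_mul]
  refine Real.norm_exp_I_mul_ofReal_sub_one_le.trans ?_
  rw [Real.norm_eq_abs, abs_mul, abs_of_pos Real.two_pi_pos]

/-- A Weyl sum is close to a complete-modulus Weyl sum. -/
lemma norm_weylSum_le {k X Q r : ℕ} [NeZero Q] {ξ : ℝ} (hQ : 7 * X ^ (k + 1) ≤ Q)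
    (hr : |ξ - r / Q| ≤ 1 / Q) :
    ‖weylSum k X ξ‖ ≤ ‖∑ n ∈ Icc 1 X, ZMod.stdAddChar (N := Q) (r * (n : ZMod Q) ^ k)‖ + 1 := by
  have hQ0 : (0 : ℝ) < Q := by exact_mod_cast NeZero.pos Q
  have hψ : ∀ n : ℕ, (ZMod.stdAddChar (N := Q) (r * (n : ZMod Q) ^ k) : ℂ) =
      e (r / Q * (n : ℝ) ^ k) := by
    intro n
    have h := ZMod.stdAddChar_coe (N := Q) ((r * n ^ k : ℕ) : ℤ)
    rw [show (r * (n : ZMod Q) ^ k) = (((r * n ^ k : ℕ) : ℤ) : ZMod Q) by push_cast; rfl, h, e]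
    congr 1
    push_cast
    ring
  have hdiff : ‖weylSum k X ξ - ∑ n ∈ Icc 1 X, ZMod.stdAddChar (N := Q) (r * (n : ZMod Q) ^ k)‖ ≤
      1 := by
    rw [weylSum, ← sum_sub_distrib]
    calc _ ≤ ∑ n ∈ Icc 1 X, 2 * Real.pi * (1 / Q * (X : ℝ) ^ k) := by
          refine (norm_sum_le _ _).trans (sum_le_sum fun n hn => ?_)
          rw [hψ]
          refine (norm_e_sub_e_le _ _).trans ?_
          have hn' : (n : ℝ) ≤ X := by exact_mod_cast (mem_Icc.1 hn).2
          rw [← sub_mul, abs_mul, abs_of_nonneg (by positivity : (0 : ℝ) ≤ (n : ℝ) ^ k)]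
          gcongr
      _ = 2 * Real.pi * (X : ℝ) ^ (k + 1) / Q := by
          rw [sum_const, Nat.card_Icc, Nat.add_sub_cancel, nsmul_eq_mul]; ring
      _ ≤ 1 := by
          rw [div_le_one hQ0]
          have h7 : 7 * (X : ℝ) ^ (k + 1) ≤ Q := by exact_mod_cast hQ
          refine le_trans ?_ h7
          gcongr
          linarith [Real.pi_lt_d2]
  calc _ ≤ _ := norm_le_norm_add_norm_sub' _ (∑ n ∈ Icc 1 X, ZMod.stdAddChar (N := Q)
    (r * (n : ZMod Q) ^ k))
    _ ≤ _ := by gcongr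

lemma norm_sum_stdAddChar_pow_le {p : ℕ} (hp : p.Prime) [NeZero p] (hp64 : 64 ≤ p)
    {d : ℕ} (hd : 1 ≤ d) (hdp : d < p) {ε : ℝ} (hε : 0 < ε) :
    ∃ K : ℝ, 1 ≤ K ∧ ∀ (M X q r : ℕ) (a : ℤ), 1 ≤ X → 2 * X < p ^ M →
      d * Nat.clog p (2 * X) ≤ M → 1 ≤ q → IsCoprime a q →
      |(r / (p ^ M : ℕ) : ℝ) - a / q| ≤ 2 / (q : ℝ) ^ 2 →
      ‖∑ n ∈ Icc 1 X, ZMod.stdAddChar (N := p ^ M)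
        (r * (n : ZMod (p ^ M)) ^ (d + 1))‖ ^ (d * (d + 1)) ≤
        K * (2 + Real.log (p ^ M : ℕ)) ^ (d * (d + 1)) * (X : ℝ) ^ ((d * (d + 1) : ℝ) + ε) *
          (1 / q + 1 / X + q / (X : ℝ) ^ (d + 1)) := by
  obtain ⟨K, hK, hmain⟩ := exists_sum_norm_expSum_pow_le_of_spaced hp hp64 hd hdp hε
  set P := d * (d + 1) with hP
  refine ⟨K * 2 ^ ((d * (d + 1) : ℝ) + ε) * (5 * (d + 1 : ℕ) + 2 * (d + 1 : ℕ) + 5), ?_,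
    fun M X q r a hX hQ hM hq haq hr => ?_⟩
  · refine one_le_mul_of_one_le_of_one_le (one_le_mul_of_one_le_of_one_le hK
      (Real.one_le_rpow one_le_two (by positivity))) ?_
    have : (0 : ℝ) ≤ (d + 1 : ℕ) := by positivity
    linarith
  set Q := p ^ M with hQd
  have hX0 : (0 : ℝ) < X := by exact_mod_cast hX
  have hX1 : (1 : ℝ) ≤ X := by exact_mod_cast hX
  have hq0 : (0 : ℝ) < q := by exact_mod_cast hq
  have hQ1 : (1 : ℝ) ≤ Q := by exact_mod_cast (by omega : 1 ≤ Q)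
  have hL : 0 ≤ 2 + Real.log Q := by linarith [Real.log_nonneg hQ1]
  obtain ⟨γ, hγ⟩ := exists_mul_norm_sum_le hQ
    (fun z => (ZMod.stdAddChar (N := Q) ((r : ZMod Q) * z ^ (d + 1)) : ℂ))
  set f := ∑ n ∈ Icc 1 X, (ZMod.stdAddChar (N := Q) (r * (n : ZMod Q) ^ (d + 1)) : ℂ) with hf
  rw [sum_congr rfl fun y _ => norm_sum_eq_norm_expSum (r : ZMod Q) γ (Icc 1 (2 * X)) y] at hγ
  set b : ℕ → ℂ := fun x => ZMod.stdAddChar (N := Q) (r * (x : ZMod Q) ^ (d + 1) + γ * x) with hb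
  have h1 := hmain M (2 * X) X b (shiftCoeff d Q r) _ (by omega) hM
    (fun x => (norm_stdAddChar _).le)
    (card_shiftCoeff_le hd hX (by omega) hq haq hr)
  set E : ℕ → ℝ := fun y => ‖expSum b (fun i => i) (Icc 1 (2 * X)) (shiftCoeff d Q r y)‖ with hE
  set Z : ℝ := (5 + 2 * (q * (1 / (X : ℝ) ^ d))) * ((d + 1 : ℕ) * X / q + 1) with hZ
  have hP0 : P ≠ 0 := by positivity
  obtain ⟨P', hP'⟩ := Nat.exists_eq_succ_of_ne_zero hP0
  have h2 : (∑ y ∈ range X, E y) ^ P ≤ (X : ℝ) ^ P' * ∑ y ∈ range X, E y ^ P := by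
    have := pow_sum_le_card_mul_sum_pow (s := range X) (f := E) (fun _ _ => norm_nonneg _) P'
    rwa [card_range, ← Nat.succ_eq_add_one, ← hP'] at this
  have h3 : (X : ℝ) ^ P * ‖f‖ ^ P ≤ (2 + Real.log Q) ^ P * ((X : ℝ) ^ P' *
      (K * Z * ((2 * X : ℕ) : ℝ) ^ ((d * (d + 1) : ℝ) + ε))) := by
    rw [← mul_pow]
    refine (pow_le_pow_left₀ (by positivity) hγ P).trans ?_
    rw [mul_pow]
    gcongr
    exact h2.trans (by gcongr)
  have hZX : Z ≤ X * ((5 * (d + 1 : ℕ) + 2 * (d + 1 : ℕ) + 5) *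
      (1 / q + 1 / X + q / (X : ℝ) ^ (d + 1))) := by
    have e1 : Z = X * (5 * (d + 1 : ℕ) * (1 / q) + 2 * (d + 1 : ℕ) * (1 / (X : ℝ) ^ d) +
        5 * (1 / X) +
        2 * (q / (X : ℝ) ^ (d + 1))) := by
      rw [hZ]; field_simp; ring
    have e2 : 1 / (X : ℝ) ^ d ≤ 1 / X := by
      gcongr
      exact le_self_pow₀ hX1 (by omega)
    rw [e1]
    gcongr
    have hd0 : (1 : ℝ) ≤ (d + 1 : ℕ) := by exact_mod_cast (by omega : 1 ≤ d + 1)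
    have p1 : 0 ≤ 1 / (q : ℝ) := by positivity
    have p2 : 0 ≤ 1 / (X : ℝ) := by positivity
    have p3 : 0 ≤ q / (X : ℝ) ^ (d + 1) := by positivity
    nlinarith [mul_nonneg (by linarith : (0 : ℝ) ≤ (d + 1 : ℕ)) p1,
      mul_nonneg (by linarith : (0 : ℝ) ≤ (d + 1 : ℕ)) p2,
      mul_nonneg (by linarith : (0 : ℝ) ≤ (d + 1 : ℕ)) p3,
      mul_le_mul_of_nonneg_left e2 (by linarith : (0 : ℝ) ≤ (d + 1 : ℕ))]
  refine le_of_mul_le_mul_left (h3.trans ?_) (pow_pos hX0 P)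
  calc _ ≤ (2 + Real.log Q) ^ P * ((X : ℝ) ^ P' *
    (K * (X * ((5 * (d + 1 : ℕ) + 2 * (d + 1 : ℕ) + 5) *
      (1 / q + 1 / X + q / (X : ℝ) ^ (d + 1)))) *
        ((2 * X : ℕ) : ℝ) ^ ((d * (d + 1) : ℝ) + ε))) := by
        gcongr
    _ = _ := by
        have hXP : (X : ℝ) ^ P = (X : ℝ) ^ P' * X := by rw [hP', pow_succ]
        rw [Nat.cast_mul, Nat.cast_two, Real.mul_rpow zero_le_two hX0.le, hXP]
        ring

/-- **Weyl's inequality** with the exponent `1 / (k (k - 1))`. -/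
theorem weyl_inequality {d : ℕ} (hd : 1 ≤ d) {ε : ℝ} (hε : 0 < ε) :
    ∃ C : ℝ, 0 < C ∧ ∀ (X q : ℕ) (a : ℤ) (ξ : ℝ), 1 ≤ X → 1 ≤ q → q ≤ X ^ (d + 1) → 0 ≤ ξ →
      IsCoprime a q → |ξ - a / q| ≤ 1 / (q : ℝ) ^ 2 →
      ‖weylSum (d + 1) X ξ‖ ≤ C * (X : ℝ) ^ (1 + ε) *
        (1 / q + 1 / X + q / (X : ℝ) ^ (d + 1)) ^ (1 / (d * (d + 1)) : ℝ) := by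
  obtain ⟨p, hpge, hp⟩ := Nat.exists_infinite_primes (64 + d)
  have : NeZero p := ⟨hp.ne_zero⟩
  set P := d * (d + 1) with hP
  have hP1 : 1 ≤ P := Nat.mul_pos hd (by omega)
  have hPr : (P : ℝ) = d * (d + 1) := by rw [hP]; push_cast; ring
  have hP0 : (0 : ℝ) < P := by exact_mod_cast hP1
  obtain ⟨K, hK, hmain⟩ := norm_sum_stdAddChar_pow_le hp (by omega) hd (by omega)
    (show 0 < P * (ε / 2) by positivity)
  have hp0 : (0 : ℝ) < p := by exact_mod_cast hp.pos
  set η := ε / 2 with hη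
  have hη0 : 0 < η := by positivity
  set c : ℝ := 2 + (2 * d + 4 : ℕ) * ((2 * p) ^ η / η) with hc
  have hc1 : 1 ≤ c := by
    have : 0 ≤ (2 * d + 4 : ℕ) * ((2 * p : ℝ) ^ η / η) := by positivity
    linarith
  refine ⟨K * c + 1, by positivity, fun X q a ξ hX hq hqX hξ haq hξa => ?_⟩
  have hX0 : (0 : ℝ) < X := by exact_mod_cast hX
  have hX1 : (1 : ℝ) ≤ X := by exact_mod_cast hX
  have hq0 : (0 : ℝ) < q := by exact_mod_cast hq
  set B := Nat.clog p (2 * X) with hB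
  set M := B * (2 * d + 4) with hM
  set Q := p ^ M with hQ
  have hQlow : (2 * X) ^ (2 * d + 4) ≤ Q := by
    rw [hQ, hM, pow_mul]
    exact Nat.pow_le_pow_left (Nat.le_pow_clog hp.one_lt _) _
  have hQ7 : 7 * X ^ (d + 1 + 1) ≤ Q := by
    refine le_trans ?_ hQlow
    rw [mul_pow]
    refine Nat.mul_le_mul ?_ (Nat.pow_le_pow_right hX (by omega))
    calc 7 ≤ 2 ^ 4 := by norm_num
      _ ≤ 2 ^ (2 * d + 4) := Nat.pow_le_pow_right (by norm_num) (by omega)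
  have hQX : 2 * X < Q := by
    have : X ≤ X ^ (d + 1 + 1) := Nat.le_self_pow (by omega) X
    omega
  have hQq : q ^ 2 ≤ Q := by
    refine le_trans ?_ hQlow
    calc q ^ 2 ≤ (X ^ (d + 1)) ^ 2 := Nat.pow_le_pow_left hqX 2
      _ = X ^ (2 * d + 2) := by rw [← pow_mul]; ring_nf
      _ ≤ X ^ (2 * d + 4) := Nat.pow_le_pow_right hX (by omega)
      _ ≤ (2 * X) ^ (2 * d + 4) := Nat.pow_le_pow_left (by omega) _
  have hQ0 : (0 : ℝ) < Q := by exact_mod_cast (by omega : 0 < Q)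
  set r := ⌊ξ * Q⌋₊ with hr
  have hrξ : |ξ - r / Q| ≤ 1 / Q := by
    have h1 : (r : ℝ) ≤ ξ * Q := Nat.floor_le (by positivity)
    have h2 : ξ * Q < r + 1 := Nat.lt_floor_add_one _
    have e1 : ξ - r / Q = (ξ * Q - r) / Q := by field_simp
    rw [e1, abs_div, abs_of_pos hQ0]
    gcongr
    rw [abs_le]
    constructor <;> linarith
  have hra : |(r / Q : ℝ) - a / q| ≤ 2 / (q : ℝ) ^ 2 := by
    have h1 : (1 : ℝ) / Q ≤ 1 / (q : ℝ) ^ 2 := by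
      gcongr
      exact_mod_cast hQq
    calc |(r / Q : ℝ) - a / q| ≤ |(r / Q : ℝ) - ξ| + |ξ - a / q| := abs_sub_le _ _ _
      _ ≤ 1 / (q : ℝ) ^ 2 + 1 / (q : ℝ) ^ 2 := by
        rw [abs_sub_comm (r / Q : ℝ)]
        exact add_le_add (hrξ.trans h1) hξa
      _ = _ := by ring
  have hdM : d * B ≤ M := by rw [hM, mul_comm]; exact Nat.mul_le_mul_left _ (by omega)
  have h1 := hmain M X q r a hX hQX hdM hq haq hra
  have h2 := norm_weylSum_le (k := d + 1) (ξ := ξ) hQ7 hrξ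
  set f := ‖∑ n ∈ Icc 1 X, ZMod.stdAddChar (N := Q) (r * (n : ZMod Q) ^ (d + 1))‖ with hf
  set D : ℝ := 1 / q + 1 / X + q / (X : ℝ) ^ (d + 1) with hD
  have hD0 : 0 < D := by positivity
  have hlog : 2 + Real.log Q ≤ c * (X : ℝ) ^ η := by
    have h3 : (Q : ℝ) ≤ (2 * p * X) ^ (2 * d + 4) := by
      have : Q ≤ (2 * p * X) ^ (2 * d + 4) := by
        rw [hQ, hM, pow_mul]
        refine Nat.pow_le_pow_left ((pow_clog_le hp.one_lt (by omega)).trans (le_of_eq ?_)) _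
        ring
      exact_mod_cast this
    have h4 : Real.log Q ≤ (2 * d + 4 : ℕ) * ((2 * p * X) ^ η / η) := by
      refine (Real.log_le_log hQ0 h3).trans ?_
      rw [Real.log_pow]
      gcongr
      exact Real.log_le_rpow_div (by positivity) hη0
    rw [Real.mul_rpow (by positivity) hX0.le] at h4
    have h5 : 1 ≤ (X : ℝ) ^ η := Real.one_le_rpow hX1 hη0.le
    calc 2 + Real.log Q ≤ 2 * (X : ℝ) ^ η + (2 * d + 4 : ℕ) * ((2 * p) ^ η * (X : ℝ) ^ η / η) := by
          linarith
      _ = c * (X : ℝ) ^ η := by rw [hc]; ring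
  have hlog0 : 0 ≤ 2 + Real.log Q := by
    have : (1 : ℝ) ≤ Q := by exact_mod_cast (by omega : 1 ≤ Q)
    linarith [Real.log_nonneg this]
  have hσ : (D ^ (1 / (d * (d + 1)) : ℝ)) ^ P = D := by
    rw [← hPr, one_div]
    exact Real.rpow_inv_natCast_pow hD0.le (by omega)
  have hXP : ((X : ℝ) ^ (1 + ε)) ^ P = ((X : ℝ) ^ η) ^ P *
      (X : ℝ) ^ ((d * (d + 1) : ℝ) + P * η) := by
    rw [← Real.rpow_mul_natCast hX0.le, ← Real.rpow_mul_natCast hX0.le,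
      ← Real.rpow_add hX0, ← hPr, hη]
    ring_nf
  have hfle : f ≤ K * c * (X : ℝ) ^ (1 + ε) * D ^ (1 / (d * (d + 1)) : ℝ) := by
    refine le_of_pow_le_pow_left₀ (n := P) (by omega) (by positivity) (h1.trans ?_)
    rw [mul_pow _ (D ^ _), hσ, mul_pow (K * c), hXP, mul_pow K]
    have hKP : K ≤ K ^ P := le_self_pow₀ hK (by omega)
    have hcX : (2 + Real.log Q) ^ P ≤ c ^ P * ((X : ℝ) ^ η) ^ P := by
      rw [← mul_pow]; gcongr
    calc _ ≤ K ^ P * (c ^ P * ((X : ℝ) ^ η) ^ P) * (X : ℝ) ^ ((d * (d + 1) : ℝ) + P * η) * D := by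
          gcongr
      _ = _ := by ring
  have hone : 1 ≤ (X : ℝ) ^ (1 + ε) * D ^ (1 / (d * (d + 1)) : ℝ) := by
    have h3 : (X : ℝ)⁻¹ ≤ D ^ (1 / (d * (d + 1)) : ℝ) := by
      have hD1 : (X : ℝ)⁻¹ ≤ D := by
        rw [hD, ← one_div]
        have : 0 ≤ 1 / (q : ℝ) := by positivity
        have : 0 ≤ q / (X : ℝ) ^ (d + 1) := by positivity
        linarith
      calc (X : ℝ)⁻¹ = ((X : ℝ)⁻¹) ^ (1 : ℝ) := (Real.rpow_one _).symm
        _ ≤ ((X : ℝ)⁻¹) ^ (1 / (d * (d + 1)) : ℝ) := by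
          refine Real.rpow_le_rpow_of_exponent_ge (by positivity) (inv_le_one_of_one_le₀ hX1) ?_
          rw [← hPr, div_le_one hP0]
          exact_mod_cast hP1
        _ ≤ _ := Real.rpow_le_rpow (by positivity) hD1 (by positivity)
    calc (1 : ℝ) = X * (X : ℝ)⁻¹ := (mul_inv_cancel₀ hX0.ne').symm
      _ ≤ _ := by
        refine mul_le_mul ?_ h3 (by positivity) (by positivity)
        calc (X : ℝ) = (X : ℝ) ^ (1 : ℝ) := (Real.rpow_one _).symm
          _ ≤ _ := Real.rpow_le_rpow_of_exponent_le hX1 (by linarith)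
  calc _ ≤ f + 1 := h2
    _ ≤ K * c * (X : ℝ) ^ (1 + ε) * D ^ (1 / (d * (d + 1)) : ℝ) +
        (X : ℝ) ^ (1 + ε) * D ^ (1 / (d * (d + 1)) : ℝ) := add_le_add hfle hone
    _ = _ := by ring

/-! ### Minor arcs -/

/-- A minor arc point has a Dirichlet approximation with a large denominator. -/
lemma exists_approx_of_minor {k X : ℕ} {α ξ : ℝ} (hX : 1 ≤ X) (hαk : α ≤ k) (hξ : 0 ≤ ξ)
    (hminor : ∀ q a : ℕ, 1 ≤ q → (q : ℝ) ≤ (X : ℝ) ^ α → Nat.Coprime a q →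
      (X : ℝ) ^ (-(k : ℝ) + α) < |ξ - (a : ℝ) / q|) :
    ∃ (q : ℕ) (a : ℤ), 1 ≤ q ∧ (X : ℝ) ^ α < q ∧ (q : ℝ) ≤ (X : ℝ) ^ (k - α) ∧ IsCoprime a q ∧
      |ξ - a / q| ≤ 1 / (q : ℝ) ^ 2 := by
  have hX0 : (0 : ℝ) < X := by exact_mod_cast hX
  have hX1 : (1 : ℝ) ≤ X := by exact_mod_cast hX
  set n := ⌊(X : ℝ) ^ (k - α)⌋₊ with hn
  have hn1 : 1 ≤ n := Nat.le_floor (by simpa using Real.one_le_rpow hX1 (by linarith))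
  have hnX : (n : ℝ) ≤ (X : ℝ) ^ (k - α) := Nat.floor_le (by positivity)
  have hnX' : (X : ℝ) ^ (k - α) < n + 1 := Nat.lt_floor_add_one _
  obtain ⟨x, hx, hxn⟩ := Real.exists_rat_abs_sub_le_and_den_le ξ hn1
  have hq1 : 1 ≤ x.den := x.pos
  have hq0 : (0 : ℝ) < x.den := by exact_mod_cast x.pos
  have hq1' : (1 : ℝ) ≤ x.den := by exact_mod_cast x.pos
  have hqn : (x.den : ℝ) ≤ n := by exact_mod_cast hxn
  have hcast : (x : ℝ) = x.num / x.den := Rat.cast_def x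
  rw [hcast] at hx
  refine ⟨x.den, x.num, hq1, ?_, hqn.trans hnX, ?_, hx.trans ?_⟩
  · by_contra! hle
    have hnum : 0 ≤ x.num := by
      by_contra! hneg
      have h1 : (x.num : ℝ) ≤ -1 := by exact_mod_cast (by omega : x.num ≤ -1)
      have h2 : (x.num : ℝ) / x.den ≤ -1 / x.den := by gcongr
      have h3 : 1 / (x.den : ℝ) ≤ |ξ - x.num / x.den| := by
        refine le_trans ?_ (le_abs_self _)
        rw [neg_div] at h2
        linarith
      have h4 : 1 / (((n : ℝ) + 1) * x.den) < 1 / (x.den : ℝ) := by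
        gcongr
        have : (1 : ℝ) ≤ n := by exact_mod_cast hn1
        nlinarith
      linarith
    obtain ⟨a, ha⟩ := Int.eq_ofNat_of_zero_le hnum
    have hcop : Nat.Coprime a x.den := by
      have := x.reduced
      rwa [ha, Int.natAbs_natCast] at this
    have h1 := hminor x.den a hq1 hle hcop
    have h2 : (x.num : ℝ) = a := by rw [ha]; simp
    rw [h2] at hx
    have h3 : 1 / (((n : ℝ) + 1) * x.den) ≤ (X : ℝ) ^ (-(k : ℝ) + α) := by
      rw [show -(k : ℝ) + α = -(k - α) by ring, Real.rpow_neg hX0.le, one_div]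
      gcongr
      nlinarith
    linarith
  · rw [Int.isCoprime_iff_nat_coprime]
    simpa using x.reduced
  · gcongr
    rw [sq]
    gcongr
    linarith

end MinorArc

theorem minor_arc_weyl_sum_bound (k : ℕ) (hk : 2 ≤ k) (α : ℝ) (hα : 0 < α) (hα' : α < 1 / 3)
    (ε : ℝ) (hε : 0 < ε) :
    ∃ C : ℝ, 0 < C ∧ ∀ N : ℕ, 1 ≤ N → ∀ ξ ∈ Set.Icc (0 : ℝ) 1,
      (∀ q a : ℕ, 1 ≤ q → (q : ℝ) ≤ (⌊(N : ℝ) ^ ((1:ℝ)/k)⌋₊ : ℝ) ^ α → Nat.Coprime a q →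
        (⌊(N : ℝ) ^ ((1:ℝ)/k)⌋₊ : ℝ) ^ (-(k : ℝ) + α) < |ξ - (a : ℝ) / q|) →
      ‖weylSum k ⌊(N : ℝ) ^ ((1:ℝ)/k)⌋₊ ξ‖ ≤
        C * (⌊(N : ℝ) ^ ((1:ℝ)/k)⌋₊ : ℝ) ^ (1 + ε - α / (k * (k - 1)) : ℝ) := by
  obtain ⟨d, rfl⟩ : ∃ d, k = d + 1 := ⟨k - 1, by omega⟩
  have hd : 1 ≤ d := by omega
  obtain ⟨C, hC, hweyl⟩ := MinorArc.weyl_inequality hd hε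
  set σ : ℝ := 1 / (d * (d + 1)) with hσ
  have hσ0 : 0 ≤ σ := by positivity
  refine ⟨C * 3 ^ σ, by positivity, fun N hN ξ hξ hminor => ?_⟩
  set X := ⌊(N : ℝ) ^ ((1 : ℝ) / (d + 1 : ℕ))⌋₊ with hX
  have hX1 : 1 ≤ X := Nat.le_floor (by
    simpa using Real.one_le_rpow (by exact_mod_cast hN : (1 : ℝ) ≤ N)
      (by positivity : (0 : ℝ) ≤ 1 / (d + 1 : ℕ)))
  have hX0 : (0 : ℝ) < X := by exact_mod_cast hX1
  have hX1' : (1 : ℝ) ≤ X := by exact_mod_cast hX1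
  have hd1 : (1 : ℝ) ≤ (d + 1 : ℕ) := by exact_mod_cast (by omega : 1 ≤ d + 1)
  obtain ⟨q, a, hq, hqlow, hqup, haq, hξq⟩ :=
    MinorArc.exists_approx_of_minor hX1 (by linarith) hξ.1 hminor
  have hqX : q ≤ X ^ (d + 1) := by
    have : (q : ℝ) ≤ (X : ℝ) ^ ((d + 1 : ℕ) : ℝ) :=
      hqup.trans (Real.rpow_le_rpow_of_exponent_le hX1' (by linarith))
    rw [Real.rpow_natCast] at this
    exact_mod_cast this
  refine (hweyl X q a ξ hX1 hq hqX hξ.1 haq hξq).trans ?_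
  have hD : (1 / q + 1 / X + q / (X : ℝ) ^ (d + 1) : ℝ) ≤ 3 * (X : ℝ) ^ (-α) := by
    have h1 : 1 / (q : ℝ) ≤ (X : ℝ) ^ (-α) := by
      rw [Real.rpow_neg hX0.le, one_div]
      gcongr
    have h2 : 1 / (X : ℝ) ≤ (X : ℝ) ^ (-α) := by
      rw [one_div, ← Real.rpow_neg_one]
      exact Real.rpow_le_rpow_of_exponent_le hX1' (by linarith)
    have h3 : q / (X : ℝ) ^ (d + 1) ≤ (X : ℝ) ^ (-α) := by
      rw [div_le_iff₀ (by positivity), ← Real.rpow_natCast, ← Real.rpow_add hX0]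
      exact hqup.trans (Real.rpow_le_rpow_of_exponent_le hX1' (by linarith))
    linarith
  calc _ ≤ C * (X : ℝ) ^ (1 + ε) * (3 * (X : ℝ) ^ (-α)) ^ σ := by gcongr
    _ = C * 3 ^ σ * ((X : ℝ) ^ (1 + ε) * (X : ℝ) ^ (-α * σ)) := by
        rw [Real.mul_rpow (by norm_num) (by positivity), ← Real.rpow_mul hX0.le]; ring
    _ = _ := by
        rw [← Real.rpow_add hX0]
        congr 2
        rw [hσ]
        push_cast
        rw [add_sub_cancel_right]
        ring
end

section
/- For k ≥ 2, d ≥ 2^{k+1}, α ∈ (0,1/3) and X ≥ 1, the tail of the singular series satisfies |∑_{q > X^α} ∑_{1 ≤ a ≤ q, (a,q)=1} G(a/q)^d e^{−2πi N a/q}| ≤ C_k X^{−α/10}, uniformly in N ∈ ℕ, where C_k depends only on k. -/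
noncomputable def warGauss (k q a : ℕ) : ℂ :=
  (q : ℂ)⁻¹ * ∑ r ∈ Finset.Icc 1 q, e ((a : ℝ) * (r : ℝ) ^ k / (q : ℝ))

noncomputable def innerSum (k d N q : ℕ) : ℂ :=
  ∑ a ∈ (Finset.Icc 1 q).filter (fun a => Nat.Coprime a q),
    (warGauss k q a) ^ d * e (-((N : ℝ) * a / q))

open Finset Polynomial in
/-- Differencing a polynomial of degree at most `n + 2` multiplies the leading coefficient by
`(n + 2) h`. -/
lemma coeff_taylor_sub_self {R : Type*} [CommRing R] {f : R[X]} {n : ℕ}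
    (hf : f.natDegree ≤ n + 2) (h : R) :
    (taylor h f - f).coeff (n + 1) = ((n + 2 : ℕ) : R) * (h * f.coeff (n + 2)) := by
  have hd : (hasseDeriv (n + 1) f).natDegree < 2 := by
    have := natDegree_hasseDeriv_le f (n + 1)
    omega
  rw [coeff_sub, taylor_coeff, eval_eq_sum_range' hd]
  simp only [sum_range_succ, sum_range_zero, hasseDeriv_coeff]
  have hc : (1 + (n + 1)).choose (n + 1) = n + 2 := by
    rw [add_comm 1 (n + 1), Nat.choose_succ_self_right]
  rw [hc, show 1 + (n + 1) = n + 2 by ring]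
  simp
  ring

open Polynomial in
lemma natDegree_taylor_sub_self_le {R : Type*} [CommRing R] {f : R[X]} {n : ℕ}
    (hf : f.natDegree ≤ n + 1) (h : R) : (taylor h f - f).natDegree ≤ n := by
  rw [natDegree_le_iff_coeff_eq_zero]
  intro N hN
  rcases Nat.lt_or_ge (n + 1) N with h1 | h1
  · rw [coeff_sub, coeff_eq_zero_of_natDegree_lt (by rw [natDegree_taylor]; omega),
      coeff_eq_zero_of_natDegree_lt (by omega), sub_zero]
  · obtain rfl : N = n + 1 := by omega
    have hd : (hasseDeriv (n + 1) f).natDegree < 1 := by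
      have := natDegree_hasseDeriv_le f (n + 1)
      omega
    rw [coeff_sub, taylor_coeff, eval_eq_sum_range' hd]
    simp [hasseDeriv_coeff]

open Polynomial in
/-- The Weyl differencing inequality for complete exponential sums. -/
lemma norm_sum_addChar_eval_sq_le {R : Type*} [CommRing R] [Fintype R]
    (ψ : AddChar R ℂ) (f : R[X]) :
    ‖∑ x, ψ (f.eval x)‖ ^ 2 ≤ ∑ h, ‖∑ x, ψ ((taylor h f - f).eval x)‖ := by
  have key : (∑ x, ψ (f.eval x)) * (starRingEnd ℂ) (∑ x, ψ (f.eval x)) =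
      ∑ h, ∑ x, ψ ((taylor h f - f).eval x) := by
    rw [map_sum, Finset.sum_mul_sum, Finset.sum_comm]
    conv_rhs => rw [Finset.sum_comm]
    refine Finset.sum_congr rfl fun x _ => ?_
    rw [← Equiv.sum_comp (Equiv.addLeft x)]
    refine Finset.sum_congr rfl fun h _ => ?_
    rw [← AddChar.map_neg_eq_conj, ← AddChar.map_add_eq_mul]
    simp [taylor_eval, sub_eq_add_neg]
  calc ‖∑ x, ψ (f.eval x)‖ ^ 2
      = ‖(∑ x, ψ (f.eval x)) * (starRingEnd ℂ) (∑ x, ψ (f.eval x))‖ := by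
        rw [norm_mul, RCLike.norm_conj, sq]
    _ ≤ _ := by rw [key]; exact norm_sum_le _ _

lemma sum_range_natCast_zmod {M : Type*} [AddCommMonoid M] (q : ℕ) [NeZero q] (F : ZMod q → M) :
    ∑ i ∈ Finset.range q, F i = ∑ x, F x := by
  refine Finset.sum_bij' (fun i _ => (i : ZMod q)) (fun x _ => x.val) ?_ ?_ ?_ ?_ ?_
  · simp
  · intro x _; simpa using ZMod.val_lt x
  · intro i hi; exact ZMod.val_cast_of_lt (by simpa using hi)
  · simp
  · simp

lemma sum_Icc_natCast_zmod {M : Type*} [AddCommMonoid M] (q : ℕ) [NeZero q] (F : ZMod q → M) :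
    ∑ i ∈ Finset.Icc 1 q, F i = ∑ x, F x := by
  rw [← Equiv.sum_comp (Equiv.addRight (1 : ZMod q)), ← sum_range_natCast_zmod,
    Finset.range_eq_Ico, ← Finset.Ico_succ_right_eq_Icc]
  simpa using (Finset.sum_Ico_add' (fun i : ℕ => F i) 0 q 1).symm

lemma gcd_natCast_val (q a : ℕ) : Nat.gcd (a : ZMod q).val q = Nat.gcd a q := by
  rw [ZMod.val_natCast, Nat.gcd_comm, Nat.gcd_comm a, Nat.gcd_rec, Nat.mod_mod, ← Nat.gcd_rec]

lemma gcd_val_mul_le (q : ℕ) [NeZero q] (a b : ZMod q) :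
    Nat.gcd (a * b).val q ≤ Nat.gcd a.val q * Nat.gcd b.val q := by
  have h : a * b = ((a.val * b.val : ℕ) : ZMod q) := by simp
  rw [h, gcd_natCast_val]
  exact Nat.le_of_dvd (Nat.mul_pos (Nat.gcd_pos_of_pos_right _ (NeZero.pos q))
    (Nat.gcd_pos_of_pos_right _ (NeZero.pos q))) (Nat.gcd_mul_left_dvd_mul_gcd _ _ _)

/-- Pillai's gcd-sum is at most `q τ(q)`. -/
lemma sum_gcd_val_le (q : ℕ) [NeZero q] :
    ∑ h : ZMod q, Nat.gcd h.val q ≤ q * q.divisors.card := by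
  rw [← sum_Icc_natCast_zmod]
  simp only [gcd_natCast_val]
  calc ∑ i ∈ Finset.Icc 1 q, Nat.gcd i q
      ≤ ∑ i ∈ Finset.Icc 1 q, ∑ d ∈ q.divisors, if d ∣ i then d else 0 := by
        refine Finset.sum_le_sum fun i _ => ?_
        have := Finset.single_le_sum (f := fun d => if d ∣ i then d else 0)
          (fun d _ => Nat.zero_le _)
          (Nat.mem_divisors.2 ⟨Nat.gcd_dvd_right i q, NeZero.ne q⟩)
        simpa [Nat.gcd_dvd_left] using this
    _ = ∑ d ∈ q.divisors, q / d * d := by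
        rw [Finset.sum_comm]
        refine Finset.sum_congr rfl fun d _ => ?_
        rw [← Finset.sum_filter, Finset.sum_const, smul_eq_mul]
        congr 1
        exact Nat.Ioc_filter_dvd_card_eq_div q d
    _ ≤ ∑ d ∈ q.divisors, q := Finset.sum_le_sum fun d _ => Nat.div_mul_le_self q d
    _ = q * q.divisors.card := by rw [Finset.sum_const, smul_eq_mul, mul_comm]

open Polynomial in
/-- Weyl's inequality for complete exponential sums. -/
lemma norm_sum_addChar_eval_pow_le (q : ℕ) [NeZero q] {ψ : AddChar (ZMod q) ℂ}
    (hψ : ψ.IsPrimitive) (m : ℕ) (f : (ZMod q)[X]) (hf : f.natDegree ≤ m + 1) :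
    ‖∑ x, ψ (f.eval x)‖ ^ 2 ^ m * q ≤ (q : ℝ) ^ 2 ^ m *
      ((m + 1).factorial * q.divisors.card ^ m * Nat.gcd (f.coeff (m + 1)).val q : ℕ) := by
  have hq : (0 : ℝ) < q := by exact_mod_cast NeZero.pos q
  induction m generalizing f with
  | zero =>
    have hS : ∑ x, ψ (f.eval x) = ψ (f.coeff 0) * ∑ x, ψ (x * f.coeff 1) := by
      rw [Finset.mul_sum]
      refine Finset.sum_congr rfl fun x _ => ?_
      rw [← AddChar.map_add_eq_mul, eval_eq_sum_range' (n := 2) (by omega)]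
      simp [Finset.sum_range_succ, mul_comm]
    rw [hS, AddChar.sum_mulShift _ hψ, norm_mul, AddChar.norm_apply]
    by_cases h : f.coeff 1 = 0 <;> simp [h]
  | succ m ih =>
    set c := f.coeff (m + 1 + 1)
    have h1 : ‖∑ x, ψ (f.eval x)‖ ^ 2 ^ (m + 1) * q ≤
        (q : ℝ) ^ 2 ^ m * ∑ h, ‖∑ x, ψ ((taylor h f - f).eval x)‖ ^ 2 ^ m := by
      obtain ⟨n, hn⟩ : ∃ n, 2 ^ m = n + 1 := Nat.exists_eq_add_one.2 (by positivity)
      have hJ := pow_sum_div_card_le_sum_pow (s := Finset.univ)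
        (f := fun h => ‖∑ x, ψ ((taylor h f - f).eval x)‖) (fun _ _ => norm_nonneg _) n
      rw [Finset.card_univ, ZMod.card, div_le_iff₀ (by positivity)] at hJ
      have hW := pow_le_pow_left₀ (by positivity) (norm_sum_addChar_eval_sq_le ψ f) (n + 1)
      rw [pow_succ 2 m, mul_comm (2 ^ m) 2, pow_mul, hn]
      calc _ ≤ _ := mul_le_mul_of_nonneg_right (hW.trans hJ) hq.le
        _ = _ := by ring
    have h2 : (∑ h, ‖∑ x, ψ ((taylor h f - f).eval x)‖ ^ 2 ^ m) * q ≤ (q : ℝ) ^ 2 ^ m *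
        (((m + 2).factorial * q.divisors.card ^ (m + 1) * Nat.gcd c.val q : ℕ) * q) := by
      rw [Finset.sum_mul]
      calc _ ≤ ∑ h : ZMod q, (q : ℝ) ^ 2 ^ m * ((m + 1).factorial * q.divisors.card ^ m *
              Nat.gcd ((taylor h f - f).coeff (m + 1)).val q : ℕ) :=
            Finset.sum_le_sum fun h _ => ih _ (natDegree_taylor_sub_self_le hf h)
        _ = (q : ℝ) ^ 2 ^ m * (∑ h : ZMod q, (m + 1).factorial * q.divisors.card ^ m *
              Nat.gcd ((taylor h f - f).coeff (m + 1)).val q : ℕ) := by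
            rw [← Finset.mul_sum]; push_cast; rfl
        _ ≤ _ := by
            refine mul_le_mul_of_nonneg_left ?_ (by positivity)
            rw [← Nat.cast_mul]
            refine Nat.cast_le.2 ?_
            rw [← Finset.mul_sum]
            have hg (h : ZMod q) : Nat.gcd ((taylor h f - f).coeff (m + 1)).val q ≤
                (m + 2) * Nat.gcd c.val q * Nat.gcd h.val q := by
              rw [coeff_taylor_sub_self hf]
              have hm : Nat.gcd ((m + 2 : ℕ) : ZMod q).val q ≤ m + 2 := by
                rw [gcd_natCast_val]
                exact Nat.gcd_le_left _ (by omega)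
              calc _ ≤ _ := gcd_val_mul_le q _ _
                _ ≤ (m + 2) * (Nat.gcd h.val q * Nat.gcd c.val q) :=
                  Nat.mul_le_mul hm (gcd_val_mul_le q _ _)
                _ = _ := by ring
            calc _ ≤ (m + 1).factorial * q.divisors.card ^ m *
                  ((m + 2) * Nat.gcd c.val q * (q * q.divisors.card)) := by
                  gcongr
                  refine (Finset.sum_le_sum fun h _ => hg h).trans ?_
                  rw [← Finset.mul_sum]
                  gcongr
                  exact sum_gcd_val_le q
              _ = _ := by rw [Nat.factorial_succ (m + 1)]; ring
    have h3 := le_of_mul_le_mul_right (h2.trans_eq (mul_assoc _ _ _).symm) hq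
    calc _ ≤ _ := h1
      _ ≤ _ := mul_le_mul_of_nonneg_left h3 (by positivity)
      _ = _ := by rw [pow_succ 2 m, mul_two, pow_add]; ring

/-- The divisor bound: every power of the number of divisors of `n` is `O(n)`. -/
lemma exists_card_divisors_pow_le (j : ℕ) :
    ∃ C : ℕ, ∀ n : ℕ, n ≠ 0 → n.divisors.card ^ j ≤ C * n := by
  set M := j.factorial * 2 ^ j
  have hM : 1 ≤ M := Nat.mul_pos j.factorial_pos (by positivity)
  have hsmall (a : ℕ) : (a + 1) ^ j ≤ M * 2 ^ a := by
    calc (a + 1) ^ j ≤ (a + 1).ascFactorial j := Nat.pow_succ_le_ascFactorial _ _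
      _ = j.factorial * (a + j).choose j := Nat.ascFactorial_eq_factorial_mul_choose _ _
      _ ≤ j.factorial * 2 ^ (a + j) := Nat.mul_le_mul_left _ (Nat.choose_le_two_pow _ _)
      _ = _ := by rw [pow_add]; ring
  refine ⟨M ^ 2 ^ j, fun n hn => ?_⟩
  calc n.divisors.card ^ j
      = ∏ p ∈ n.primeFactors, (n.factorization p + 1) ^ j := by
        rw [Nat.card_divisors hn, Finset.prod_pow]
    _ ≤ ∏ p ∈ n.primeFactors, (if p < 2 ^ j then M else 1) * p ^ n.factorization p := by
        refine Finset.prod_le_prod' fun p hp => ?_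
        split_ifs with h
        · refine (hsmall _).trans ?_
          gcongr
          exact (Nat.prime_of_mem_primeFactors hp).two_le
        · rw [one_mul]
          calc (n.factorization p + 1) ^ j ≤ (2 ^ n.factorization p) ^ j :=
                Nat.pow_le_pow_left Nat.lt_two_pow_self _
            _ = (2 ^ j) ^ n.factorization p := by rw [← pow_mul, ← pow_mul, mul_comm]
            _ ≤ _ := Nat.pow_le_pow_left (not_lt.1 h) _
    _ = M ^ (n.primeFactors.filter (· < 2 ^ j)).card * n := by
        rw [Finset.prod_mul_distrib, ← Finset.prod_filter, Finset.prod_const]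
        congr 1
        exact Nat.prod_factorization_pow_eq_self hn
    _ ≤ M ^ 2 ^ j * n := by
        gcongr
        calc _ ≤ (Finset.range (2 ^ j)).card :=
              Finset.card_le_card fun p hp => by simpa using (Finset.mem_filter.1 hp).2
          _ = _ := Finset.card_range _

lemma norm_e (x : ℝ) : ‖e x‖ = 1 := by
  rw [e, show 2 * Real.pi * Complex.I * x = ((2 * Real.pi * x : ℝ) : ℂ) * Complex.I by
    push_cast; ring, Complex.norm_exp_ofReal_mul_I]

lemma norm_warGauss_le_one (k q a : ℕ) : ‖warGauss k q a‖ ≤ 1 := by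
  rw [warGauss, norm_mul, norm_inv, Complex.norm_natCast]
  have : ‖∑ r ∈ Finset.Icc 1 q, e ((a : ℝ) * (r : ℝ) ^ k / (q : ℝ))‖ ≤ q := by
    refine (norm_sum_le _ _).trans ?_
    simp [norm_e]
  exact inv_mul_le_one_of_le₀ this (by positivity)

lemma warGauss_eq_sum_stdAddChar (k q a : ℕ) [NeZero q] :
    warGauss k q a = (q : ℂ)⁻¹ * ∑ x : ZMod q, ZMod.stdAddChar ((a : ZMod q) * x ^ k) := by
  rw [warGauss, ← sum_Icc_natCast_zmod]
  congr 1
  refine Finset.sum_congr rfl fun r _ => ?_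
  rw [show (a : ZMod q) * (r : ZMod q) ^ k = ((a * r ^ k : ℤ) : ZMod q) by push_cast; rfl,
    ZMod.stdAddChar_coe, e]
  congr 1
  push_cast
  ring

open Polynomial in
lemma norm_warGauss_pow_le {m q a : ℕ} (hq : q ≠ 0) (ha : a.Coprime q) :
    ‖warGauss (m + 1) q a‖ ^ 2 ^ m * q ≤
      ((m + 1).factorial * q.divisors.card ^ m : ℕ) := by
  have : NeZero q := ⟨hq⟩
  have hq0 : (0 : ℝ) < q := by exact_mod_cast NeZero.pos q
  have h := norm_sum_addChar_eval_pow_le q (ZMod.isPrimitive_stdAddChar q) m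
    (C (a : ZMod q) * X ^ (m + 1)) (natDegree_C_mul_X_pow_le _ _)
  rw [coeff_C_mul_X_pow, if_pos rfl, gcd_natCast_val, ha, mul_one] at h
  simp only [eval_mul, eval_C, eval_pow, eval_X] at h
  rw [warGauss_eq_sum_stdAddChar, norm_mul, norm_inv, Complex.norm_natCast, mul_pow, mul_assoc,
    inv_pow, inv_mul_le_iff₀ (by positivity)]
  exact h

lemma exists_norm_innerSum_le {k : ℕ} (hk : 1 ≤ k) :
    ∃ C : ℝ, 0 < C ∧ ∀ d : ℕ, 2 ^ (k + 1) ≤ d → ∀ N q : ℕ, q ≠ 0 →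
      ‖innerSum k d N q‖ ≤ C * ((q : ℝ) ^ 2)⁻¹ := by
  obtain ⟨m, rfl⟩ : ∃ m, k = m + 1 := ⟨k - 1, by omega⟩
  obtain ⟨D, hD⟩ := exists_card_divisors_pow_le (m * 4)
  refine ⟨(m + 1).factorial ^ 4 * D + 1, by positivity, fun d hd N q hq => ?_⟩
  have hq0 : (0 : ℝ) < q := by exact_mod_cast Nat.pos_of_ne_zero hq
  have hG {a : ℕ} (ha : a.Coprime q) :
      ‖warGauss (m + 1) q a‖ ^ d ≤ ((m + 1).factorial ^ 4 * D + 1) * ((q : ℝ) ^ 3)⁻¹ := by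
    refine (pow_le_pow_of_le_one (norm_nonneg _) (norm_warGauss_le_one _ _ _) hd).trans ?_
    have h4 := pow_le_pow_left₀ (by positivity) (norm_warGauss_pow_le (m := m) hq ha) 4
    have hD' : ((q.divisors.card : ℝ)) ^ (m * 4) ≤ D * q := by exact_mod_cast hD q hq
    rw [mul_pow, ← pow_mul, show 2 ^ m * 4 = 2 ^ (m + 1 + 1) by ring] at h4
    push_cast at h4
    rw [mul_pow, ← pow_mul] at h4
    rw [← div_eq_mul_inv, le_div_iff₀ (by positivity)]
    refine le_of_mul_le_mul_right ?_ hq0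
    calc _ = ‖warGauss (m + 1) q a‖ ^ 2 ^ (m + 1 + 1) * (q : ℝ) ^ 4 := by ring
      _ ≤ _ := h4
      _ ≤ ((m + 1).factorial : ℝ) ^ 4 * (D * q) := by gcongr
      _ ≤ _ := by nlinarith
  calc ‖innerSum (m + 1) d N q‖
      ≤ ∑ a ∈ (Finset.Icc 1 q).filter (fun a => Nat.Coprime a q),
          ((m + 1).factorial ^ 4 * D + 1) * ((q : ℝ) ^ 3)⁻¹ := by
        refine (norm_sum_le _ _).trans (Finset.sum_le_sum fun a ha => ?_)
        rw [norm_mul, norm_e, mul_one, norm_pow]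
        exact hG (Finset.mem_filter.1 ha).2
    _ ≤ q * (((m + 1).factorial ^ 4 * D + 1) * ((q : ℝ) ^ 3)⁻¹) := by
        rw [Finset.sum_const, nsmul_eq_mul]
        gcongr
        exact (Finset.card_filter_le _ _).trans (by simp)
    _ = _ := by field_simp

theorem singular_series_tail_bound (k : ℕ) (hk : 2 ≤ k) (α : ℝ) (hα : 0 < α)
    (hα' : α < 1 / 3) :
    ∃ C : ℝ, 0 < C ∧ ∀ d : ℕ, 2 ^ (k + 1) ≤ d → ∀ X : ℝ, 1 ≤ X → ∀ N : ℕ,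
      ‖∑' q : ℕ, if X ^ α < (q : ℝ) then innerSum k d N q else 0‖ ≤
        C * X ^ (-α / 10) := by
  obtain ⟨C, hC, hbound⟩ := exists_norm_innerSum_le (k := k) (by omega)
  have hs : Summable fun q : ℕ => (q : ℝ) ^ (-(19 / 10) : ℝ) :=
    Real.summable_nat_rpow.2 (by norm_num)
  have hs0 : 0 ≤ ∑' q : ℕ, (q : ℝ) ^ (-(19 / 10) : ℝ) := tsum_nonneg fun q => by positivity
  refine ⟨C * (∑' q : ℕ, (q : ℝ) ^ (-(19 / 10) : ℝ) + 1), by positivity,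
    fun d hd X hX N => ?_⟩
  have hX0 : 0 < X := by linarith
  have hterm (q : ℕ) : ‖if X ^ α < (q : ℝ) then innerSum k d N q else 0‖ ≤
      C * X ^ (-α / 10) * (q : ℝ) ^ (-(19 / 10) : ℝ) := by
    split_ifs with h
    · have hXα : 0 < X ^ α := Real.rpow_pos_of_pos hX0 α
      have hq0 : (0 : ℝ) < q := hXα.trans h
      have hdecay : (q : ℝ) ^ (-(1 / 10) : ℝ) ≤ X ^ (-α / 10) := by
        rw [show -α / 10 = α * (-(1 / 10)) by ring, Real.rpow_mul hX0.le]
        exact Real.rpow_le_rpow_of_nonpos hXα h.le (by norm_num)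
      calc _ ≤ C * ((q : ℝ) ^ 2)⁻¹ := hbound d hd N q (by exact_mod_cast hq0.ne')
        _ = C * (q : ℝ) ^ (-(1 / 10) : ℝ) * (q : ℝ) ^ (-(19 / 10) : ℝ) := by
            rw [mul_assoc, ← Real.rpow_add hq0, ← Real.rpow_natCast, ← Real.rpow_neg hq0.le]
            norm_num
        _ ≤ _ := by gcongr
    · rw [norm_zero]
      positivity
  refine (tsum_of_norm_bounded (hs.hasSum.mul_left _) hterm).trans ?_
  have : 0 < X ^ (-α / 10) := Real.rpow_pos_of_pos hX0 _
  nlinarith [mul_pos hC this]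
end
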